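/- There exist constants C > 0 and K > 0 such that for all sufficiently large x: if C/log x ≤ g ≤ 1/10 and 1/(g·log x) ≤ ε ≤ 1/4, then the number of integers n ≤ x for which λ(n) has no prime divisor in (x^g, x^{g(1+ε)}] is at most K·g^{ε/2}·log(1/g)·x. -/

import Mathlib

open scoped Classical

open Filter

/-- The Carmichael function: the exponent of the unit group `(ℤ/nℤ)ˣ`. -/
noncomputable def carmichael (n : ℕ) : ℕ := Monoid.exponent (ZMod n)ˣ

section

open Finset
open scoped ArithmeticFunction.vonMangoldt

theorem sum_vonMangoldt_mul_div (N : ℕ) :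
    ∑ k ∈ Ioc 0 N, Λ k * ((N / k : ℕ) : ℝ) = Real.log (N.factorial : ℝ) := by
  have h : ∀ M : ℕ, Real.log (M.factorial : ℝ) = ∑ n ∈ Ioc 0 M, Real.log n := by
    intro M
    induction M with
    | zero => simp
    | succ k ih =>
      rw [Nat.factorial_succ, Nat.cast_mul, Real.log_mul (by positivity) (by positivity), ih,
        Finset.sum_Ioc_succ_top (by omega)]
      ring
  rw [h]
  have h2 : ∀ n ∈ Ioc 0 N, Real.log n = ∑ k ∈ Ioc 0 N, if k ∣ n then Λ k else 0 := by
    intro n hn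
    rw [mem_Ioc] at hn
    rw [← ArithmeticFunction.vonMangoldt_sum, ← Finset.sum_filter]
    apply Finset.sum_congr _ fun _ _ => rfl
    ext k
    simp only [Nat.mem_divisors, mem_filter, mem_Ioc]
    constructor
    · rintro ⟨h1, h2⟩
      exact ⟨⟨Nat.pos_of_dvd_of_pos h1 hn.1, (Nat.le_of_dvd hn.1 h1).trans hn.2⟩, h1⟩
    · rintro ⟨h1, h2⟩
      exact ⟨h2, by omega⟩
  rw [Finset.sum_congr rfl h2, Finset.sum_comm]
  apply Finset.sum_congr rfl
  intro k hk
  rw [← Finset.sum_filter, Finset.sum_const, Nat.Ioc_filter_dvd_card_eq_div, nsmul_eq_mul]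
  ring

theorem log_factorial_ge (N : ℕ) : N * Real.log N - N ≤ Real.log (N.factorial : ℝ) := by
  rcases Nat.eq_zero_or_pos N with rfl | hN
  · simp
  have := Stirling.le_log_factorial_stirling (n := N) (by omega)
  have h1 : 0 ≤ Real.log N := Real.log_natCast_nonneg N
  have h2 : 0 ≤ Real.log (2 * Real.pi) := Real.log_nonneg (by linarith [Real.pi_gt_three])
  linarith

theorem log_factorial_le (N : ℕ) (hN : 1 ≤ N) :
    Real.log (N.factorial : ℝ) ≤ N * Real.log N - N + Real.log N + 1 := by
  induction N, hN using Nat.le_induction with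
  | base => simp
  | succ k hk ih =>
    rw [Nat.factorial_succ, Nat.cast_mul, Real.log_mul (by positivity) (by positivity)]
    have hk0 : (0 : ℝ) < k := by exact_mod_cast hk
    have h1 : Real.log ((k : ℝ) / (k + 1)) ≤ (k : ℝ) / (k + 1) - 1 :=
      Real.log_le_sub_one_of_pos (by positivity)
    rw [Real.log_div (by positivity) (by positivity)] at h1
    have h2 : ((k : ℝ) + 1) * (Real.log k - Real.log (k + 1)) ≤ -1 := by
      calc ((k : ℝ) + 1) * (Real.log k - Real.log (k + 1))
          ≤ (k + 1) * ((k : ℝ) / (k + 1) - 1) := by gcongr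
        _ = -1 := by field_simp; ring
    push_cast
    linarith

theorem psi_natCast (n : ℕ) : Chebyshev.psi n = ∑ k ∈ Ioc 0 n, Λ k := by
  simp [Chebyshev.psi]

theorem chebyshev_combination (m : ℕ) :
    ∑ k ∈ Ioc 0 (30 * m), Λ k * (((30 * m / k : ℕ) : ℝ) - (15 * m / k : ℕ) - (10 * m / k : ℕ)
      - (6 * m / k : ℕ) + (m / k : ℕ)) =
    Real.log ((30 * m).factorial : ℝ) - Real.log ((15 * m).factorial : ℝ)
      - Real.log ((10 * m).factorial : ℝ) - Real.log ((6 * m).factorial : ℝ)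
      + Real.log (m.factorial : ℝ) := by
  have key : ∀ j : ℕ, j ≤ 30 * m →
      ∑ k ∈ Ioc 0 (30 * m), Λ k * ((j / k : ℕ) : ℝ) = Real.log (j.factorial : ℝ) := by
    intro j hj
    rw [← sum_vonMangoldt_mul_div]
    symm
    apply Finset.sum_subset (Ioc_subset_Ioc_right hj)
    intro k hk hk'
    simp only [mem_Ioc, not_and, not_le] at hk hk'
    rw [Nat.div_eq_of_lt (hk' hk.1)]
    simp
  rw [← key (30 * m) le_rfl, ← key (15 * m) (by omega), ← key (10 * m) (by omega),
    ← key (6 * m) (by omega), ← key m (by omega), ← Finset.sum_sub_distrib,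
    ← Finset.sum_sub_distrib, ← Finset.sum_sub_distrib, ← Finset.sum_add_distrib]
  apply Finset.sum_congr rfl
  intro k _
  ring

theorem chebyshev_coeff_eq (m k : ℕ) :
    15 * m / k = 30 * m / k / 2 ∧ 10 * m / k = 30 * m / k / 3 ∧ 6 * m / k = 30 * m / k / 5 ∧
      m / k = 30 * m / k / 30 := by
  refine ⟨?_, ?_, ?_, ?_⟩ <;> rw [Nat.div_div_eq_div_mul, mul_comm k]
  · rw [show 30 * m = 2 * (15 * m) by ring, Nat.mul_div_mul_left _ _ (by norm_num)]
  · rw [show 30 * m = 3 * (10 * m) by ring, Nat.mul_div_mul_left _ _ (by norm_num)]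
  · rw [show 30 * m = 5 * (6 * m) by ring, Nat.mul_div_mul_left _ _ (by norm_num)]
  · rw [Nat.mul_div_mul_left _ _ (by norm_num)]

theorem log_factorial_combination (m : ℕ) (hm : 1 ≤ m) :
    |Real.log ((30 * m).factorial : ℝ) - Real.log ((15 * m).factorial : ℝ)
      - Real.log ((10 * m).factorial : ℝ) - Real.log ((6 * m).factorial : ℝ)
      + Real.log (m.factorial : ℝ)
      - m * (14 * Real.log 2 + 9 * Real.log 3 + 5 * Real.log 5)| ≤ 5 * Real.log (30 * m) + 5 := by
  have hm0 : (0 : ℝ) < m := by exact_mod_cast hm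
  have l30 : Real.log 30 = Real.log 2 + Real.log 3 + Real.log 5 := by
    rw [← Real.log_mul (by norm_num) (by norm_num), ← Real.log_mul (by norm_num) (by norm_num)]
    norm_num
  have l15 : Real.log 15 = Real.log 3 + Real.log 5 := by
    rw [← Real.log_mul (by norm_num) (by norm_num)]; norm_num
  have l10 : Real.log 10 = Real.log 2 + Real.log 5 := by
    rw [← Real.log_mul (by norm_num) (by norm_num)]; norm_num
  have l6 : Real.log 6 = Real.log 2 + Real.log 3 := by
    rw [← Real.log_mul (by norm_num) (by norm_num)]; norm_num
  have e : ∀ c : ℝ, 0 < c → Real.log (c * m) = Real.log c + Real.log m := fun c hc =>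
    Real.log_mul hc.ne' hm0.ne'
  have hlm : 0 ≤ Real.log m := Real.log_natCast_nonneg m
  have a2 : 0 < Real.log 2 := Real.log_pos (by norm_num)
  have a3 : 0 < Real.log 3 := Real.log_pos (by norm_num)
  have a5 : 0 < Real.log 5 := Real.log_pos (by norm_num)
  have u1 := log_factorial_le (30 * m) (by omega)
  have u2 := log_factorial_le (15 * m) (by omega)
  have u3 := log_factorial_le (10 * m) (by omega)
  have u4 := log_factorial_le (6 * m) (by omega)
  have u5 := log_factorial_le m (by omega)
  have v1 := log_factorial_ge (30 * m)
  have v2 := log_factorial_ge (15 * m)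
  have v3 := log_factorial_ge (10 * m)
  have v4 := log_factorial_ge (6 * m)
  have v5 := log_factorial_ge m
  push_cast at u1 u2 u3 u4 u5 v1 v2 v3 v4 v5
  simp only [e 30 (by norm_num), e 15 (by norm_num), e 10 (by norm_num), e 6 (by norm_num), l30,
    l15, l10, l6] at *
  rw [abs_le]
  constructor <;> nlinarith

theorem psi_thirty_mul_ge (m : ℕ) (hm : 1 ≤ m) :
    27.63 * m - (5 * Real.log (30 * m) + 5) ≤ Chebyshev.psi ((30 * m : ℕ) : ℝ) := by
  have h := chebyshev_combination m
  have h2 := (abs_le.1 (log_factorial_combination m hm)).1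
  rw [← h] at h2
  have h3 : ∑ k ∈ Ioc 0 (30 * m), Λ k * (((30 * m / k : ℕ) : ℝ) - (15 * m / k : ℕ)
      - (10 * m / k : ℕ) - (6 * m / k : ℕ) + (m / k : ℕ)) ≤ ∑ k ∈ Ioc 0 (30 * m), Λ k := by
    apply Finset.sum_le_sum
    intro k _
    have hle : (((30 * m / k : ℕ) : ℝ) - (15 * m / k : ℕ)
      - (10 * m / k : ℕ) - (6 * m / k : ℕ) + (m / k : ℕ)) ≤ 1 := by
      obtain ⟨e1, e2, e3, e4⟩ := chebyshev_coeff_eq m k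
      rw [e1, e2, e3, e4]
      have : 30 * m / k + 30 * m / k / 30 ≤
        1 + 30 * m / k / 2 + 30 * m / k / 3 + 30 * m / k / 5 := by omega
      have : ((30 * m / k : ℕ) : ℝ) + (30 * m / k / 30 : ℕ) ≤
        1 + (30 * m / k / 2 : ℕ) + (30 * m / k / 3 : ℕ) + (30 * m / k / 5 : ℕ) := by
        exact_mod_cast this
      linarith
    exact mul_le_of_le_one_right ArithmeticFunction.vonMangoldt_nonneg hle
  rw [psi_natCast]
  have hc : 27.63 ≤ 14 * Real.log 2 + 9 * Real.log 3 + 5 * Real.log 5 := by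
    linarith [Real.log_two_gt_d9, Real.log_three_gt_d9, Real.log_five_gt_d9]
  have := mul_le_mul_of_nonneg_left hc (Nat.cast_nonneg (α := ℝ) m)
  linarith

theorem psi_thirty_mul_le (m : ℕ) (hm : 1 ≤ m) :
    Chebyshev.psi ((30 * m : ℕ) : ℝ) ≤
      27.64 * m + (5 * Real.log (30 * m) + 5) + Chebyshev.psi ((5 * m : ℕ) : ℝ) := by
  have h := chebyshev_combination m
  have h2 := (abs_le.1 (log_factorial_combination m hm)).2
  rw [← h] at h2
  have h3 : ∑ k ∈ Ioc 0 (30 * m), (Λ k - if k ≤ 5 * m then Λ k else 0) ≤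
      ∑ k ∈ Ioc 0 (30 * m), Λ k * (((30 * m / k : ℕ) : ℝ) - (15 * m / k : ℕ)
      - (10 * m / k : ℕ) - (6 * m / k : ℕ) + (m / k : ℕ)) := by
    apply Finset.sum_le_sum
    intro k hk
    rw [mem_Ioc] at hk
    obtain ⟨e1, e2, e3, e4⟩ := chebyshev_coeff_eq m k
    rw [e1, e2, e3, e4]
    split_ifs with hkm
    · rw [sub_self]
      apply mul_nonneg ArithmeticFunction.vonMangoldt_nonneg
      have : 30 * m / k / 2 + 30 * m / k / 3 + 30 * m / k / 5 ≤ 30 * m / k + 30 * m / k / 30 := by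
        omega
      have : ((30 * m / k / 2 : ℕ) : ℝ) + (30 * m / k / 3 : ℕ) + (30 * m / k / 5 : ℕ) ≤
        (30 * m / k : ℕ) + (30 * m / k / 30 : ℕ) := by exact_mod_cast this
      linarith
    · rw [sub_zero]
      apply le_mul_of_one_le_right ArithmeticFunction.vonMangoldt_nonneg
      have l1 : 1 ≤ 30 * m / k := (Nat.one_le_div_iff hk.1).2 hk.2
      have l2 : 30 * m / k < 6 := (Nat.div_lt_iff_lt_mul hk.1).2 (by omega)
      have : 1 + 30 * m / k / 2 + 30 * m / k / 3 + 30 * m / k / 5 ≤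
        30 * m / k + 30 * m / k / 30 := by omega
      have : 1 + ((30 * m / k / 2 : ℕ) : ℝ) + (30 * m / k / 3 : ℕ) + (30 * m / k / 5 : ℕ) ≤
        (30 * m / k : ℕ) + (30 * m / k / 30 : ℕ) := by exact_mod_cast this
      linarith
  have h4 : ∑ k ∈ Ioc 0 (30 * m), (if k ≤ 5 * m then Λ k else 0) = ∑ k ∈ Ioc 0 (5 * m), Λ k := by
    rw [← Finset.sum_filter]
    apply Finset.sum_congr _ fun _ _ => rfl
    ext k
    simp only [mem_filter, mem_Ioc]
    omega
  rw [Finset.sum_sub_distrib, h4] at h3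
  rw [psi_natCast, psi_natCast]
  have hc : 14 * Real.log 2 + 9 * Real.log 3 + 5 * Real.log 5 ≤ 27.64 := by
    linarith [Real.log_two_lt_d9, Real.log_three_lt_d9, Real.log_five_lt_d9]
  have := mul_le_mul_of_nonneg_left hc (Nat.cast_nonneg (α := ℝ) m)
  linarith

theorem psi_natCast_ge : ∃ K : ℝ, 0 ≤ K ∧ ∀ n : ℕ, 0.92 * (n : ℝ) - K ≤ Chebyshev.psi n := by
  refine ⟨30 + 5 * 4999 + 5, by norm_num, fun n => ?_⟩
  have hn : (n : ℝ) = 30 * ((n / 30 : ℕ) : ℝ) + ((n % 30 : ℕ) : ℝ) := by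
    exact_mod_cast (Nat.div_add_mod n 30).symm
  have hr : ((n % 30 : ℕ) : ℝ) ≤ 30 := by exact_mod_cast (Nat.mod_lt n (by norm_num)).le
  rcases Nat.eq_zero_or_pos (n / 30) with h | h
  · rw [h] at hn
    have := Chebyshev.psi_nonneg (n : ℝ)
    push_cast at hn
    linarith
  · have h1 := psi_thirty_mul_ge (n / 30) h
    have h2 : Chebyshev.psi ((30 * (n / 30) : ℕ) : ℝ) ≤ Chebyshev.psi n :=
      Chebyshev.psi_mono (by exact_mod_cast Nat.mul_div_le n 30)
    have hmpos : (1 : ℝ) ≤ ((n / 30 : ℕ) : ℝ) := Nat.one_le_cast.2 h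
    set m : ℝ := ((n / 30 : ℕ) : ℝ) with hm
    have h3 : Real.log (30 * m) ≤ 30 * m / 5000 - 1 + 4999 := by
      have a := Real.log_le_sub_one_of_pos (show (0 : ℝ) < 30 * m / 5000 by positivity)
      have b := Real.log_le_sub_one_of_pos (show (0 : ℝ) < 5000 by norm_num)
      rw [Real.log_div (by positivity) (by norm_num)] at a
      linarith
    linarith

theorem psi_natCast_le : ∃ K : ℝ, 0 ≤ K ∧ ∀ n : ℕ, Chebyshev.psi n ≤ 1.115 * (n : ℝ) + K := by
  obtain ⟨P, hP⟩ : ∃ P : ℝ, P = Chebyshev.psi ((3000000 : ℕ) : ℝ) := ⟨_, rfl⟩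
  refine ⟨P, hP ▸ Chebyshev.psi_nonneg _, fun n => ?_⟩
  induction n using Nat.strong_induction_on with
  | _ n ih =>
    rcases le_or_gt n 3000000 with h | h
    · have : Chebyshev.psi n ≤ P := hP ▸ Chebyshev.psi_mono (by exact_mod_cast h)
      have h0 : (0 : ℝ) ≤ n := by positivity
      linarith
    · obtain ⟨m, hm⟩ : ∃ m, m = n / 30 + 1 := ⟨_, rfl⟩
      have h1 := psi_thirty_mul_le m (by omega)
      have h2 := ih (5 * m) (by omega)
      have h3 : Chebyshev.psi n ≤ Chebyshev.psi ((30 * m : ℕ) : ℝ) :=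
        Chebyshev.psi_mono (by exact_mod_cast (by omega : n ≤ 30 * m))
      have h4 : 30 * (m : ℝ) ≤ n + 30 := by exact_mod_cast (by omega : 30 * m ≤ n + 30)
      have h5 : (100000 : ℝ) ≤ m := by exact_mod_cast (by omega : 100000 ≤ m)
      have h6 : Real.log (30 * m) ≤ 30 * m / 1500 - 1 + 1499 := by
        have a := Real.log_le_sub_one_of_pos (show (0 : ℝ) < 30 * m / 1500 by positivity)
        have b := Real.log_le_sub_one_of_pos (show (0 : ℝ) < 1500 by norm_num)
        rw [Real.log_div (by positivity) (by norm_num)] at a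
        linarith
      rw [Nat.cast_mul] at h2
      push_cast at h1 h2 h3
      linarith

theorem theta_natCast_ge : ∃ K : ℝ, 0 ≤ K ∧ ∀ n : ℕ, 0.919 * (n : ℝ) - K ≤ Chebyshev.theta n := by
  obtain ⟨K, hK, h⟩ := psi_natCast_ge
  obtain ⟨C, hC⟩ := Chebyshev.psi_sub_theta_le_mul_sqrt
  refine ⟨K + 250 * C ^ 2, by positivity, fun n => ?_⟩
  have h1 := h n
  have h2 := hC n
  have h3 := Real.sq_sqrt (Nat.cast_nonneg (α := ℝ) n)
  nlinarith [sq_nonneg (0.001 * √(n : ℝ) - C / 2)]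

theorem theta_natCast_le : ∃ K : ℝ, 0 ≤ K ∧ ∀ n : ℕ, Chebyshev.theta n ≤ 1.115 * (n : ℝ) + K := by
  obtain ⟨K, hK, h⟩ := psi_natCast_le
  exact ⟨K, hK, fun n => (Chebyshev.theta_le_psi _).trans (h n)⟩

theorem sum_vonMangoldt_div_ge (N : ℕ) (hN : 1 ≤ N) :
    Real.log N - 1 ≤ ∑ k ∈ Ioc 0 N, Λ k / (k : ℝ) := by
  have hN' : (0 : ℝ) < N := by exact_mod_cast hN
  have h : Real.log (N.factorial : ℝ) ≤ N * ∑ k ∈ Ioc 0 N, Λ k / (k : ℝ) := by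
    rw [← sum_vonMangoldt_mul_div, mul_sum]
    refine sum_le_sum fun k _ => ?_
    have := Nat.cast_div_le (α := ℝ) (m := N) (n := k)
    calc Λ k * ((N / k : ℕ) : ℝ) ≤ Λ k * (N / k) :=
          mul_le_mul_of_nonneg_left this ArithmeticFunction.vonMangoldt_nonneg
      _ = N * (Λ k / k) := by ring
  have h2 := log_factorial_ge N
  refine le_of_mul_le_mul_left ?_ hN'
  linarith

theorem sum_vonMangoldt_div_le : ∃ C : ℝ, 0 ≤ C ∧ ∀ N : ℕ, 1 ≤ N →
    ∑ k ∈ Ioc 0 N, Λ k / (k : ℝ) ≤ Real.log N + C := by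
  refine ⟨Real.log 4 + 4, by positivity, fun N hN => ?_⟩
  have hN' : (0 : ℝ) < N := by exact_mod_cast hN
  have h : N * ∑ k ∈ Ioc 0 N, Λ k / (k : ℝ) ≤ Real.log (N.factorial : ℝ) + Chebyshev.psi N := by
    rw [← sum_vonMangoldt_mul_div, mul_sum, psi_natCast, ← sum_add_distrib]
    refine sum_le_sum fun k hk => ?_
    have hk0 : 0 < k := (mem_Ioc.1 hk).1
    have : (N : ℝ) / k ≤ ((N / k : ℕ) : ℝ) + 1 := by
      rw [div_le_iff₀ (by positivity)]
      have := Nat.lt_div_mul_add (a := N) hk0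
      have h5 : (N : ℝ) ≤ ((N / k * k + k : ℕ) : ℝ) := by exact_mod_cast this.le
      push_cast at h5
      linarith
    calc N * (Λ k / k) = Λ k * (N / k) := by ring
      _ ≤ Λ k * (((N / k : ℕ) : ℝ) + 1) :=
          mul_le_mul_of_nonneg_left this ArithmeticFunction.vonMangoldt_nonneg
      _ = _ := by ring
  have h2 := log_factorial_le N hN
  have h3 := Chebyshev.psi_le_const_mul_self (x := N) (by positivity)
  have h4 := Real.log_le_sub_one_of_pos hN'
  refine le_of_mul_le_mul_left ?_ hN'
  linarith

theorem abs_card_modEq_sub_lt (M H v : ℕ) {r : ℕ} (hr : 0 < r) :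
    |(#{x ∈ Ioc M (M + H) | x ≡ v [MOD r]} : ℝ) - H / r| < 1 := by
  have h := Nat.Ioc_filter_modEq_card M (M + H) hr v
  have hr' : (0 : ℚ) < r := by exact_mod_cast hr
  set A : ℚ := (((M + H : ℕ) : ℚ) - v) / r with hA
  set B : ℚ := ((M : ℚ) - v) / r with hB
  have hAB : A - B = (H : ℚ) / r := by
    rw [hA, hB]; push_cast; field_simp; ring
  have hle : ⌊B⌋ ≤ ⌊A⌋ := Int.floor_le_floor (by
    have : (0 : ℚ) ≤ (H : ℚ) / r := by positivity
    linarith)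
  rw [max_eq_left (by omega)] at h
  have h' : (#{x ∈ Ioc M (M + H) | x ≡ v [MOD r]} : ℚ) = (⌊A⌋ : ℚ) - ⌊B⌋ := by exact_mod_cast h
  have key : |(#{x ∈ Ioc M (M + H) | x ≡ v [MOD r]} : ℚ) - H / r| < 1 := by
    rw [h', abs_lt]
    have := Int.floor_le A
    have := Int.floor_le B
    have := Int.lt_floor_add_one A
    have := Int.lt_floor_add_one B
    constructor <;> linarith
  have key2 : ((|(#{x ∈ Ioc M (M + H) | x ≡ v [MOD r]} : ℚ) - H / r| : ℚ) : ℝ) < ((1 : ℚ) : ℝ) :=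
    Rat.cast_lt.2 key
  push_cast at key2
  exact key2

theorem le_card_mul_modEq (L a : ℕ) {d k : ℕ} (hd : 0 < d) (hk : 0 < k) (hkd : k.Coprime d) :
    L / d / k ≤ #{n ∈ Ioc 0 L | n ≡ a [MOD d] ∧ k ∣ n} := by
  obtain ⟨v, hv⟩ : ∃ v, k * v ≡ a [MOD d] := by
    rcases Nat.lt_or_ge 1 d with h1 | h1
    · obtain ⟨u, hu, hu2⟩ := Nat.exists_mul_mod_eq_one_of_coprime hkd h1
      refine ⟨u * a, ?_⟩
      have : k * u ≡ 1 [MOD d] := by rw [Nat.ModEq, hu2, Nat.mod_eq_of_lt h1]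
      simpa [mul_assoc] using this.mul_right a
    · have : d = 1 := by omega
      subst this
      exact ⟨0, Nat.modEq_one⟩
  have h := abs_card_modEq_sub_lt 0 (L / k) v hd
  rw [abs_lt, Nat.zero_add] at h
  have h1 : L / k / d ≤ #{x ∈ Ioc 0 (L / k) | x ≡ v [MOD d]} := by
    have h2 := Nat.cast_div_le (α := ℝ) (m := L / k) (n := d)
    have : ((L / k / d : ℕ) : ℝ) < (#{x ∈ Ioc 0 (L / k) | x ≡ v [MOD d]} : ℝ) + 1 := by linarith
    exact Nat.lt_succ_iff.1 (by exact_mod_cast this)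
  rw [Nat.div_div_eq_div_mul, mul_comm d k, ← Nat.div_div_eq_div_mul]
  refine h1.trans ?_
  refine card_le_card_of_injOn (fun l => k * l) ?_ ?_
  · intro l hl
    simp only [coe_filter, mem_Ioc, Set.mem_ofPred_eq] at hl ⊢
    refine ⟨⟨Nat.mul_pos hk hl.1.1, ?_⟩, (hl.2.mul_left k).trans hv, dvd_mul_right _ _⟩
    rw [mul_comm]
    exact (Nat.le_div_iff_mul_le hk).1 hl.1.2
  · intro a _ b _ hab
    exact Nat.eq_of_mul_eq_mul_left hk hab

theorem sum_log_primeFactors_le (d : ℕ) (hd : 0 < d) :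
    ∑ p ∈ d.primeFactors, Real.log p ≤ Real.log d := by
  rw [← Real.log_prod (fun p hp => by
    exact_mod_cast (Nat.prime_of_mem_primeFactors hp).ne_zero)]
  refine Real.log_le_log (prod_pos fun p hp => by
    exact_mod_cast (Nat.prime_of_mem_primeFactors hp).pos) ?_
  rw [← Nat.cast_prod]
  exact Nat.cast_le.2 (Nat.le_of_dvd hd (Nat.prod_primeFactors_dvd d))

theorem sum_vonMangoldt_div_not_coprime_le (N d : ℕ) (hd : 0 < d) :
    ∑ k ∈ Ioc 0 N with ¬ k.Coprime d, Λ k / (k : ℝ) ≤ Real.log d := by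
  refine le_trans ?_ (sum_log_primeFactors_le d hd)
  set T := d.primeFactors ×ˢ Ioc 0 N
  have h1 : ∑ k ∈ Ioc 0 N with ¬ k.Coprime d, Λ k / (k : ℝ) ≤
      ∑ k ∈ T.image (fun x => x.1 ^ x.2), Λ k / (k : ℝ) := by
    rw [← sum_filter_ne_zero]
    refine sum_le_sum_of_subset_of_nonneg ?_ fun k _ _ =>
      div_nonneg ArithmeticFunction.vonMangoldt_nonneg (Nat.cast_nonneg _)
    intro k hk
    simp only [mem_filter, mem_Ioc] at hk
    have hL : Λ k ≠ 0 := fun h => hk.2 (by rw [h, zero_div])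
    obtain ⟨p, j, hp, hj, rfl⟩ := (isPrimePow_nat_iff _).1
      (ArithmeticFunction.vonMangoldt_ne_zero_iff.1 hL)
    refine mem_image.2 ⟨(p, j), mem_product.2 ⟨?_, ?_⟩, rfl⟩
    · refine Nat.mem_primeFactors.2 ⟨hp, ?_, hd.ne'⟩
      by_contra hpd
      exact hk.1.2 (Nat.Coprime.pow_left _ ((Nat.Prime.coprime_iff_not_dvd hp).2 hpd))
    · exact mem_Ioc.2 ⟨hj, (Nat.lt_pow_self hp.one_lt).le.trans hk.1.1.2⟩
  refine h1.trans ((sum_image_le_of_nonneg fun k _ =>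
      div_nonneg ArithmeticFunction.vonMangoldt_nonneg (Nat.cast_nonneg _)).trans ?_)
  rw [sum_product]
  refine sum_le_sum fun p hp => ?_
  have hp' := Nat.prime_of_mem_primeFactors hp
  have hp2 : (2 : ℝ) ≤ p := by exact_mod_cast hp'.two_le
  have h2 : ∀ M : ℕ, ∑ j ∈ Ioc 0 M, Λ (p ^ j) / ((p ^ j : ℕ) : ℝ) ≤
      Real.log p * (1 - (1 / 2) ^ M) := by
    intro M
    induction M with
    | zero => simp
    | succ M ih =>
      rw [sum_Ioc_succ_top (by omega), ArithmeticFunction.vonMangoldt_apply_pow (by omega),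
        ArithmeticFunction.vonMangoldt_apply_prime hp']
      have hlog : 0 ≤ Real.log p := Real.log_nonneg (by linarith)
      have : Real.log p / ((p ^ (M + 1) : ℕ) : ℝ) ≤ Real.log p * (1 / 2) ^ (M + 1) := by
        rw [div_eq_mul_inv]
        gcongr
        push_cast
        rw [← inv_pow]
        gcongr
        rw [one_div]
        gcongr
      have e : (1 / 2 : ℝ) ^ M = 2 * (1 / 2) ^ (M + 1) := by rw [pow_succ]; ring
      rw [e] at ih
      nlinarith
  refine (h2 N).trans ?_
  have hlog : 0 ≤ Real.log p := Real.log_nonneg (by linarith)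
  have : (0 : ℝ) ≤ (1 / 2) ^ N := by positivity
  nlinarith

theorem sum_vonMangoldt_modEq_le : ∃ C : ℝ, 0 ≤ C ∧ ∀ d a L : ℕ, 0 < d → a.Coprime d → d ≤ L →
    ∑ k ∈ Ioc 0 L with k ≡ a [MOD d], Λ k ≤ C * (L / d) * (Real.log d + 1) := by
  refine ⟨Real.log 4 + 4 + 10, by positivity, fun d a L hd had hdL => ?_⟩
  set S := {k ∈ Ioc 0 L | k ≡ a [MOD d]} with hS
  obtain ⟨N, hN⟩ : ∃ N, N = L / d := ⟨_, rfl⟩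
  have hN1 : 1 ≤ N := hN ▸ Nat.div_pos hdL hd
  have hNL : N ≤ L := hN ▸ Nat.div_le_self _ _
  have hd' : (1 : ℝ) ≤ d := by exact_mod_cast hd
  have hN' : (1 : ℝ) ≤ N := by exact_mod_cast hN1
  have hlogd : 0 ≤ Real.log d := Real.log_nonneg hd'
  have hcop : ∀ k ∈ S, k.Coprime d := fun k hk => by
    have := (mem_filter.1 hk).2
    rw [Nat.Coprime, Nat.ModEq.gcd_eq this]
    exact had
  have e1 : ∑ n ∈ S, Real.log n = ∑ k ∈ Ioc 0 L, Λ k * (#{n ∈ S | k ∣ n} : ℝ) := by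
    have : ∀ n ∈ S, Real.log n = ∑ k ∈ Ioc 0 L, if k ∣ n then Λ k else 0 := by
      intro n hn
      have hn' := mem_Ioc.1 (mem_filter.1 hn).1
      rw [← ArithmeticFunction.vonMangoldt_sum, ← sum_filter]
      refine sum_congr ?_ fun _ _ => rfl
      ext k
      simp only [Nat.mem_divisors, mem_filter, mem_Ioc]
      constructor
      · rintro ⟨h, _⟩
        exact ⟨⟨Nat.pos_of_dvd_of_pos h hn'.1, (Nat.le_of_dvd hn'.1 h).trans hn'.2⟩, h⟩
      · rintro ⟨_, h⟩
        exact ⟨h, by omega⟩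
    rw [sum_congr rfl this, sum_comm]
    refine sum_congr rfl fun k _ => ?_
    rw [← sum_filter, sum_const, nsmul_eq_mul, mul_comm]
  have e2 : ∑ k ∈ Ioc 0 L, (Λ k * (if k.Coprime d then ((N / k : ℕ) : ℝ) else 0) +
      (if k ∈ S ∧ N < k then Λ k else 0)) ≤ ∑ n ∈ S, Real.log n := by
    rw [e1]
    refine sum_le_sum fun k hk => ?_
    have hk' := mem_Ioc.1 hk
    have hΛ : 0 ≤ Λ k := ArithmeticFunction.vonMangoldt_nonneg
    by_cases hc : k.Coprime d
    · rw [if_pos hc]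
      split_ifs with h
      · rw [Nat.div_eq_of_lt h.2]
        have : (1 : ℝ) ≤ (#{n ∈ S | k ∣ n} : ℝ) := by
          exact_mod_cast card_pos.2 ⟨k, mem_filter.2 ⟨h.1, dvd_rfl⟩⟩
        nlinarith [Nat.cast_zero (R := ℝ)]
      · rw [add_zero]
        refine mul_le_mul_of_nonneg_left ?_ hΛ
        have := le_card_mul_modEq L a hd hk'.1 hc
        rw [← hN] at this
        rw [hS, filter_filter]
        exact_mod_cast this
    · rw [if_neg hc, if_neg (fun h => hc (hcop k h.1))]
      simp only [mul_zero, add_zero]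
      positivity
  rw [sum_add_distrib, ← sum_filter] at e2
  have e3 : Real.log (N.factorial : ℝ) - N * Real.log d ≤
      ∑ k ∈ Ioc 0 L, Λ k * (if k.Coprime d then ((N / k : ℕ) : ℝ) else 0) := by
    have h1 : ∑ k ∈ Ioc 0 N, Λ k * (if k.Coprime d then ((N / k : ℕ) : ℝ) else 0) ≤
        ∑ k ∈ Ioc 0 L, Λ k * (if k.Coprime d then ((N / k : ℕ) : ℝ) else 0) := by
      refine sum_le_sum_of_subset_of_nonneg (Ioc_subset_Ioc_right hNL) fun k _ _ => ?_
      refine mul_nonneg ArithmeticFunction.vonMangoldt_nonneg ?_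
      split_ifs <;> positivity
    have h2 : Real.log (N.factorial : ℝ) ≤
        ∑ k ∈ Ioc 0 N, Λ k * (if k.Coprime d then ((N / k : ℕ) : ℝ) else 0) +
        N * ∑ k ∈ Ioc 0 N with ¬ k.Coprime d, Λ k / (k : ℝ) := by
      rw [← sum_vonMangoldt_mul_div, mul_sum, sum_filter, ← sum_add_distrib]
      refine sum_le_sum fun k _ => ?_
      by_cases hc : k.Coprime d
      · rw [if_pos hc, if_neg (not_not.2 hc)]
        simp
      · simp only [hc, if_false, mul_zero, zero_add, not_false_eq_true, if_true]
        calc Λ k * ((N / k : ℕ) : ℝ) ≤ Λ k * (N / k) :=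
              mul_le_mul_of_nonneg_left Nat.cast_div_le ArithmeticFunction.vonMangoldt_nonneg
          _ = N * (Λ k / k) := by ring
    have h3 := sum_vonMangoldt_div_not_coprime_le N d hd
    have := mul_le_mul_of_nonneg_left h3 (Nat.cast_nonneg (α := ℝ) N)
    linarith
  have e4 : ∑ n ∈ S, Real.log n ≤ (N + 1) * (Real.log N + 1 + Real.log d) := by
    have hc : (#S : ℝ) ≤ N + 1 := by
      have h := abs_card_modEq_sub_lt 0 L a hd
      rw [abs_lt, Nat.zero_add] at h
      have h2 : (L : ℝ) / d < N + 1 := by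
        rw [div_lt_iff₀ (by positivity)]
        have := Nat.lt_div_mul_add (a := L) hd
        rw [← hN] at this
        have h3 : (L : ℝ) < ((N * d + d : ℕ) : ℝ) := by exact_mod_cast this
        push_cast at h3
        linarith
      have h4 : (#S : ℝ) < ((N + 2 : ℕ) : ℝ) := by
        push_cast
        linarith [h.2]
      have h5 : #S < N + 2 := by exact_mod_cast h4
      exact_mod_cast Nat.lt_succ_iff.1 h5
    have hl : ∀ n ∈ S, Real.log n ≤ Real.log N + 1 + Real.log d := by
      intro n hn
      have hn' := mem_Ioc.1 (mem_filter.1 hn).1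
      have : (n : ℝ) ≤ 2 * N * d := by
        have := Nat.lt_div_mul_add (a := L) hd
        rw [← hN] at this
        have : n ≤ 2 * N * d := by nlinarith
        exact_mod_cast this
      have hn0 : (0 : ℝ) < n := by exact_mod_cast hn'.1
      have := Real.log_le_log hn0 this
      rw [Real.log_mul (by positivity) (by positivity), Real.log_mul (by norm_num)
        (by positivity)] at this
      linarith [Real.log_two_lt_d9]
    have hnn : 0 ≤ Real.log N + 1 + Real.log d := by
      have := Real.log_nonneg hN'
      linarith
    calc ∑ n ∈ S, Real.log n ≤ ∑ n ∈ S, (Real.log N + 1 + Real.log d) := sum_le_sum hl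
      _ = #S * (Real.log N + 1 + Real.log d) := by rw [sum_const, nsmul_eq_mul]
      _ ≤ _ := mul_le_mul_of_nonneg_right hc hnn
  have e5 : ∑ k ∈ S, Λ k ≤ Chebyshev.psi N + ∑ k ∈ Ioc 0 L with k ∈ S ∧ N < k, Λ k := by
    rw [psi_natCast, ← sum_filter_add_sum_filter_not S (fun k => k ≤ N)]
    refine add_le_add ?_ ?_
    · refine sum_le_sum_of_subset_of_nonneg (fun k hk => ?_)
        fun _ _ _ => ArithmeticFunction.vonMangoldt_nonneg
      simp only [mem_filter, hS, mem_Ioc] at hk ⊢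
      exact ⟨hk.1.1.1, hk.2⟩
    · refine sum_le_sum_of_subset_of_nonneg (fun k hk => ?_)
        fun _ _ _ => ArithmeticFunction.vonMangoldt_nonneg
      simp only [mem_filter, hS, mem_Ioc, not_le] at hk ⊢
      exact ⟨hk.1.1, hk.1, hk.2⟩
  have e6 := log_factorial_ge N
  have e7 := Chebyshev.psi_le_const_mul_self (x := N) (by positivity)
  have e8 : Real.log N ≤ N - 1 := Real.log_le_sub_one_of_pos (by linarith)
  have e9 : ∑ k ∈ S, Λ k ≤ (Real.log 4 + 4 + 10) * N * (Real.log d + 1) := by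
    have h4 : 0 ≤ Real.log 4 := Real.log_nonneg (by norm_num)
    have : 0 ≤ (Real.log 4 + 4) * N * Real.log d := by positivity
    nlinarith
  refine e9.trans ?_
  have : (N : ℝ) ≤ L / d := hN ▸ Nat.cast_div_le
  gcongr

theorem abs_card_modEq_mod_sub_lt (M H a b : ℕ) {r n : ℕ} (hr : 0 < r) (hn : 0 < n)
    (hrn : r.Coprime n) :
    |(#{m ∈ {m ∈ Ioc M (M + H) | m ≡ a [MOD r]} | m ≡ b [MOD n]} : ℝ) - H / (r * n)| < 1 := by
  obtain ⟨k, hk⟩ := Nat.chineseRemainder hrn a b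
  have h := abs_card_modEq_sub_lt M H k (Nat.mul_pos hr hn)
  have e : {m ∈ {m ∈ Ioc M (M + H) | m ≡ a [MOD r]} | m ≡ b [MOD n]} =
      {m ∈ Ioc M (M + H) | m ≡ k [MOD (r * n)]} := by
    rw [filter_filter]
    refine filter_congr fun m _ => ?_
    rw [← Nat.modEq_and_modEq_iff_modEq_mul hrn]
    exact ⟨fun h => ⟨h.1.trans hk.1.symm, h.2.trans hk.2.symm⟩,
      fun h => ⟨h.1.trans hk.1, h.2.trans hk.2⟩⟩
  rw [e]
  push_cast at h
  exact h

theorem sum_mod_eq_sum_range (S : Finset ℕ) {q : ℕ} (hq : 0 < q) (f : ℕ → ℝ) (c : ℕ → ℝ) :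
    ∑ m ∈ S, c m * f (m % q) = ∑ b ∈ range q, f b * ∑ m ∈ S with m % q = b, c m := by
  have : ∀ b, f b * ∑ m ∈ S with m % q = b, c m =
      ∑ m ∈ S, if m % q = b then c m * f b else 0 := fun b => by
    rw [mul_sum, sum_filter]
    exact sum_congr rfl fun m _ => by split_ifs <;> ring
  simp_rw [this]
  rw [sum_comm]
  refine sum_congr rfl fun m _ => ?_
  rw [sum_ite_eq, if_pos (mem_range.2 (Nat.mod_lt _ hq))]

theorem abs_sum_mul_mod_mod_le (M H a : ℕ) {r q q' : ℕ} (hr : 0 < r) (hq : 0 < q) (hq' : 0 < q')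
    (hrq : r.Coprime q) (hrq' : r.Coprime q') (hqq' : q.Coprime q') (f g : ℕ → ℝ)
    (hf : ∑ b ∈ range q, f b = 0) :
    |∑ m ∈ Ioc M (M + H) with m ≡ a [MOD r], f (m % q) * g (m % q')| ≤
      (∑ b ∈ range q, |f b|) * ∑ b ∈ range q', |g b| := by
  set S := {m ∈ Ioc M (M + H) | m ≡ a [MOD r]} with hS
  have e : ∑ m ∈ S, f (m % q) * g (m % q') = ∑ b ∈ range q, ∑ b' ∈ range q',
      f b * g b' * ((#{m ∈ S | m % q = b ∧ m % q' = b'} : ℝ) - H / (r * (q * q'))) := by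
    have h0 : ∑ b ∈ range q, ∑ b' ∈ range q', f b * g b' * ((H : ℝ) / (r * (q * q'))) = 0 := by
      simp_rw [← sum_mul, ← mul_sum]
      rw [← sum_mul, hf]
      ring
    simp_rw [mul_sub, sum_sub_distrib]
    rw [h0, sub_zero]
    have : ∀ b b', f b * g b' * (#{m ∈ S | m % q = b ∧ m % q' = b'} : ℝ) =
        ∑ m ∈ S, if m % q = b then (if m % q' = b' then f b * g b' else 0) else 0 := by
      intro b b'
      rw [mul_comm, ← nsmul_eq_mul, ← sum_const, sum_filter]
      exact sum_congr rfl fun m _ => by rw [ite_and]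
    simp_rw [this]
    have h2 : ∀ b, ∑ b' ∈ range q', ∑ m ∈ S,
        (if m % q = b then (if m % q' = b' then f b * g b' else 0) else 0) =
        ∑ m ∈ S, if m % q = b then f b * g (m % q') else 0 := by
      intro b
      rw [sum_comm]
      refine sum_congr rfl fun m _ => ?_
      split_ifs
      · rw [sum_ite_eq, if_pos (mem_range.2 (Nat.mod_lt _ hq'))]
      · simp
    simp_rw [h2]
    rw [sum_comm]
    refine sum_congr rfl fun m _ => ?_
    rw [sum_ite_eq, if_pos (mem_range.2 (Nat.mod_lt _ hq))]
  rw [e, sum_mul_sum]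
  refine (abs_sum_le_sum_abs _ _).trans (sum_le_sum fun b hb => ?_)
  refine (abs_sum_le_sum_abs _ _).trans (sum_le_sum fun b' hb' => ?_)
  rw [abs_mul, abs_mul]
  refine mul_le_of_le_one_right (by positivity) ?_
  obtain ⟨k, hk⟩ := Nat.chineseRemainder hqq' b b'
  have h := abs_card_modEq_mod_sub_lt M H a k hr (Nat.mul_pos hq hq') (hrq.mul_right hrq')
  have e2 : {m ∈ S | m % q = b ∧ m % q' = b'} = {m ∈ S | m ≡ k [MOD (q * q')]} := by
    refine filter_congr fun m _ => ?_
    rw [← Nat.modEq_and_modEq_iff_modEq_mul hqq']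
    have h1 : m % q = b ↔ m ≡ b [MOD q] := by
      rw [Nat.ModEq, Nat.mod_eq_of_lt (mem_range.1 hb)]
    have h2 : m % q' = b' ↔ m ≡ b' [MOD q'] := by
      rw [Nat.ModEq, Nat.mod_eq_of_lt (mem_range.1 hb')]
    rw [h1, h2]
    exact ⟨fun h => ⟨h.1.trans hk.1.symm, h.2.trans hk.2.symm⟩,
      fun h => ⟨h.1.trans hk.1, h.2.trans hk.2⟩⟩
  rw [e2]
  push_cast at h
  exact h.le

theorem sum_sq_mod_le (M H a : ℕ) {r q : ℕ} (hr : 0 < r) (hq : 0 < q)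
    (hrq : r.Coprime q) (f : ℕ → ℝ) :
    ∑ m ∈ Ioc M (M + H) with m ≡ a [MOD r], f (m % q) ^ 2 ≤
      ((H : ℝ) / (r * q) + 1) * ∑ b ∈ range q, f b ^ 2 := by
  have e := sum_mod_eq_sum_range {m ∈ Ioc M (M + H) | m ≡ a [MOD r]} hq (fun b => f b ^ 2)
    (fun _ => 1)
  simp only [one_mul] at e
  rw [e, mul_sum]
  refine sum_le_sum fun b hb => ?_
  rw [mul_comm]
  refine mul_le_mul_of_nonneg_right ?_ (sq_nonneg _)
  have h := (abs_lt.1 (abs_card_modEq_mod_sub_lt M H a b hr hq hrq)).2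
  rw [sum_const, nsmul_eq_mul, mul_one]
  have e2 : {m ∈ {m ∈ Ioc M (M + H) | m ≡ a [MOD r]} | m % q = b} =
      {m ∈ {m ∈ Ioc M (M + H) | m ≡ a [MOD r]} | m ≡ b [MOD q]} :=
    filter_congr fun m _ => by rw [Nat.ModEq, Nat.mod_eq_of_lt (mem_range.1 hb)]
  rw [e2]
  linarith

theorem sum_sq_residue_deviation_le (M H a Y : ℕ) {r : ℕ} (hr : 0 < r) (Q : Finset ℕ)
    (hQ : ∀ q ∈ Q, q.Prime) (hQr : ∀ q ∈ Q, r.Coprime q) (hQY : ∀ q ∈ Q, q ≤ Y) (c : ℕ → ℝ)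
    (S : Finset ℕ) (hS : S = {m ∈ Ioc M (M + H) | m ≡ a [MOD r]}) :
    ∑ q ∈ Q, (q : ℝ) * ∑ b ∈ range q,
      (∑ m ∈ S with m % q = b, c m - (∑ m ∈ S, c m) / q) ^ 2 ≤
    ((H : ℝ) / r + 2 * (Y : ℝ) ^ 3) * ∑ m ∈ S, c m ^ 2 := by
  set ξ : ℕ → ℕ → ℝ := fun q b => ∑ m ∈ S with m % q = b, c m - (∑ m ∈ S, c m) / q with hξ
  set X := ∑ q ∈ Q, (q : ℝ) * ∑ b ∈ range q, ξ q b ^ 2 with hX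
  have hξ0 : ∀ q ∈ Q, ∑ b ∈ range q, ξ q b = 0 := by
    intro q hq
    have hq0 := (hQ q hq).pos
    have h := sum_mod_eq_sum_range S hq0 (fun _ => 1) c
    simp only [mul_one, one_mul] at h
    rw [hξ, sum_sub_distrib, ← h, sum_const, card_range, nsmul_eq_mul]
    have : (q : ℝ) ≠ 0 := by exact_mod_cast hq0.ne'
    field_simp
    ring
  set v : ℕ → ℝ := fun m => ∑ q ∈ Q, (q : ℝ) * ξ q (m % q) with hv
  have hXv : X = ∑ m ∈ S, c m * v m := by
    simp_rw [hv, mul_sum]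
    rw [sum_comm]
    refine sum_congr rfl fun q hq => ?_
    have h := sum_mod_eq_sum_range S (hQ q hq).pos (ξ q) c
    have h2 : ∑ m ∈ S, c m * ((q : ℝ) * ξ q (m % q)) = q * ∑ m ∈ S, c m * ξ q (m % q) := by
      rw [mul_sum]; exact sum_congr rfl fun _ _ => by ring
    rw [h2, h]
    congr 1
    have h3 : ∑ b ∈ range q, ξ q b * ((∑ m ∈ S, c m) / q) = 0 := by
      rw [← sum_mul, hξ0 q hq, zero_mul]
    rw [← sub_eq_zero, ← sum_sub_distrib, ← neg_eq_zero, ← h3, ← sum_neg_distrib]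
    refine sum_congr rfl fun b _ => ?_
    simp only [hξ]
    ring
  have hX0 : 0 ≤ X := sum_nonneg fun q _ => by positivity
  have hdiag : ∀ q ∈ Q, ∑ m ∈ S, ((q : ℝ) * ξ q (m % q)) ^ 2 ≤
      ((H : ℝ) / r + Y) * (q * ∑ b ∈ range q, ξ q b ^ 2) := by
    intro q hq
    have hq0 := (hQ q hq).pos
    have h := sum_sq_mod_le M H a hr hq0 (hQr q hq) (ξ q)
    rw [← hS] at h
    simp_rw [mul_pow]
    rw [← mul_sum]
    have hs : 0 ≤ ∑ b ∈ range q, ξ q b ^ 2 := by positivity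
    have hq' : (0 : ℝ) < q := by exact_mod_cast hq0
    have hr' : (0 : ℝ) < r := by exact_mod_cast hr
    have hqY : (q : ℝ) ≤ Y := by exact_mod_cast hQY q hq
    calc (q : ℝ) ^ 2 * ∑ m ∈ S, ξ q (m % q) ^ 2
        ≤ (q : ℝ) ^ 2 * (((H : ℝ) / (r * q) + 1) * ∑ b ∈ range q, ξ q b ^ 2) := by gcongr
      _ = ((H : ℝ) / r + q) * (q * ∑ b ∈ range q, ξ q b ^ 2) := by field_simp
      _ ≤ _ := by gcongr
  set Z := ∑ q ∈ Q, (q : ℝ) * ∑ b ∈ range q, |ξ q b| with hZ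
  have hvv : ∑ m ∈ S, v m ^ 2 ≤ ((H : ℝ) / r + Y) * X + Z ^ 2 := by
    have e : ∑ m ∈ S, v m ^ 2 = ∑ q ∈ Q, ∑ q' ∈ Q,
        ∑ m ∈ S, ((q : ℝ) * ξ q (m % q)) * ((q' : ℝ) * ξ q' (m % q')) := by
      simp_rw [hv, sq, sum_mul_sum]
      rw [sum_comm]
      refine sum_congr rfl fun q _ => ?_
      rw [sum_comm]
    have e2 : ((H : ℝ) / r + Y) * X + Z ^ 2 = ∑ q ∈ Q, ∑ q' ∈ Q,
        ((if q = q' then ((H : ℝ) / r + Y) * (q * ∑ b ∈ range q, ξ q b ^ 2) else 0) +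
        ((q : ℝ) * ∑ b ∈ range q, |ξ q b|) * ((q' : ℝ) * ∑ b ∈ range q', |ξ q' b|)) := by
      rw [hX, mul_sum, hZ, sq, sum_mul_sum, ← sum_add_distrib]
      refine sum_congr rfl fun q hq => ?_
      rw [sum_add_distrib, sum_ite_eq, if_pos hq]
    rw [e, e2]
    refine sum_le_sum fun q hq => sum_le_sum fun q' hq' => ?_
    by_cases hqq : q = q'
    · subst hqq
      rw [if_pos rfl]
      have := hdiag q hq
      simp_rw [← sq]
      have h2 : 0 ≤ ((q : ℝ) * ∑ b ∈ range q, |ξ q b|) ^ 2 := by positivity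
      linarith
    · rw [if_neg hqq, zero_add]
      have h := abs_sum_mul_mod_mod_le M H a hr (hQ q hq).pos (hQ q' hq').pos (hQr q hq)
        (hQr q' hq') ((Nat.coprime_primes (hQ q hq) (hQ q' hq')).2 hqq) (ξ q) (ξ q') (hξ0 q hq)
      rw [← hS] at h
      calc ∑ m ∈ S, ((q : ℝ) * ξ q (m % q)) * ((q' : ℝ) * ξ q' (m % q'))
          = (q * q') * ∑ m ∈ S, ξ q (m % q) * ξ q' (m % q') := by
            rw [mul_sum]; exact sum_congr rfl fun _ _ => by ring
        _ ≤ (q * q') * ((∑ b ∈ range q, |ξ q b|) * ∑ b ∈ range q', |ξ q' b|) := by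
            gcongr
            exact (le_abs_self _).trans h
        _ = _ := by ring
  have hZX : Z ^ 2 ≤ (Y : ℝ) ^ 3 * X := by
    have h1 : ∀ q ∈ Q, (∑ b ∈ range q, |ξ q b|) ^ 2 ≤ q * ∑ b ∈ range q, ξ q b ^ 2 := by
      intro q _
      have := sq_sum_le_card_mul_sum_sq (s := range q) (f := fun b => |ξ q b|)
      simpa only [card_range, sq_abs] using this
    have hcard : (#Q : ℝ) ≤ Y := by
      have : Q ⊆ Ioc 0 Y := fun q hq => mem_Ioc.2 ⟨(hQ q hq).pos, hQY q hq⟩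
      have := card_le_card this
      rw [Nat.card_Ioc] at this
      exact_mod_cast this
    calc Z ^ 2 ≤ #Q * ∑ q ∈ Q, ((q : ℝ) * ∑ b ∈ range q, |ξ q b|) ^ 2 :=
          sq_sum_le_card_mul_sum_sq
      _ ≤ #Q * ∑ q ∈ Q, (Y : ℝ) ^ 2 * (q * ∑ b ∈ range q, ξ q b ^ 2) := by
          refine mul_le_mul_of_nonneg_left (sum_le_sum fun q hq => ?_) (by positivity)
          rw [mul_pow]
          have hqY : (q : ℝ) ≤ Y := by exact_mod_cast hQY q hq
          have := h1 q hq
          gcongr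
      _ = #Q * ((Y : ℝ) ^ 2 * X) := by rw [← mul_sum]
      _ ≤ Y * ((Y : ℝ) ^ 2 * X) := by gcongr
      _ = _ := by ring
  have hYY : (Y : ℝ) ≤ (Y : ℝ) ^ 3 := by
    have : Y ≤ Y ^ 3 := Nat.le_self_pow (by norm_num) Y
    exact_mod_cast this
  have hcs : X ^ 2 ≤ (∑ m ∈ S, c m ^ 2) * ∑ m ∈ S, v m ^ 2 := by
    rw [hXv]
    exact sum_mul_sq_le_sq_mul_sq _ _ _
  have hc0 : 0 ≤ ∑ m ∈ S, c m ^ 2 := by positivity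
  rcases hX0.eq_or_lt with h | h
  · rw [← h]
    positivity
  · have h2 : ∑ m ∈ S, v m ^ 2 ≤ ((H : ℝ) / r + 2 * (Y : ℝ) ^ 3) * X := by nlinarith
    have h3 := hcs.trans (mul_le_mul_of_nonneg_left h2 hc0)
    refine le_of_mul_le_mul_right ?_ h
    nlinarith

/-- The indicator of `n ≡ 1 (mod q)` minus its mean over the invertible residues. -/
noncomputable def oneResidueDeviation (q n : ℕ) : ℝ :=
  (if n % q = 1 then 1 else 0) - (if q ∣ n then 0 else 1 / ((q : ℝ) - 1))

theorem mul_mod_eq_one_iff {q : ℕ} (hq : q.Prime) {j : ℕ} (hj : ¬ q ∣ j) (m : ℕ) :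
    m * j % q = 1 ↔ m % q = ((j : ZMod q)⁻¹).val := by
  have : Fact q.Prime := ⟨hq⟩
  have hj0 : (j : ZMod q) ≠ 0 := fun h => hj ((ZMod.natCast_eq_zero_iff j q).1 h)
  have h1 : m * j % q = 1 ↔ ((m * j : ℕ) : ZMod q) = ((1 : ℕ) : ZMod q) := by
    rw [ZMod.natCast_eq_natCast_iff, Nat.ModEq, Nat.mod_eq_of_lt hq.one_lt]
  rw [h1, ← ZMod.val_natCast, (ZMod.val_injective q).eq_iff]
  rw [Nat.cast_mul]
  rw [Nat.cast_one, ← eq_div_iff hj0, one_div]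

theorem sum_inv_val_eq {q : ℕ} (hq : q.Prime) (F : ℕ → ℝ) :
    ∑ j ∈ (range q).erase 0, F ((j : ZMod q)⁻¹).val = ∑ b ∈ (range q).erase 0, F b := by
  have : Fact q.Prime := ⟨hq⟩
  have hmaps : ∀ j ∈ (range q).erase 0, ((j : ZMod q)⁻¹).val ∈ (range q).erase 0 := by
    intro j hj
    rw [mem_erase, mem_range] at hj ⊢
    refine ⟨?_, ZMod.val_lt _⟩
    rw [Ne, ZMod.val_eq_zero, inv_eq_zero, ZMod.natCast_eq_zero_iff]
    exact Nat.not_dvd_of_pos_of_lt (Nat.pos_of_ne_zero hj.1) hj.2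
  have hinv : ∀ j ∈ (range q).erase 0,
      (((((j : ZMod q)⁻¹).val : ℕ) : ZMod q)⁻¹).val = j := by
    intro j hj
    rw [mem_erase, mem_range] at hj
    rw [ZMod.natCast_zmod_val, inv_inv, ZMod.val_cast_of_lt hj.2]
  exact sum_nbij' (fun j => ((j : ZMod q)⁻¹).val) (fun j => ((j : ZMod q)⁻¹).val)
    hmaps hmaps hinv hinv (fun _ _ => rfl)

theorem sum_mul_oneResidueDeviation {q : ℕ} (hq : q.Prime) (S : Finset ℕ) (c : ℕ → ℝ) {j : ℕ}
    (hj : ¬ q ∣ j) :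
    ∑ m ∈ S, c m * oneResidueDeviation q (m * j) =
      (∑ m ∈ S with m % q = ((j : ZMod q)⁻¹).val, c m - (∑ m ∈ S, c m) / q) +
      (∑ m ∈ S with m % q = 0, c m - (∑ m ∈ S, c m) / q) / (q - 1) := by
  have hq1 : (1 : ℝ) < q := by exact_mod_cast hq.one_lt
  have e : ∑ m ∈ S, c m * oneResidueDeviation q (m * j) =
      ∑ m ∈ S with m % q = ((j : ZMod q)⁻¹).val, c m -
      (∑ m ∈ S, c m - ∑ m ∈ S with m % q = 0, c m) / (q - 1) := by
    rw [sum_filter, sum_filter, ← sum_sub_distrib, sum_div, ← sum_sub_distrib]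
    refine sum_congr rfl fun m _ => ?_
    have h2 : q ∣ m * j ↔ m % q = 0 := by
      rw [hq.dvd_mul, or_iff_left hj, Nat.dvd_iff_mod_eq_zero]
    simp only [oneResidueDeviation, mul_mod_eq_one_iff hq hj, h2]
    split_ifs <;> ring
  rw [e]
  have h3 : (q : ℝ) - 1 ≠ 0 := by linarith
  field_simp
  ring

theorem sq_bilinear_oneResidueDeviation_le {q : ℕ} (hq : q.Prime) (S T : Finset ℕ)
    (c β : ℕ → ℝ) :
    (∑ m ∈ S, ∑ k ∈ T, c m * β k * oneResidueDeviation q (m * k)) ^ 2 ≤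
      (∑ b ∈ range q, (∑ m ∈ S with m % q = b, c m - (∑ m ∈ S, c m) / q) ^ 2) *
      ∑ b ∈ (range q).erase 0, (∑ k ∈ T with k % q = b, β k) ^ 2 := by
  set ξ : ℕ → ℝ := fun b => ∑ m ∈ S with m % q = b, c m - (∑ m ∈ S, c m) / q with hξ
  set g : ℕ → ℝ := fun j => ∑ m ∈ S, c m * oneResidueDeviation q (m * j) with hg
  have hq0 := hq.pos
  have hq1 : (1 : ℝ) < q := by exact_mod_cast hq.one_lt
  have hmod : ∀ k, g k = g (k % q) := by
    intro k
    simp only [hg]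
    refine sum_congr rfl fun m _ => ?_
    have h1 : m * (k % q) % q = m * k % q := by rw [Nat.mul_mod, Nat.mod_mod, ← Nat.mul_mod]
    simp only [oneResidueDeviation, Nat.dvd_iff_mod_eq_zero, h1]
  have hg0 : g 0 = 0 := by
    simp [hg, oneResidueDeviation]
  have e1 : ∑ m ∈ S, ∑ k ∈ T, c m * β k * oneResidueDeviation q (m * k) =
      ∑ b ∈ (range q).erase 0, g b * ∑ k ∈ T with k % q = b, β k := by
    have h := sum_mod_eq_sum_range T hq0 g β
    rw [← add_sum_erase _ _ (mem_range.2 hq0), hg0, zero_mul, zero_add] at h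
    rw [← h, sum_comm]
    refine sum_congr rfl fun k _ => ?_
    rw [← hmod, mul_sum]
    exact sum_congr rfl fun m _ => by ring
  have hξ0 : ∑ b ∈ range q, ξ b = 0 := by
    have h := sum_mod_eq_sum_range S hq0 (fun _ => 1) c
    simp only [mul_one, one_mul] at h
    rw [hξ, sum_sub_distrib, ← h, sum_const, card_range, nsmul_eq_mul]
    field_simp
    ring
  have e2 : ∑ b ∈ (range q).erase 0, g b ^ 2 ≤ ∑ b ∈ range q, ξ b ^ 2 := by
    have h1 : ∑ b ∈ (range q).erase 0, g b ^ 2 =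
        ∑ b ∈ (range q).erase 0, (ξ b + ξ 0 / (q - 1)) ^ 2 := by
      rw [← sum_inv_val_eq hq (fun b => (ξ b + ξ 0 / (q - 1)) ^ 2)]
      refine sum_congr rfl fun j hj => ?_
      rw [mem_erase, mem_range] at hj
      simp only [hg, hξ]
      rw [sum_mul_oneResidueDeviation hq S c
        (Nat.not_dvd_of_pos_of_lt (Nat.pos_of_ne_zero hj.1) hj.2)]
    rw [← add_sum_erase _ _ (mem_range.2 hq0)] at hξ0 ⊢
    have h2 : ∑ b ∈ (range q).erase 0, (ξ b + ξ 0 / (q - 1)) ^ 2 =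
        ∑ b ∈ (range q).erase 0, ξ b ^ 2 - ξ 0 ^ 2 / (q - 1) := by
      have : ∀ b, (ξ b + ξ 0 / (q - 1)) ^ 2 =
          ξ b ^ 2 + 2 * (ξ 0 / (q - 1)) * ξ b + (ξ 0 / (q - 1)) ^ 2 := fun b => by ring
      simp_rw [this, sum_add_distrib, ← mul_sum]
      rw [sum_const, card_erase_of_mem (mem_range.2 hq0), card_range, nsmul_eq_mul,
        Nat.cast_sub hq0, Nat.cast_one, eq_neg_of_add_eq_zero_right hξ0]
      have h3 : (q : ℝ) - 1 ≠ 0 := by linarith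
      field_simp
      ring
    rw [h1, h2]
    have h4 : 0 ≤ ξ 0 ^ 2 / ((q : ℝ) - 1) := div_nonneg (sq_nonneg _) (by linarith)
    nlinarith [sq_nonneg (ξ 0)]
  rw [e1]
  refine (sum_mul_sq_le_sq_mul_sq _ _ _).trans ?_
  exact mul_le_mul_of_nonneg_right e2 (by positivity)

theorem abs_sum_mul_le_of_antitone {f g : ℕ → ℝ} (hf : Antitone f) (hf0 : ∀ n, 0 ≤ f n) {K : ℝ}
    (hg : ∀ n, |∑ l ∈ Ioc 0 n, g l| ≤ K) (n : ℕ) :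
    |∑ l ∈ Ioc 0 n, f l * g l| ≤ K * f 0 := by
  have hK : 0 ≤ K := by simpa using hg 0
  have key : ∀ n, |∑ l ∈ Ioc 0 n, f l * g l - f n * ∑ l ∈ Ioc 0 n, g l| ≤ K * (f 0 - f n) := by
    intro n
    induction n with
    | zero => simp
    | succ n ih =>
      rw [sum_Ioc_succ_top (by omega), sum_Ioc_succ_top (by omega)]
      have e : ∑ l ∈ Ioc 0 n, f l * g l + f (n + 1) * g (n + 1) -
          f (n + 1) * (∑ l ∈ Ioc 0 n, g l + g (n + 1)) =
          (∑ l ∈ Ioc 0 n, f l * g l - f n * ∑ l ∈ Ioc 0 n, g l) +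
          (f n - f (n + 1)) * ∑ l ∈ Ioc 0 n, g l := by ring
      rw [e]
      have h1 : 0 ≤ f n - f (n + 1) := sub_nonneg.2 (hf n.le_succ)
      have h2 : |(f n - f (n + 1)) * ∑ l ∈ Ioc 0 n, g l| ≤ (f n - f (n + 1)) * K := by
        rw [abs_mul, abs_of_nonneg h1]
        exact mul_le_mul_of_nonneg_left (hg n) h1
      refine (abs_add_le _ _).trans ?_
      linarith
  have h1 := key n
  have h2 : |f n * ∑ l ∈ Ioc 0 n, g l| ≤ f n * K := by
    rw [abs_mul, abs_of_nonneg (hf0 n)]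
    exact mul_le_mul_of_nonneg_left (hg n) (hf0 n)
  have h3 := abs_add_le (∑ l ∈ Ioc 0 n, f l * g l - f n * ∑ l ∈ Ioc 0 n, g l)
    (f n * ∑ l ∈ Ioc 0 n, g l)
  rw [sub_add_cancel] at h3
  linarith

theorem abs_sum_oneResidueDeviation_le {q r : ℕ} (hq : q.Prime) (hr : 0 < r) (hrq : r.Coprime q)
    (d L : ℕ) :
    |∑ l ∈ Ioc 0 L with d * l ≡ 1 [MOD r], oneResidueDeviation q (d * l)| ≤ 3 := by
  have hq1 : (2 : ℝ) ≤ q := by exact_mod_cast hq.two_le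
  by_cases hqd : q ∣ d
  · rw [sum_eq_zero fun l _ => ?_]
    · simp
    · have h : q ∣ d * l := hqd.mul_right l
      simp [oneResidueDeviation, h, Nat.dvd_iff_mod_eq_zero.1 h]
  by_cases hdr : d.Coprime r
  swap
  · rw [filter_false_of_mem fun l _ h => hdr ?_]
    · simp
    · have := Nat.ModEq.gcd_eq h
      rw [Nat.gcd_one_left] at this
      exact Nat.Coprime.coprime_dvd_left (dvd_mul_right d l) this
  obtain ⟨a, ha⟩ : ∃ a, d * a ≡ 1 [MOD r] := by
    rcases Nat.lt_or_ge 1 r with h1 | h1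
    · obtain ⟨u, -, hu2⟩ := Nat.exists_mul_mod_eq_one_of_coprime hdr h1
      exact ⟨u, by rw [Nat.ModEq, hu2, Nat.mod_eq_of_lt h1]⟩
    · have : r = 1 := by omega
      subst this
      exact ⟨0, Nat.modEq_one⟩
  have hS : {l ∈ Ioc 0 L | d * l ≡ 1 [MOD r]} = {l ∈ Ioc 0 (0 + L) | l ≡ a [MOD r]} := by
    rw [Nat.zero_add]
    refine filter_congr fun l _ => ⟨fun h => ?_, fun h => (h.mul_left d).trans ha⟩
    exact Nat.ModEq.cancel_left_of_coprime (by rwa [Nat.gcd_comm]) (h.trans ha.symm)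
  rw [hS]
  set S := {l ∈ Ioc 0 (0 + L) | l ≡ a [MOD r]} with hSdef
  clear_value S
  set b := ((d : ZMod q)⁻¹).val with hb
  have e : ∑ l ∈ S, oneResidueDeviation q (d * l) =
      (#{l ∈ S | l ≡ b [MOD q]} : ℝ) - ((#S : ℝ) - #{l ∈ S | l ≡ 0 [MOD q]}) / (q - 1) := by
    have h1 : ∀ l, d * l % q = 1 ↔ l ≡ b [MOD q] := by
      intro l
      have : Fact q.Prime := ⟨hq⟩
      rw [mul_comm, mul_mod_eq_one_iff hq hqd, Nat.ModEq, ← hb, Nat.mod_eq_of_lt (ZMod.val_lt _)]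
    have h2 : ∀ l, q ∣ d * l ↔ l ≡ 0 [MOD q] := by
      intro l
      rw [hq.dvd_mul, or_iff_right hqd, Nat.modEq_zero_iff_dvd]
    simp only [oneResidueDeviation, h1, h2]
    rw [card_eq_sum_ones, card_eq_sum_ones, card_eq_sum_ones, sum_filter, sum_filter]
    push_cast
    rw [← sum_sub_distrib, sum_div, ← sum_sub_distrib]
    refine sum_congr rfl fun m _ => ?_
    split_ifs <;> ring
  have c1 := abs_lt.1 (abs_card_modEq_mod_sub_lt 0 L a b hr hq.pos hrq)
  have c2 := abs_lt.1 (abs_card_modEq_mod_sub_lt 0 L a 0 hr hq.pos hrq)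
  have c3 := abs_lt.1 (abs_card_modEq_sub_lt 0 L a hr)
  rw [← hSdef] at c1 c2 c3
  have hr' : (0 : ℝ) < r := by exact_mod_cast hr
  have hq0 : (0 : ℝ) < q - 1 := by linarith
  have e2 : ((L : ℝ) / r - L / (r * q)) / (q - 1) = L / (r * q) := by
    field_simp
  have h3 : |((#S : ℝ) - #{l ∈ S | l ≡ 0 [MOD q]}) / (q - 1) - L / (r * q)| ≤ 2 := by
    rw [← e2, ← sub_div, abs_div, abs_of_pos hq0, div_le_iff₀ hq0, abs_le]
    constructor <;> nlinarith [c2.1, c2.2, c3.1, c3.2]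
  rw [e]
  have h4 := abs_le.1 h3
  rw [abs_le]
  constructor <;> linarith [c1.1, c1.2]

theorem abs_sum_antitone_mul_oneResidueDeviation_le {q r : ℕ} (hq : q.Prime) (hr : 0 < r)
    (hrq : r.Coprime q) (d L : ℕ) {f : ℕ → ℝ} (hf : Antitone f) (hf0 : ∀ n, 0 ≤ f n) :
    |∑ l ∈ Ioc 0 L with d * l ≡ 1 [MOD r], f l * oneResidueDeviation q (d * l)| ≤ 3 * f 0 := by
  have h := abs_sum_mul_le_of_antitone hf hf0 (K := 3)
    (g := fun l => if d * l ≡ 1 [MOD r] then oneResidueDeviation q (d * l) else 0)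
    (fun n => by
      rw [← sum_filter]
      exact abs_sum_oneResidueDeviation_le hq hr hrq d n) L
  simp only [mul_ite, mul_zero] at h
  rwa [← sum_filter] at h

/-- The deviation from equidistribution modulo `q`, restricted to `n ≡ 1 (mod r)` and smoothed by
the weight `max (t - n) 0`. -/
noncomputable def smoothedDeviation (r q t n : ℕ) : ℝ :=
  if n ≡ 1 [MOD r] then ((t - n : ℕ) : ℝ) * oneResidueDeviation q n else 0

/-- The Möbius function truncated to arguments at most `D`. -/
noncomputable def truncatedMoebius (D : ℕ) : ArithmeticFunction ℝ :=
  ⟨fun d => if d ≤ D then ((ArithmeticFunction.moebius d : ℤ) : ℝ) else 0, by simp⟩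

/-- The divisor sum of the truncated Möbius function. -/
noncomputable def truncatedMoebiusSum (D : ℕ) : ArithmeticFunction ℝ :=
  truncatedMoebius D * ((ArithmeticFunction.zeta : ArithmeticFunction ℕ) : ArithmeticFunction ℝ)

theorem smoothedDeviation_eq_zero {r q t n : ℕ} (h : t ≤ n) : smoothedDeviation r q t n = 0 := by
  simp [smoothedDeviation, Nat.sub_eq_zero_of_le h]

theorem abs_truncatedMoebius_le (D d : ℕ) :
    |truncatedMoebius D d| ≤ if d ≤ D then 1 else 0 := by
  simp only [truncatedMoebius, ArithmeticFunction.coe_mk]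
  split_ifs
  · exact_mod_cast ArithmeticFunction.abs_moebius_le_one
  · simp

theorem sum_abs_truncatedMoebius_le (D N : ℕ) :
    ∑ d ∈ Ioc 0 N, |truncatedMoebius D d| ≤ D := by
  calc ∑ d ∈ Ioc 0 N, |truncatedMoebius D d| ≤ ∑ d ∈ Ioc 0 N, if d ≤ D then (1 : ℝ) else 0 :=
        sum_le_sum fun d _ => abs_truncatedMoebius_le D d
    _ = (#{d ∈ Ioc 0 N | d ≤ D} : ℝ) := by rw [← sum_filter, sum_const, nsmul_eq_mul, mul_one]
    _ ≤ (#(Ioc 0 D) : ℝ) := by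
        refine Nat.cast_le.2 (card_le_card fun d hd => ?_)
        simp only [mem_filter, mem_Ioc] at hd ⊢
        exact ⟨hd.1.1, hd.2⟩
    _ = D := by simp

theorem truncatedMoebiusSum_one {D : ℕ} (hD : 1 ≤ D) : truncatedMoebiusSum D 1 = 1 := by
  rw [truncatedMoebiusSum, ArithmeticFunction.coe_mul_zeta_apply]
  simp [truncatedMoebius, hD]

theorem truncatedMoebiusSum_eq_zero {D m : ℕ} (h1 : 1 < m) (hm : m ≤ D) :
    truncatedMoebiusSum D m = 0 := by
  have h := congrArg (fun f : ArithmeticFunction ℝ => f m)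
    (ArithmeticFunction.coe_moebius_mul_coe_zeta (R := ℝ))
  simp only [ArithmeticFunction.coe_mul_zeta_apply, ArithmeticFunction.one_apply_ne h1.ne'] at h
  rw [truncatedMoebiusSum, ArithmeticFunction.coe_mul_zeta_apply, ← h]
  refine sum_congr rfl fun d hd => ?_
  have : d ≤ D := (Nat.divisor_le hd).trans hm
  simp [truncatedMoebius, this]

theorem abs_truncatedMoebiusSum_le (D m : ℕ) :
    |truncatedMoebiusSum D m| ≤ #m.divisors := by
  rw [truncatedMoebiusSum, ArithmeticFunction.coe_mul_zeta_apply]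
  refine (abs_sum_le_sum_abs _ _).trans ?_
  rw [card_eq_sum_ones, Nat.cast_sum]
  refine sum_le_sum fun d _ => (abs_truncatedMoebius_le D d).trans ?_
  split_ifs <;> simp

theorem sum_mul_apply_mul (f g : ArithmeticFunction ℝ) (G : ℕ → ℝ) (N : ℕ) :
    ∑ n ∈ Ioc 0 N, (f * g) n * G n =
      ∑ n ∈ Ioc 0 N, f n * ∑ m ∈ Ioc 0 (N / n), g m * G (n * m) := by
  have e1 : ∑ n ∈ Ioc 0 N, (f * g) n * G n =
      ∑ x ∈ Ioc 0 N ×ˢ Ioc 0 N with x.1 * x.2 ≤ N, f x.1 * (g x.2 * G (x.1 * x.2)) := by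
    simp only [ArithmeticFunction.mul_apply]
    trans ∑ n ∈ Ioc 0 N, ∑ x ∈ Ioc 0 N ×ˢ Ioc 0 N with x.1 * x.2 = n,
      f x.1 * (g x.2 * G (x.1 * x.2))
    · refine sum_congr rfl fun n hn => ?_
      simp only [mem_Ioc] at hn
      rw [Nat.divisorsAntidiagonal_eq_prod_filter_of_le hn.1.ne' hn.2, sum_mul]
      refine sum_congr rfl fun x hx => ?_
      rw [(mem_filter.1 hx).2]
      ring
    · simp_rw [sum_filter]
      rw [sum_comm]
      exact sum_congr rfl fun _ _ => (by simp_all)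
  rw [e1, sum_filter, sum_product]
  refine sum_congr rfl fun n hn => ?_
  rw [← sum_filter, mul_sum]
  refine sum_congr ?_ fun _ _ => rfl
  ext m
  have hn' := (mem_Ioc.1 hn).1
  simp only [mem_filter, mem_Ioc, Nat.le_div_iff_mul_le hn']
  constructor
  · rintro ⟨⟨h1, _⟩, h2⟩
    exact ⟨h1, by rwa [mul_comm]⟩
  · rintro ⟨h1, h2⟩
    exact ⟨⟨h1, (Nat.le_mul_of_pos_right m hn').trans h2⟩, by rwa [mul_comm]⟩

theorem abs_sum_smoothedDeviation_le {q r : ℕ} (hq : q.Prime) (hr : 0 < r)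
    (hrq : r.Coprime q) (t d L : ℕ) :
    |∑ l ∈ Ioc 0 L, smoothedDeviation r q t (d * l)| ≤ 3 * t := by
  have h := abs_sum_antitone_mul_oneResidueDeviation_le hq hr hrq d L
    (f := fun l => ((t - d * l : ℕ) : ℝ))
    (fun a b hab => Nat.cast_le.2 (Nat.sub_le_sub_left (Nat.mul_le_mul_left d hab) t))
    (fun _ => Nat.cast_nonneg _)
  simp only [mul_zero, Nat.sub_zero] at h
  rw [sum_filter] at h
  exact h

theorem abs_sum_log_smoothedDeviation_le {q r : ℕ} (hq : q.Prime) (hr : 0 < r)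
    (hrq : r.Coprime q) {t d : ℕ} (ht : 1 ≤ t) (hd : 1 ≤ d) (L : ℕ) :
    |∑ l ∈ Ioc 0 L, Real.log l * smoothedDeviation r q t (d * l)| ≤ 6 * t * Real.log t := by
  have hlogt : 0 ≤ Real.log t := Real.log_nonneg (by exact_mod_cast ht)
  have hlog : ∀ a b : ℕ, a ≤ b → Real.log a ≤ Real.log b := fun a b hab => by
    rcases Nat.eq_zero_or_pos a with rfl | ha
    · simpa using Real.log_natCast_nonneg b
    · exact Real.log_le_log (by exact_mod_cast ha) (by exact_mod_cast hab)
  have h := abs_sum_antitone_mul_oneResidueDeviation_le hq hr hrq d L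
    (f := fun l => max (Real.log t - Real.log l) 0 * ((t - d * l : ℕ) : ℝ))
    (fun a b hab => mul_le_mul (max_le_max (by linarith [hlog a b hab]) le_rfl)
      (Nat.cast_le.2 (Nat.sub_le_sub_left (Nat.mul_le_mul_left d hab) t)) (Nat.cast_nonneg _)
      (le_max_right _ _))
    (fun _ => mul_nonneg (le_max_right _ _) (Nat.cast_nonneg _))
  simp only [mul_zero, Nat.sub_zero, Nat.cast_zero, Real.log_zero, sub_zero,
    max_eq_left hlogt] at h
  have h1 := abs_sum_smoothedDeviation_le hq hr hrq t d L
  have e : ∑ l ∈ Ioc 0 L, Real.log l * smoothedDeviation r q t (d * l) =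
      Real.log t * ∑ l ∈ Ioc 0 L, smoothedDeviation r q t (d * l) -
      ∑ l ∈ Ioc 0 L with d * l ≡ 1 [MOD r], max (Real.log t - Real.log l) 0 *
        ((t - d * l : ℕ) : ℝ) * oneResidueDeviation q (d * l) := by
    rw [mul_sum, sum_filter, ← sum_sub_distrib]
    refine sum_congr rfl fun l _ => ?_
    rcases le_or_gt t (d * l) with hl | hl
    · rw [smoothedDeviation_eq_zero hl, Nat.sub_eq_zero_of_le hl]
      simp
    · have hlt : l ≤ t := (Nat.le_mul_of_pos_left l hd).trans hl.le
      rw [max_eq_left (by linarith [hlog l t hlt]), smoothedDeviation]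
      split_ifs <;> ring
  rw [e]
  have h2 : |Real.log t * ∑ l ∈ Ioc 0 L, smoothedDeviation r q t (d * l)| ≤
      Real.log t * (3 * t) := by
    rw [abs_mul, abs_of_nonneg hlogt]
    exact mul_le_mul_of_nonneg_left h1 hlogt
  refine (abs_sub _ _).trans ?_
  linarith

theorem abs_sum_truncatedMoebius_mul_log_le {q r : ℕ} (hq : q.Prime) (hr : 0 < r)
    (hrq : r.Coprime q) {t : ℕ} (ht : 1 ≤ t) (D : ℕ) :
    |∑ n ∈ Ioc 0 t, (truncatedMoebius D * ArithmeticFunction.log) n *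
      smoothedDeviation r q t n| ≤ D * (6 * t * Real.log t) := by
  rw [sum_mul_apply_mul]
  have hlogt : 0 ≤ Real.log t := Real.log_nonneg (by exact_mod_cast ht)
  calc _ ≤ ∑ d ∈ Ioc 0 t, |truncatedMoebius D d| * (6 * t * Real.log t) := by
        refine (abs_sum_le_sum_abs _ _).trans (sum_le_sum fun d hd => ?_)
        rw [abs_mul]
        refine mul_le_mul_of_nonneg_left ?_ (abs_nonneg _)
        exact abs_sum_log_smoothedDeviation_le hq hr hrq ht (mem_Ioc.1 hd).1 _
    _ ≤ _ := by
        rw [← sum_mul]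
        exact mul_le_mul_of_nonneg_right (sum_abs_truncatedMoebius_le D t) (by positivity)

theorem abs_sum_truncatedMoebiusSum_smoothedDeviation_le {q r : ℕ} (hq : q.Prime) (hr : 0 < r)
    (hrq : r.Coprime q) (t D k N : ℕ) :
    |∑ m ∈ Ioc 0 N, truncatedMoebiusSum D m * smoothedDeviation r q t (m * k)| ≤
      D * (3 * t) := by
  rw [truncatedMoebiusSum, sum_mul_apply_mul _ _ (fun n => smoothedDeviation r q t (n * k))]
  calc _ ≤ ∑ d ∈ Ioc 0 N, |truncatedMoebius D d| * (3 * t) := by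
        refine (abs_sum_le_sum_abs _ _).trans (sum_le_sum fun d hd => ?_)
        rw [abs_mul]
        refine mul_le_mul_of_nonneg_left ?_ (abs_nonneg _)
        have h := abs_sum_smoothedDeviation_le hq hr hrq t (d * k) (N / d)
        have e : ∑ m ∈ Ioc 0 (N / d), (((ArithmeticFunction.zeta : ArithmeticFunction ℕ) :
            ArithmeticFunction ℝ) m) * smoothedDeviation r q t (d * m * k) =
            ∑ l ∈ Ioc 0 (N / d), smoothedDeviation r q t (d * k * l) := by
          refine sum_congr rfl fun m hm => ?_
          have hm' : m ≠ 0 := (mem_Ioc.1 hm).1.ne'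
          rw [ArithmeticFunction.natCoe_apply, ArithmeticFunction.zeta_apply_ne hm', Nat.cast_one,
            one_mul, mul_right_comm]
        rw [e]
        exact h
    _ ≤ _ := by
        rw [← sum_mul]
        exact mul_le_mul_of_nonneg_right (sum_abs_truncatedMoebius_le D N) (by positivity)

theorem abs_sum_large_truncatedMoebiusSum_le {q r : ℕ} (hq : q.Prime) (hr : 0 < r)
    (hrq : r.Coprime q) (t D : ℕ) {U : ℕ} (hU : 0 < U) (hUt : U ≤ t) :
    |∑ m ∈ Ioc U t, truncatedMoebiusSum D m * ∑ k ∈ Ioc 0 (t / m),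
      Λ k * smoothedDeviation r q t (m * k)| ≤
      Chebyshev.psi ((t / U : ℕ) : ℝ) * (D * (6 * t)) := by
  have e : ∑ m ∈ Ioc U t, truncatedMoebiusSum D m * ∑ k ∈ Ioc 0 (t / m),
      Λ k * smoothedDeviation r q t (m * k) = ∑ k ∈ Ioc 0 (t / U), Λ k *
        ∑ m ∈ Ioc U t, truncatedMoebiusSum D m * smoothedDeviation r q t (m * k) := by
    have h1 : ∀ m ∈ Ioc U t, truncatedMoebiusSum D m * ∑ k ∈ Ioc 0 (t / m),
        Λ k * smoothedDeviation r q t (m * k) = ∑ k ∈ Ioc 0 (t / U),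
        Λ k * (truncatedMoebiusSum D m * smoothedDeviation r q t (m * k)) := by
      intro m hm
      have hm' := mem_Ioc.1 hm
      rw [mul_sum]
      refine (sum_subset (Ioc_subset_Ioc_right (Nat.div_le_div_left hm'.1.le hU))
        fun k hk hk2 => ?_).trans (sum_congr rfl fun _ _ => by ring)
      simp only [mem_Ioc, not_and, not_le] at hk hk2
      have := (Nat.div_lt_iff_lt_mul (by omega)).1 (hk2 hk.1)
      rw [smoothedDeviation_eq_zero (by rw [mul_comm]; exact this.le)]
      ring
    rw [sum_congr rfl h1, sum_comm]
    simp_rw [mul_sum]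
  rw [e, psi_natCast, sum_mul]
  refine (abs_sum_le_sum_abs _ _).trans (sum_le_sum fun k _ => ?_)
  rw [abs_mul, abs_of_nonneg ArithmeticFunction.vonMangoldt_nonneg]
  refine mul_le_mul_of_nonneg_left ?_ ArithmeticFunction.vonMangoldt_nonneg
  have h1 := abs_sum_truncatedMoebiusSum_smoothedDeviation_le hq hr hrq t D k t
  have h2 := abs_sum_truncatedMoebiusSum_smoothedDeviation_le hq hr hrq t D k U
  have h3 := sum_Ioc_consecutive (fun m => truncatedMoebiusSum D m *
    smoothedDeviation r q t (m * k)) (Nat.zero_le U) hUt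
  rw [← h3] at h1
  rw [abs_le] at h1 h2 ⊢
  constructor <;> linarith [h1.1, h1.2, h2.1, h2.2]

theorem sum_vonMangoldt_smoothedDeviation_eq (r q : ℕ) {t D : ℕ} (hD : 1 ≤ D) (hDt : D ≤ t) :
    ∑ n ∈ Ioc 0 t, Λ n * smoothedDeviation r q t n =
      ∑ n ∈ Ioc 0 t, (truncatedMoebius D * ArithmeticFunction.log) n * smoothedDeviation r q t n -
      ∑ m ∈ Ioc D t, truncatedMoebiusSum D m * ∑ k ∈ Ioc 0 (t / m),
        Λ k * smoothedDeviation r q t (m * k) := by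
  have e : truncatedMoebius D * ArithmeticFunction.log = truncatedMoebiusSum D * Λ := by
    rw [truncatedMoebiusSum, mul_assoc, mul_comm _ Λ, ArithmeticFunction.vonMangoldt_mul_zeta]
  rw [e, sum_mul_apply_mul, ← sum_Ioc_consecutive (fun m => truncatedMoebiusSum D m * _)
    (Nat.zero_le D) hDt, add_sub_cancel_right, ← sum_Ioc_consecutive _ (Nat.zero_le 1) hD]
  rw [sum_eq_zero (s := Ioc 1 D) fun m hm => ?_]
  · simp [truncatedMoebiusSum_one hD]
  · have hm' := mem_Ioc.1 hm
    rw [truncatedMoebiusSum_eq_zero hm'.1 hm'.2, zero_mul]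

theorem exists_mul_modEq_one {n d : ℕ} (hd : 0 < d) (h : n.Coprime d) :
    ∃ a, n * a ≡ 1 [MOD d] ∧ a.Coprime d := by
  obtain ⟨a, ha⟩ : ∃ a, n * a ≡ 1 [MOD d] := by
    rcases Nat.lt_or_ge 1 d with h1 | h1
    · obtain ⟨u, -, hu2⟩ := Nat.exists_mul_mod_eq_one_of_coprime h h1
      exact ⟨u, by rw [Nat.ModEq, hu2, Nat.mod_eq_of_lt h1]⟩
    · have : d = 1 := by omega
      subst this
      exact ⟨0, Nat.modEq_one⟩
  refine ⟨a, ha, ?_⟩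
  have h2 := Nat.ModEq.gcd_eq ha
  rw [Nat.gcd_one_left] at h2
  exact Nat.Coprime.coprime_dvd_left (dvd_mul_left a n) h2

theorem coprime_of_mul_modEq_one {n k d : ℕ} (h : n * k ≡ 1 [MOD d]) : n.Coprime d := by
  have h2 := Nat.ModEq.gcd_eq h
  rw [Nat.gcd_one_left] at h2
  exact Nat.Coprime.coprime_dvd_left (dvd_mul_right n k) h2

theorem sum_vonMangoldt_mul_modEq_le : ∃ C : ℝ, 1 ≤ C ∧
    (∀ d n L : ℕ, 0 < d → d ≤ L →
      ∑ k ∈ Ioc 0 L with n * k ≡ 1 [MOD d], Λ k ≤ C * (L / d) * (Real.log d + 1)) ∧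
    (∀ r q n b L : ℕ, 0 < r → 0 < q → r.Coprime q → b.Coprime q → r * q ≤ L →
      ∑ k ∈ Ioc 0 L with n * k ≡ 1 [MOD r] ∧ k ≡ b [MOD q], Λ k ≤
        C * (L / (r * q)) * (Real.log (r * q) + 1)) := by
  obtain ⟨C, hC, h⟩ := sum_vonMangoldt_modEq_le
  have hpos : ∀ d L : ℕ, 0 < d → 0 ≤ (C + 1) * (L / d : ℝ) * (Real.log d + 1) := by
    intro d L hd
    have := Real.log_natCast_nonneg d
    positivity
  have hle : ∀ d L : ℕ, 0 < d →
      C * (L / d : ℝ) * (Real.log d + 1) ≤ (C + 1) * (L / d : ℝ) * (Real.log d + 1) := by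
    intro d L hd
    have := Real.log_natCast_nonneg d
    gcongr
    linarith
  refine ⟨C + 1, by linarith, fun d n L hd hdL => ?_, fun r q n b L hr hq hrq hb hL => ?_⟩
  · by_cases hn : n.Coprime d
    · obtain ⟨a, ha, had⟩ := exists_mul_modEq_one hd hn
      have e : {k ∈ Ioc 0 L | n * k ≡ 1 [MOD d]} = {k ∈ Ioc 0 L | k ≡ a [MOD d]} :=
        filter_congr fun k _ => ⟨fun h => Nat.ModEq.cancel_left_of_coprime
          (by rwa [Nat.gcd_comm]) (h.trans ha.symm), fun h => (h.mul_left n).trans ha⟩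
      rw [e]
      exact (h d a L hd had hdL).trans (hle d L hd)
    · rw [filter_false_of_mem fun k _ h => hn (coprime_of_mul_modEq_one h), sum_empty]
      exact hpos d L hd
  · have hrq0 := Nat.mul_pos hr hq
    by_cases hn : n.Coprime r
    · obtain ⟨a, ha, har⟩ := exists_mul_modEq_one hr hn
      obtain ⟨u, hu⟩ := Nat.chineseRemainder hrq a b
      have hur : u.Coprime (r * q) := by
        refine Nat.Coprime.mul_right ?_ ?_
        · rw [Nat.Coprime, hu.1.gcd_eq]; exact har
        · rw [Nat.Coprime, hu.2.gcd_eq]; exact hb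
      have e : {k ∈ Ioc 0 L | n * k ≡ 1 [MOD r] ∧ k ≡ b [MOD q]} =
          {k ∈ Ioc 0 L | k ≡ u [MOD (r * q)]} := by
        refine filter_congr fun k _ => ?_
        rw [← Nat.modEq_and_modEq_iff_modEq_mul hrq]
        refine and_congr ⟨fun h => ?_, fun h => ?_⟩
          ⟨fun h => h.trans hu.2.symm, fun h => h.trans hu.2⟩
        · exact (Nat.ModEq.cancel_left_of_coprime
            (by rwa [Nat.gcd_comm]) (h.trans ha.symm)).trans hu.1.symm
        · exact ((h.trans hu.1).mul_left n).trans ha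
      rw [e]
      have := (h (r * q) u L hrq0 hur hL).trans (hle (r * q) L hrq0)
      push_cast at this
      exact this
    · rw [filter_false_of_mem fun k _ h => hn (coprime_of_mul_modEq_one h.1), sum_empty]
      have := hpos (r * q) L hrq0
      push_cast at this
      exact this

theorem two_mul_abs_le_of_sq_le {x V W s : ℝ} (hs : 0 < s) (hV : 0 ≤ V) (hW : 0 ≤ W)
    (h : x ^ 2 ≤ V * W) : 2 * |x| ≤ s * V + W / s := by
  have h1 : (2 * x) ^ 2 ≤ (s * V + W / s) ^ 2 := by
    have : (s * V + W / s) ^ 2 = (s * V - W / s) ^ 2 + 4 * (V * W) := by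
      field_simp
      ring
    rw [this]
    nlinarith [sq_nonneg (s * V - W / s)]
  have h2 := abs_le_of_sq_le_sq h1 (by positivity)
  have := abs_mul 2 x
  rw [abs_two] at this
  rw [← this]
  exact h2

theorem abs_oneResidueDeviation_le {q : ℕ} (hq : q.Prime) (n : ℕ) :
    |oneResidueDeviation q n| ≤ (if n % q = 1 then 1 else 0) + 2 / (q : ℝ) := by
  have hq2 : (2 : ℝ) ≤ q := by exact_mod_cast hq.two_le
  have h1 : 1 / ((q : ℝ) - 1) ≤ 2 / q := by
    rw [div_le_div_iff₀ (by linarith) (by linarith)]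
    linarith
  have h2 : 0 ≤ 1 / ((q : ℝ) - 1) := div_nonneg zero_le_one (by linarith)
  unfold oneResidueDeviation
  refine (abs_sub _ _).trans (add_le_add ?_ ?_)
  · split_ifs <;> simp
  · split_ifs
    · rw [abs_zero]
      positivity
    · rwa [abs_of_nonneg h2]

theorem sum_inv_le_of_subset (Q : Finset ℕ) {N : ℕ} (hQ : Q ⊆ Ioc 0 N) :
    ∑ q ∈ Q, (1 : ℝ) / q ≤ 1 + Real.log N := by
  have h1 : ∑ q ∈ Q, (1 : ℝ) / q ≤ ∑ q ∈ Ioc 0 N, (1 : ℝ) / q :=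
    sum_le_sum_of_subset_of_nonneg hQ fun _ _ _ => by positivity
  refine h1.trans ?_
  have h2 := harmonic_le_one_add_log N
  rw [harmonic_eq_sum_Icc] at h2
  push_cast at h2
  refine le_trans (le_of_eq ?_) h2
  refine sum_congr ?_ fun _ _ => one_div _
  ext; simp [Nat.succ_le_iff]

theorem sum_inv_sq_le_of_lt (Q : Finset ℕ) {y N : ℕ} (hy : 0 < y) (hQ : Q ⊆ Ioc y N) :
    ∑ q ∈ Q, (1 : ℝ) / (q : ℝ) ^ 2 ≤ 1 / y := by
  rcases Q.eq_empty_or_nonempty with rfl | ⟨q, hq⟩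
  · simp
  have hyN : y ≤ N := by
    have := mem_Ioc.1 (hQ hq)
    omega
  have h1 : ∑ q ∈ Q, (1 : ℝ) / (q : ℝ) ^ 2 ≤ ∑ q ∈ Ioc y N, (1 : ℝ) / (q : ℝ) ^ 2 :=
    sum_le_sum_of_subset_of_nonneg hQ fun _ _ _ => by positivity
  have h2 := sum_Ioc_inv_sq_le_sub (α := ℝ) hy.ne' hyN
  simp_rw [one_div] at h1 ⊢
  have : (0 : ℝ) ≤ (N : ℝ)⁻¹ := by positivity
  linarith

theorem log_mul_le_of_le_sq {y r q : ℕ} (hr : 0 < r) (hq : 0 < q) (hry : r ≤ y ^ 2)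
    (hqy : q ≤ y ^ 2) : Real.log (r * q) + 1 ≤ 4 * (1 + Real.log y) := by
  have h1 : (0 : ℝ) < (r : ℝ) * q := by positivity
  have h2 : (r : ℝ) * q ≤ (y : ℝ) ^ 4 := by
    have : r * q ≤ y ^ 4 := by
      calc r * q ≤ y ^ 2 * y ^ 2 := Nat.mul_le_mul hry hqy
        _ = y ^ 4 := by ring
    exact_mod_cast this
  have h3 := Real.log_le_log h1 h2
  rw [Real.log_pow] at h3
  push_cast at h3
  linarith

theorem abs_block_sub_le : ∃ C : ℝ, 1 ≤ C ∧ ∀ (y r q t M H : ℕ) (c : ℕ → ℝ), 0 < r →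
    r ≤ y ^ 2 → q.Prime → q ≤ y ^ 2 → r.Coprime q → 0 < M → M * y ^ 4 ≤ t →
    |∑ m ∈ Ioc M (M + H), c m * ∑ k ∈ Ioc 0 (t / m), Λ k * smoothedDeviation r q t (m * k) -
      ∑ m ∈ Ioc M (M + H), c m * ∑ k ∈ Ioc 0 (t / M) with m * k ≡ 1 [MOD r],
        Λ k * ((t : ℝ) - M * k) * oneResidueDeviation q (m * k)| ≤
    C * H * ((t : ℝ) / M) ^ 2 * (1 + Real.log y) / (r * q) * ∑ m ∈ Ioc M (M + H), |c m| := by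
  obtain ⟨C, hC1, hC, hC'⟩ := sum_vonMangoldt_mul_modEq_le
  refine ⟨12 * C, by linarith, fun y r q t M H c hr hry hq hqy hrq hM hMt => ?_⟩
  rw [← sum_sub_distrib, mul_sum]
  refine (abs_sum_le_sum_abs _ _).trans (sum_le_sum fun m hm => ?_)
  rw [← mul_sub, abs_mul, mul_comm]
  refine mul_le_mul_of_nonneg_right ?_ (abs_nonneg _)
  have hm' := mem_Ioc.1 hm
  have hM' : (0 : ℝ) < M := by exact_mod_cast hM
  have hq0 : (0 : ℝ) < q := by exact_mod_cast hq.pos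
  have hr0 : (0 : ℝ) < r := by exact_mod_cast hr
  set X := t / M with hX
  have hXr : (X : ℝ) ≤ t / M := Nat.cast_div_le
  have hrqX : r * q ≤ X := by
    rw [hX, Nat.le_div_iff_mul_le hM, mul_comm]
    refine le_trans (Nat.mul_le_mul_left M ?_) hMt
    calc r * q ≤ y ^ 2 * y ^ 2 := Nat.mul_le_mul hry hqy
      _ = y ^ 4 := by ring
  have e : ∑ k ∈ Ioc 0 (t / m), Λ k * smoothedDeviation r q t (m * k) =
      ∑ k ∈ Ioc 0 X with m * k ≡ 1 [MOD r],
        Λ k * (((t - m * k : ℕ) : ℝ) * oneResidueDeviation q (m * k)) := by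
    rw [sum_filter]
    refine (sum_subset (Ioc_subset_Ioc_right (Nat.div_le_div_left hm'.1.le hM))
        fun k hk hk2 => ?_).trans (sum_congr rfl fun k _ => ?_)
    · simp only [mem_Ioc, not_and, not_le] at hk hk2
      have := (Nat.div_lt_iff_lt_mul (by omega)).1 (hk2 hk.1)
      rw [smoothedDeviation_eq_zero (by rw [mul_comm]; exact this.le)]
      ring
    · unfold smoothedDeviation
      split_ifs <;> simp
  rw [e, ← sum_sub_distrib]
  have hstep : |∑ k ∈ Ioc 0 X with m * k ≡ 1 [MOD r],
      (Λ k * (((t - m * k : ℕ) : ℝ) * oneResidueDeviation q (m * k)) -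
        Λ k * ((t : ℝ) - M * k) * oneResidueDeviation q (m * k))| ≤
      ∑ k ∈ Ioc 0 X with m * k ≡ 1 [MOD r],
        H * X * (Λ k * ((if m * k % q = 1 then 1 else 0) + 2 / (q : ℝ))) := by
    refine (abs_sum_le_sum_abs _ _).trans (sum_le_sum fun k hk => ?_)
    have hk' := mem_Ioc.1 (mem_filter.1 hk).1
    have hMk : M * k ≤ t := by
      rw [mul_comm]
      exact (Nat.le_div_iff_mul_le hM).1 hk'.2
    have hd : |((t - m * k : ℕ) : ℝ) - ((t : ℝ) - M * k)| ≤ H * X := by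
      have h1 : (t - m * k : ℕ) ≤ t - M * k :=
        Nat.sub_le_sub_left (Nat.mul_le_mul_right k hm'.1.le) t
      have h2 : t - M * k ≤ (t - m * k : ℕ) + H * X := by
        have h3 : m * k ≤ M * k + H * X := by
          calc m * k ≤ (M + H) * k := Nat.mul_le_mul_right k hm'.2
            _ = M * k + H * k := by ring
            _ ≤ _ := Nat.add_le_add_left (Nat.mul_le_mul_left H hk'.2) _
        omega
      have h4 : ((t - M * k : ℕ) : ℝ) = (t : ℝ) - M * k := by
        rw [Nat.cast_sub hMk]
        push_cast
        ring
      rw [← h4]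
      have h1' : ((t - m * k : ℕ) : ℝ) ≤ ((t - M * k : ℕ) : ℝ) := Nat.cast_le.2 h1
      have h2' : ((t - M * k : ℕ) : ℝ) ≤ ((t - m * k : ℕ) : ℝ) + H * X := by exact_mod_cast h2
      rw [abs_le]
      constructor
      · linarith
      · have : (0 : ℝ) ≤ H * X := by positivity
        linarith
    have e2 : Λ k * (((t - m * k : ℕ) : ℝ) * oneResidueDeviation q (m * k)) -
        Λ k * ((t : ℝ) - M * k) * oneResidueDeviation q (m * k) =
        (((t - m * k : ℕ) : ℝ) - ((t : ℝ) - M * k)) *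
          (Λ k * oneResidueDeviation q (m * k)) := by ring
    rw [e2, abs_mul, abs_mul, abs_of_nonneg ArithmeticFunction.vonMangoldt_nonneg]
    have hΛ : 0 ≤ Λ k := ArithmeticFunction.vonMangoldt_nonneg
    have h3 := abs_oneResidueDeviation_le hq (m * k)
    gcongr
  refine hstep.trans ?_
  rw [← mul_sum]
  have hℓ := log_mul_le_of_le_sq hr hq.pos hry hqy
  have hs1 : ∑ k ∈ Ioc 0 X with m * k ≡ 1 [MOD r], Λ k * (if m * k % q = 1 then 1 else 0) ≤
      C * (X / (r * q)) * (4 * (1 + Real.log y)) := by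
    have e3 : ∑ k ∈ Ioc 0 X with m * k ≡ 1 [MOD r], Λ k * (if m * k % q = 1 then 1 else 0) =
        ∑ k ∈ Ioc 0 X with m * k ≡ 1 [MOD (r * q)], Λ k := by
      simp_rw [mul_ite, mul_one, mul_zero]
      rw [← sum_filter, filter_filter]
      refine sum_congr (filter_congr fun k _ => ?_) fun _ _ => rfl
      rw [← Nat.modEq_and_modEq_iff_modEq_mul hrq]
      refine and_congr_right fun _ => ?_
      rw [Nat.ModEq, Nat.mod_eq_of_lt hq.one_lt]
    rw [e3]
    have := hC (r * q) m X (Nat.mul_pos hr hq.pos) hrqX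
    push_cast at this
    refine this.trans ?_
    gcongr
  have hs2 : ∑ k ∈ Ioc 0 X with m * k ≡ 1 [MOD r], Λ k * (2 / (q : ℝ)) ≤
      2 * (C * (X / (r * q)) * (4 * (1 + Real.log y))) := by
    rw [← sum_mul]
    have h1 := hC r m X hr ((Nat.le_mul_of_pos_right r hq.pos).trans hrqX)
    have h2 : Real.log r ≤ Real.log (r * q) := by
      refine Real.log_le_log hr0 (le_mul_of_one_le_right hr0.le ?_)
      exact_mod_cast hq.pos
    have h3 : Real.log r + 1 ≤ 4 * (1 + Real.log y) := by linarith
    calc _ ≤ (C * (X / r) * (Real.log r + 1)) * (2 / (q : ℝ)) := by gcongr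
      _ ≤ (C * (X / r) * (4 * (1 + Real.log y))) * (2 / (q : ℝ)) := by gcongr
      _ = _ := by field_simp
  have hℓ0 : 0 ≤ 1 + Real.log y := by
    have := Real.log_natCast_nonneg y
    linarith
  simp_rw [mul_add, sum_add_distrib]
  rw [← mul_add]
  calc _ ≤ (H : ℝ) * X * (C * (X / (r * q)) * (4 * (1 + Real.log y)) +
        2 * (C * (X / (r * q)) * (4 * (1 + Real.log y)))) := by
        gcongr
    _ = 12 * C * H * (X : ℝ) ^ 2 * (1 + Real.log y) / (r * q) := by ring
    _ ≤ _ := by gcongr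

theorem sum_sum_modEq_one_eq {r : ℕ} (hr : 0 < r) (A T : Finset ℕ) (c : ℕ → ℝ)
    (F : ℕ → ℕ → ℝ) :
    ∑ m ∈ A, c m * ∑ k ∈ T with m * k ≡ 1 [MOD r], F m k =
      ∑ a ∈ range r, ∑ m ∈ A with m ≡ a [MOD r], ∑ k ∈ T with a * k ≡ 1 [MOD r],
        c m * F m k := by
  rw [← sum_fiberwise_of_maps_to (s := A) (t := range r) (g := fun m => m % r)
    (fun m _ => mem_range.2 (Nat.mod_lt _ hr))]
  refine sum_congr rfl fun a ha => ?_
  have har := mem_range.1 ha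
  refine sum_congr (filter_congr fun m _ => ?_) fun m hm => ?_
  · rw [Nat.ModEq, Nat.mod_eq_of_lt har]
  · have hm2 : m ≡ a [MOD r] := (mem_filter.1 hm).2
    rw [mul_sum]
    refine sum_congr (filter_congr fun k _ => ?_) fun k _ => rfl
    exact ⟨fun h => ((hm2.mul_right k).symm.trans h), fun h => (hm2.mul_right k).trans h⟩

theorem sum_abs_block_main_le : ∃ C : ℝ, 1 ≤ C ∧ ∀ (y r t M : ℕ) (Q : Finset ℕ) (c : ℕ → ℝ),
    0 < y → 0 < r → r ≤ y ^ 2 → (∀ q ∈ Q, q.Prime) → (∀ q ∈ Q, r.Coprime q) →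
    Q ⊆ Ioc y (y ^ 2) → 0 < M → M * y ^ 4 ≤ t →
    ∑ q ∈ Q, |∑ m ∈ Ioc M (M + y ^ 9), c m *
        ∑ k ∈ Ioc 0 (t / M) with m * k ≡ 1 [MOD r],
          Λ k * ((t : ℝ) - M * k) * oneResidueDeviation q (m * k)| ≤
    C * t * ((t : ℝ) / M) * (1 + Real.log y) / (r * √y) *
      (∑ m ∈ Ioc M (M + y ^ 9), c m ^ 2 + (y : ℝ) ^ 9) := by
  obtain ⟨C, hC1, -, hC⟩ := sum_vonMangoldt_mul_modEq_le
  refine ⟨8 * C, by linarith, fun y r t M Q c hy hr hry hQ hQr hQy hM hMt => ?_⟩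
  have hy0 : (0 : ℝ) < y := by exact_mod_cast hy
  have hy1 : (1 : ℝ) ≤ y := by exact_mod_cast hy
  have hr0 : (0 : ℝ) < r := by exact_mod_cast hr
  have hM0 : (0 : ℝ) < M := by exact_mod_cast hM
  have ht : 0 < t := lt_of_lt_of_le (by positivity) hMt
  have ht0 : (0 : ℝ) < t := by exact_mod_cast ht
  have hl : 0 < 1 + Real.log y := by
    have := Real.log_nonneg hy1
    linarith
  have hs0 : 0 < √(y : ℝ) := Real.sqrt_pos.2 hy0
  have hss : √(y : ℝ) * √y = y := Real.mul_self_sqrt hy0.le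
  set X := t / M with hX
  set β : ℕ → ℝ := fun k => Λ k * ((t : ℝ) - M * k) with hβ
  set S : ℕ → Finset ℕ := fun a => {m ∈ Ioc M (M + y ^ 9) | m ≡ a [MOD r]} with hS
  set T : ℕ → Finset ℕ := fun a => {k ∈ Ioc 0 X | a * k ≡ 1 [MOD r]} with hT
  set B : ℝ := 4 * C * t * ((t : ℝ) / M) * (1 + Real.log y) / r with hB
  have hB0 : 0 < B := by positivity
  set V : ℕ → ℕ → ℝ := fun a q =>
    ∑ b ∈ range q, (∑ m ∈ S a with m % q = b, c m - (∑ m ∈ S a, c m) / q) ^ 2 with hV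
  set W : ℕ → ℕ → ℝ := fun a q =>
    ∑ b ∈ (range q).erase 0, (∑ k ∈ T a with k % q = b, β k) ^ 2 with hW
  set x : ℕ → ℕ → ℝ := fun a q =>
    ∑ m ∈ S a, ∑ k ∈ T a, c m * β k * oneResidueDeviation q (m * k) with hx
  have hx2 : ∀ a, ∀ q ∈ Q, x a q ^ 2 ≤ V a q * W a q := fun a q hq =>
    sq_bilinear_oneResidueDeviation_le (hQ q hq) (S a) (T a) c β
  have hV0 : ∀ a q, 0 ≤ V a q := fun a q => sum_nonneg fun _ _ => sq_nonneg _
  have hW0 : ∀ a q, 0 ≤ W a q := fun a q => sum_nonneg fun _ _ => sq_nonneg _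
  have hWle : ∀ a, ∀ q ∈ Q, W a q ≤ B ^ 2 / q := by
    intro a q hq
    have hqp := hQ q hq
    have hq0 : (0 : ℝ) < q := by exact_mod_cast hqp.pos
    have hqy := mem_Ioc.1 (hQy hq)
    have hrqX : r * q ≤ X := by
      rw [hX, Nat.le_div_iff_mul_le hM, mul_comm]
      refine le_trans (Nat.mul_le_mul_left M ?_) hMt
      calc r * q ≤ y ^ 2 * y ^ 2 := Nat.mul_le_mul hry hqy.2
        _ = y ^ 4 := by ring
    have hlog := log_mul_le_of_le_sq hr hqp.pos hry hqy.2
    have hterm : ∀ b ∈ (range q).erase 0, (∑ k ∈ T a with k % q = b, β k) ^ 2 ≤ (B / q) ^ 2 := by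
      intro b hb
      obtain ⟨hb0, hbq⟩ := mem_erase.1 hb
      have hbq := mem_range.1 hbq
      have hcop : b.Coprime q :=
        (Nat.coprime_of_lt_prime hb0 hbq hqp).symm
      have hk : ∀ k ∈ T a, 0 ≤ (t : ℝ) - M * k ∧ (t : ℝ) - M * k ≤ t := by
        intro k hk
        have hk' := mem_Ioc.1 (mem_filter.1 hk).1
        have : M * k ≤ t := by
          rw [mul_comm]
          exact (Nat.le_div_iff_mul_le hM).1 hk'.2
        have h2 : (M : ℝ) * k ≤ t := by exact_mod_cast this
        have h3 : 0 ≤ (M : ℝ) * k := by positivity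
        constructor <;> linarith
      have hnn : 0 ≤ ∑ k ∈ T a with k % q = b, β k := sum_nonneg fun k hk' =>
        mul_nonneg ArithmeticFunction.vonMangoldt_nonneg (hk k (mem_filter.1 hk').1).1
      refine pow_le_pow_left₀ hnn ?_ 2
      calc ∑ k ∈ T a with k % q = b, β k ≤ ∑ k ∈ T a with k % q = b, Λ k * t :=
            sum_le_sum fun k hk' => mul_le_mul_of_nonneg_left (hk k (mem_filter.1 hk').1).2
              ArithmeticFunction.vonMangoldt_nonneg
        _ = (∑ k ∈ Ioc 0 X with a * k ≡ 1 [MOD r] ∧ k ≡ b [MOD q], Λ k) * t := by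
            rw [← sum_mul]
            congr 1
            refine sum_congr ?_ fun _ _ => rfl
            simp only [hT, filter_filter]
            refine filter_congr fun k _ => and_congr_right fun _ => ?_
            rw [Nat.ModEq, Nat.mod_eq_of_lt hbq]
        _ ≤ (C * ((t / M : ℝ) / (r * q)) * (4 * (1 + Real.log y))) * t := by
            refine mul_le_mul_of_nonneg_right ?_ ht0.le
            refine (hC r q a b X hr hqp.pos (hQr q hq) hcop hrqX).trans ?_
            have hXr : (X : ℝ) ≤ t / M := Nat.cast_div_le
            have hlog0 : 0 ≤ Real.log (r * q) + 1 := by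
              have h := Real.log_natCast_nonneg (r * q)
              push_cast at h
              linarith
            gcongr
        _ = B / q := by rw [hB]; field_simp
    calc W a q ≤ ∑ b ∈ (range q).erase 0, (B / q) ^ 2 := sum_le_sum hterm
      _ = (#((range q).erase 0) : ℝ) * (B / q) ^ 2 := by rw [sum_const, nsmul_eq_mul]
      _ ≤ q * (B / q) ^ 2 := by
          refine mul_le_mul_of_nonneg_right ?_ (sq_nonneg _)
          exact_mod_cast (card_le_card (erase_subset _ _)).trans (card_range q).le
      _ = B ^ 2 / q := by field_simp
  set s : ℝ := r * B / (√y * (y : ℝ) ^ 9) with hs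
  have hs' : 0 < s := by positivity
  have h1 : ∀ a, ∀ q ∈ Q, 2 * |x a q| ≤ s * (q * V a q) + B ^ 2 / s * (1 / (q : ℝ) ^ 2) := by
    intro a q hq
    have hq0 : (0 : ℝ) < q := by exact_mod_cast (hQ q hq).pos
    refine (two_mul_abs_le_of_sq_le (s := s * q) (by positivity) (hV0 a q)
      (by positivity) ((hx2 a q hq).trans
        (mul_le_mul_of_nonneg_left (hWle a q hq) (hV0 a q)))).trans (le_of_eq ?_)
    field_simp
  have h2 : ∀ a, ∑ q ∈ Q, 2 * |x a q| ≤
      s * (((y : ℝ) ^ 9 / r + 2 * (y : ℝ) ^ 6) * ∑ m ∈ S a, c m ^ 2) + B ^ 2 / s * (1 / y) := by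
    intro a
    refine (sum_le_sum (h1 a)).trans ?_
    rw [sum_add_distrib, ← mul_sum, ← mul_sum]
    have h3 := sum_sq_residue_deviation_le M (y ^ 9) a (y ^ 2) hr Q hQ hQr
      (fun q hq => (mem_Ioc.1 (hQy hq)).2) c (S a) rfl
    have h4 := sum_inv_sq_le_of_lt Q hy hQy
    refine add_le_add (mul_le_mul_of_nonneg_left (h3.trans (le_of_eq ?_)) hs'.le)
      (mul_le_mul_of_nonneg_left h4 (by positivity))
    push_cast
    ring
  have h3 : ∑ a ∈ range r, ∑ m ∈ S a, c m ^ 2 = ∑ m ∈ Ioc M (M + y ^ 9), c m ^ 2 := by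
    rw [← sum_fiberwise_of_maps_to (s := Ioc M (M + y ^ 9)) (t := range r)
      (g := fun m => m % r) (fun m _ => mem_range.2 (Nat.mod_lt _ hr))]
    refine sum_congr rfl fun a ha => sum_congr (filter_congr fun m _ => ?_) fun _ _ => rfl
    rw [Nat.ModEq, Nat.mod_eq_of_lt (mem_range.1 ha)]
  have h4 : ∀ q ∈ Q, |∑ m ∈ Ioc M (M + y ^ 9), c m *
        ∑ k ∈ Ioc 0 X with m * k ≡ 1 [MOD r],
          Λ k * ((t : ℝ) - M * k) * oneResidueDeviation q (m * k)| ≤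
      ∑ a ∈ range r, |x a q| := by
    intro q hq
    rw [sum_sum_modEq_one_eq hr]
    refine (abs_sum_le_sum_abs _ _).trans (le_of_eq (sum_congr rfl fun a _ => ?_))
    congr 1
    refine sum_congr rfl fun m _ => sum_congr rfl fun k _ => ?_
    simp only [hβ]
    ring
  set N := ∑ m ∈ Ioc M (M + y ^ 9), c m ^ 2 with hN
  have hN0 : 0 ≤ N := sum_nonneg fun _ _ => sq_nonneg _
  have h5 : 2 * ∑ q ∈ Q, ∑ a ∈ range r, |x a q| ≤
      s * ((y : ℝ) ^ 9 / r + 2 * (y : ℝ) ^ 6) * N + r * (B ^ 2 / s * (1 / y)) := by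
    rw [sum_comm, mul_sum]
    calc ∑ a ∈ range r, 2 * ∑ q ∈ Q, |x a q| ≤ ∑ a ∈ range r,
          (s * (((y : ℝ) ^ 9 / r + 2 * (y : ℝ) ^ 6) * ∑ m ∈ S a, c m ^ 2) +
            B ^ 2 / s * (1 / y)) := sum_le_sum fun a _ => by rw [mul_sum]; exact h2 a
      _ = _ := by
        rw [sum_add_distrib, ← mul_sum, ← mul_sum, h3, sum_const, card_range, nsmul_eq_mul]
        ring
  have h6 : (r : ℝ) * (B ^ 2 / s * (1 / y)) = B * (y : ℝ) ^ 9 / √y := by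
    rw [hs]
    field_simp
    nlinarith [hss]
  have h7 : s * ((y : ℝ) ^ 9 / r + 2 * (y : ℝ) ^ 6) ≤ 3 * B / √y := by
    have h8 : (r : ℝ) * y ^ 6 ≤ y ^ 9 := by
      have : r * y ^ 6 ≤ y ^ 9 := by
        calc r * y ^ 6 ≤ y ^ 2 * y ^ 6 := Nat.mul_le_mul_right _ hry
          _ = y ^ 8 * 1 := by ring
          _ ≤ y ^ 8 * y := Nat.mul_le_mul_left _ hy
          _ = y ^ 9 := by ring
      exact_mod_cast this
    have h9 : s * ((y : ℝ) ^ 9 / r + 2 * (y : ℝ) ^ 6) =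
        B / √y * (1 + 2 * ((r * (y : ℝ) ^ 6) / (y : ℝ) ^ 9)) := by
      rw [hs]
      field_simp
    have h10 : (r * (y : ℝ) ^ 6) / (y : ℝ) ^ 9 ≤ 1 := (div_le_one (by positivity)).2 h8
    rw [h9]
    calc B / √y * (1 + 2 * ((r * (y : ℝ) ^ 6) / (y : ℝ) ^ 9)) ≤ B / √y * (1 + 2 * 1) := by
          gcongr
      _ = _ := by ring
  have h8 : s * ((y : ℝ) ^ 9 / r + 2 * (y : ℝ) ^ 6) * N ≤ 3 * B / √y * N :=
    mul_le_mul_of_nonneg_right h7 hN0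
  have h9 : 8 * C * t * ((t : ℝ) / M) * (1 + Real.log y) / (r * √y) * (N + (y : ℝ) ^ 9) =
      2 * (B / √y) * (N + (y : ℝ) ^ 9) := by
    rw [hB]
    field_simp
    ring
  rw [h9]
  refine (sum_le_sum h4).trans ?_
  have h10 : 0 ≤ B / √y * N := by positivity
  have h11 : 0 ≤ B / √y * (y : ℝ) ^ 9 := by positivity
  rw [h6] at h5
  have e1 : 3 * B / √y * N = 3 * (B / √y * N) := by ring
  have e2 : B * (y : ℝ) ^ 9 / √y = B / √y * (y : ℝ) ^ 9 := by ring
  rw [e1] at h8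
  rw [e2] at h5
  linarith

theorem sum_abs_block_le : ∃ C : ℝ, 1 ≤ C ∧ ∀ (y r t M : ℕ) (Q : Finset ℕ) (c : ℕ → ℝ),
    0 < y → 0 < r → r ≤ y ^ 2 → (∀ q ∈ Q, q.Prime) → (∀ q ∈ Q, r.Coprime q) →
    Q ⊆ Ioc y (y ^ 2) → y ^ 10 ≤ M → M * y ^ 4 ≤ t →
    ∑ q ∈ Q, |∑ m ∈ Ioc M (M + y ^ 9), c m *
        ∑ k ∈ Ioc 0 (t / m), Λ k * smoothedDeviation r q t (m * k)| ≤
    C * ((t : ℝ) ^ 2 * (1 + Real.log y) ^ 2 / (r * √y)) *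
      ((∑ m ∈ Ioc M (M + y ^ 9), c m ^ 2 + (y : ℝ) ^ 9) / M) := by
  obtain ⟨C₁, hC₁, h₁⟩ := abs_block_sub_le
  obtain ⟨C₂, hC₂, h₂⟩ := sum_abs_block_main_le
  refine ⟨2 * C₁ + C₂, by linarith, fun y r t M Q c hy hr hry hQ hQr hQy hM hMt => ?_⟩
  have hy0 : (0 : ℝ) < y := by exact_mod_cast hy
  have hy1 : (1 : ℝ) ≤ y := by exact_mod_cast hy
  have hr0 : (0 : ℝ) < r := by exact_mod_cast hr
  have hM' : 0 < M := lt_of_lt_of_le (by positivity) hM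
  have hM0 : (0 : ℝ) < M := by exact_mod_cast hM'
  have hlog := Real.log_nonneg hy1
  have hs0 : 0 < √(y : ℝ) := Real.sqrt_pos.2 hy0
  have hss : √(y : ℝ) * √y = y := Real.mul_self_sqrt hy0.le
  have hsy : √(y : ℝ) ≤ y := by
    rw [Real.sqrt_le_left hy0.le]
    nlinarith
  set A : ℕ → ℝ := fun q => ∑ m ∈ Ioc M (M + y ^ 9), c m *
        ∑ k ∈ Ioc 0 (t / m), Λ k * smoothedDeviation r q t (m * k) with hA
  set A' : ℕ → ℝ := fun q => ∑ m ∈ Ioc M (M + y ^ 9), c m *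
        ∑ k ∈ Ioc 0 (t / M) with m * k ≡ 1 [MOD r],
          Λ k * ((t : ℝ) - M * k) * oneResidueDeviation q (m * k) with hA'
  set N := ∑ m ∈ Ioc M (M + y ^ 9), c m ^ 2 + (y : ℝ) ^ 9 with hN
  have hN0 : 0 ≤ N := add_nonneg (sum_nonneg fun _ _ => sq_nonneg _) (by positivity)
  have hN1 : ∑ m ∈ Ioc M (M + y ^ 9), |c m| ≤ N := by
    have : ∀ m, |c m| ≤ c m ^ 2 + 1 := fun m => by
      rw [← sq_abs]
      nlinarith [sq_nonneg (|c m| - 1), abs_nonneg (c m)]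
    refine (sum_le_sum fun m _ => this m).trans (le_of_eq ?_)
    rw [sum_add_distrib, hN]
    simp
  have e1 : ∀ q ∈ Q, |A q| ≤ C₁ * ((t : ℝ) ^ 2 * (1 + Real.log y) / (r * √y)) * (N / M) *
      (1 / q) + |A' q| := by
    intro q hq
    have hqp := hQ q hq
    have hq0 : (0 : ℝ) < q := by exact_mod_cast hqp.pos
    have h3 := h₁ y r q t M (y ^ 9) c hr hry hqp (mem_Ioc.1 (hQy hq)).2 (hQr q hq) hM' hMt
    have h4 : |A q| ≤ |A q - A' q| + |A' q| := by
      have := abs_add_le (A q - A' q) (A' q)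
      rwa [sub_add_cancel] at this
    refine h4.trans (add_le_add (h3.trans ?_) le_rfl)
    have h5 : ((y ^ 9 : ℕ) : ℝ) * √y ≤ M := by
      have h6 : (y : ℝ) ^ 10 ≤ M := by exact_mod_cast hM
      push_cast
      calc (y : ℝ) ^ 9 * √y ≤ (y : ℝ) ^ 9 * y := by gcongr
        _ = (y : ℝ) ^ 10 := by ring
        _ ≤ M := h6
    have h6 : ((y ^ 9 : ℕ) : ℝ) / M ≤ 1 / √y := by
      rw [div_le_div_iff₀ hM0 hs0]
      linarith
    calc C₁ * ((y ^ 9 : ℕ) : ℝ) * ((t : ℝ) / M) ^ 2 * (1 + Real.log y) / (r * q) *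
          ∑ m ∈ Ioc M (M + y ^ 9), |c m| ≤
        C₁ * ((y ^ 9 : ℕ) : ℝ) * ((t : ℝ) / M) ^ 2 * (1 + Real.log y) / (r * q) * N := by
          gcongr
      _ = C₁ * (((y ^ 9 : ℕ) : ℝ) / M) * ((t : ℝ) ^ 2 * (1 + Real.log y) / r) * (N / M) *
          (1 / q) := by
          field_simp
      _ ≤ C₁ * (1 / √y) * ((t : ℝ) ^ 2 * (1 + Real.log y) / r) * (N / M) * (1 / q) := by
          gcongr
      _ = _ := by
          field_simp
  have e2 : ∑ q ∈ Q, (1 : ℝ) / q ≤ 2 * (1 + Real.log y) := by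
    have h3 := sum_inv_le_of_subset Q (N := y ^ 2)
      (hQy.trans (Ioc_subset_Ioc_left (Nat.zero_le _)))
    push_cast [Real.log_pow] at h3
    linarith
  have e3 := h₂ y r t M Q c hy hr hry hQ hQr hQy hM' hMt
  have e4 : C₂ * t * ((t : ℝ) / M) * (1 + Real.log y) / (r * √y) * N ≤
      C₂ * ((t : ℝ) ^ 2 * (1 + Real.log y) ^ 2 / (r * √y)) * (N / M) := by
    calc C₂ * t * ((t : ℝ) / M) * (1 + Real.log y) / (r * √y) * N =
        C₂ * ((t : ℝ) ^ 2 * (1 + Real.log y) / (r * √y)) * (N / M) := by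
          field_simp
      _ ≤ _ := by
          have : (1 + Real.log y) ≤ (1 + Real.log y) ^ 2 := by nlinarith
          gcongr
  calc ∑ q ∈ Q, |A q| ≤ ∑ q ∈ Q, (C₁ * ((t : ℝ) ^ 2 * (1 + Real.log y) / (r * √y)) * (N / M) *
      (1 / q) + |A' q|) := sum_le_sum e1
    _ = C₁ * ((t : ℝ) ^ 2 * (1 + Real.log y) / (r * √y)) * (N / M) * ∑ q ∈ Q, (1 / (q : ℝ)) +
        ∑ q ∈ Q, |A' q| := by rw [sum_add_distrib, ← mul_sum]
    _ ≤ C₁ * ((t : ℝ) ^ 2 * (1 + Real.log y) / (r * √y)) * (N / M) * (2 * (1 + Real.log y)) +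
        C₂ * ((t : ℝ) ^ 2 * (1 + Real.log y) ^ 2 / (r * √y)) * (N / M) := by
          refine add_le_add (mul_le_mul_of_nonneg_left e2 (by positivity)) (e3.trans e4)
    _ = _ := by ring

theorem card_divisors_mul_le (m n : ℕ) : #(m * n).divisors ≤ #m.divisors * #n.divisors := by
  rw [Nat.divisors_mul]
  exact card_mul_le

theorem sum_inv_Ioc_le (N : ℕ) : ∑ k ∈ Ioc 0 N, (1 : ℝ) / k ≤ 1 + Real.log N :=
  sum_inv_le_of_subset (Ioc 0 N) Subset.rfl

theorem sum_card_divisors_mul_le (N : ℕ) (G : ℕ → ℝ) (hG : ∀ n, 0 ≤ G n) (F : ℕ → ℝ)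
    (hGF : ∀ m n, G (m * n) ≤ F m * F n) :
    ∑ n ∈ Ioc 0 N, (#n.divisors : ℝ) * G n ≤ (∑ n ∈ Ioc 0 N, F n) ^ 2 := by
  have h := sum_mul_apply_mul
    ((ArithmeticFunction.zeta : ArithmeticFunction ℕ) : ArithmeticFunction ℝ)
    ((ArithmeticFunction.zeta : ArithmeticFunction ℕ) : ArithmeticFunction ℝ) G N
  have e : ∀ n ∈ Ioc 0 N, (#n.divisors : ℝ) * G n =
      (((ArithmeticFunction.zeta : ArithmeticFunction ℕ) : ArithmeticFunction ℝ) *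
      ((ArithmeticFunction.zeta : ArithmeticFunction ℕ) : ArithmeticFunction ℝ)) n * G n := by
    intro n _
    congr 1
    rw [ArithmeticFunction.coe_mul_zeta_apply, card_eq_sum_ones, Nat.cast_sum]
    refine sum_congr rfl fun d hd => ?_
    have := Nat.pos_of_mem_divisors hd
    rw [ArithmeticFunction.natCoe_apply, ArithmeticFunction.zeta_apply_ne this.ne']
  rw [sum_congr rfl e, h, sq, sum_mul_sum]
  refine sum_le_sum fun m hm => ?_
  have hm0 := (mem_Ioc.1 hm).1
  rw [ArithmeticFunction.natCoe_apply, ArithmeticFunction.zeta_apply_ne hm0.ne', Nat.cast_one,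
    one_mul]
  refine (sum_le_sum_of_subset_of_nonneg (Ioc_subset_Ioc_right (Nat.div_le_self N m))
    fun k hk _ => ?_).trans (sum_le_sum fun k hk => ?_)
  · rw [ArithmeticFunction.natCoe_apply]
    exact mul_nonneg (Nat.cast_nonneg _) (hG _)
  · have hk0 := (mem_Ioc.1 hk).1
    rw [ArithmeticFunction.natCoe_apply, ArithmeticFunction.zeta_apply_ne hk0.ne', Nat.cast_one,
      one_mul]
    exact hGF m k

theorem sum_sq_card_divisors_div_le (N : ℕ) :
    ∑ n ∈ Ioc 0 N, (#n.divisors : ℝ) ^ 2 / n ≤ (1 + Real.log N) ^ 4 := by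
  have h1 := sum_card_divisors_mul_le N (fun n => (#n.divisors : ℝ) / n)
    (fun n => by positivity) (fun n => (#n.divisors : ℝ) / n)
    (fun m n => by
      have : (#(m * n).divisors : ℝ) ≤ #m.divisors * #n.divisors := by
        exact_mod_cast card_divisors_mul_le m n
      push_cast
      rw [div_mul_div_comm]
      gcongr)
  have h2 := sum_card_divisors_mul_le N (fun n => (1 : ℝ) / n)
    (fun n => by positivity) (fun n => (1 : ℝ) / n)
    (fun m n => by
      push_cast
      rw [div_mul_div_comm, one_mul])
  have h3 : ∑ n ∈ Ioc 0 N, (#n.divisors : ℝ) / n ≤ (1 + Real.log N) ^ 2 := by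
    refine le_trans (le_of_eq (sum_congr rfl fun n _ => by rw [mul_one_div])) (h2.trans ?_)
    exact pow_le_pow_left₀ (sum_nonneg fun _ _ => by positivity) (sum_inv_Ioc_le N) 2
  calc _ = ∑ n ∈ Ioc 0 N, (#n.divisors : ℝ) * ((#n.divisors : ℝ) / n) :=
        sum_congr rfl fun n _ => by ring
    _ ≤ _ := h1
    _ ≤ ((1 + Real.log N) ^ 2) ^ 2 :=
        pow_le_pow_left₀ (sum_nonneg fun _ _ => by positivity) h3 2
    _ = _ := by ring

theorem sum_Ioc_mul_eq_sum_blocks {a b : ℕ} (hab : a ≤ b) (H : ℕ) (f : ℕ → ℝ) :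
    ∑ m ∈ Ioc (a * H) (b * H), f m = ∑ i ∈ Ico a b, ∑ m ∈ Ioc (i * H) (i * H + H), f m := by
  induction b, hab using Nat.le_induction with
  | base => simp
  | succ b hab ih =>
    rw [sum_Ico_succ_top hab, ← ih, ← sum_Ioc_consecutive f (Nat.mul_le_mul_right H hab)
      (Nat.mul_le_mul_right H (Nat.le_succ b))]
    rw [Nat.succ_mul]

theorem sum_blocks_truncatedMoebiusSum_le {y : ℕ} (hy : 0 < y) (D : ℕ) :
    ∑ i ∈ Ico y (y ^ 6), ((∑ m ∈ Ioc (i * y ^ 9) (i * y ^ 9 + y ^ 9),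
      truncatedMoebiusSum D m ^ 2 + (y : ℝ) ^ 9) / ((i * y ^ 9 : ℕ) : ℝ)) ≤
    2 * (1 + 15 * Real.log y) ^ 4 + (1 + 6 * Real.log y) := by
  have hy0 : (0 : ℝ) < y := by exact_mod_cast hy
  have hyy : y ≤ y ^ 6 := Nat.le_self_pow (by norm_num) y
  have h1 : ∀ i ∈ Ico y (y ^ 6), ((∑ m ∈ Ioc (i * y ^ 9) (i * y ^ 9 + y ^ 9),
      truncatedMoebiusSum D m ^ 2 + (y : ℝ) ^ 9) / ((i * y ^ 9 : ℕ) : ℝ)) ≤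
      2 * ∑ m ∈ Ioc (i * y ^ 9) (i * y ^ 9 + y ^ 9), (#m.divisors : ℝ) ^ 2 / m + 1 / i := by
    intro i hi
    have hi0 : 0 < i := hy.trans_le (mem_Ico.1 hi).1
    have hi0' : (0 : ℝ) < i := by exact_mod_cast hi0
    have hM : 0 < i * y ^ 9 := by positivity
    have hM' : (0 : ℝ) < ((i * y ^ 9 : ℕ) : ℝ) := by exact_mod_cast hM
    rw [add_div, sum_div, mul_sum]
    refine add_le_add (sum_le_sum fun m hm => ?_) (le_of_eq ?_)
    · have hm' := mem_Ioc.1 hm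
      have hm0 : (0 : ℝ) < m := by exact_mod_cast hM.trans hm'.1
      have h2 : m ≤ 2 * (i * y ^ 9) := by
        have : y ^ 9 ≤ i * y ^ 9 := Nat.le_mul_of_pos_left _ hi0
        omega
      have h2' : (m : ℝ) ≤ 2 * ((i * y ^ 9 : ℕ) : ℝ) := by exact_mod_cast h2
      have h3 : truncatedMoebiusSum D m ^ 2 ≤ (#m.divisors : ℝ) ^ 2 := by
        rw [← sq_abs]
        exact pow_le_pow_left₀ (abs_nonneg _) (abs_truncatedMoebiusSum_le D m) 2
      rw [← mul_div_assoc, div_le_div_iff₀ hM' hm0]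
      nlinarith [mul_le_mul h3 h2' hm0.le (by positivity)]
    · push_cast
      field_simp
  refine (sum_le_sum h1).trans ?_
  rw [sum_add_distrib, ← mul_sum, ← sum_Ioc_mul_eq_sum_blocks hyy]
  have h2 : ∑ m ∈ Ioc (y * y ^ 9) (y ^ 6 * y ^ 9), (#m.divisors : ℝ) ^ 2 / m ≤
      (1 + 15 * Real.log y) ^ 4 := by
    have h3 := sum_sq_card_divisors_div_le (y ^ 15)
    push_cast [Real.log_pow] at h3
    refine le_trans (sum_le_sum_of_subset_of_nonneg ?_ fun _ _ _ => by positivity) h3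
    refine Ioc_subset_Ioc (Nat.zero_le _) (le_of_eq (by ring))
  have h4 : ∑ i ∈ Ico y (y ^ 6), (1 : ℝ) / i ≤ 1 + 6 * Real.log y := by
    have h3 := sum_inv_le_of_subset (Ico y (y ^ 6)) (N := y ^ 6) (fun i hi => by
      have := mem_Ico.1 hi
      exact mem_Ioc.2 ⟨by omega, this.2.le⟩)
    push_cast [Real.log_pow] at h3
    exact h3
  linarith

theorem sum_abs_vonMangoldt_smoothedDeviation_le : ∃ C : ℝ, 1 ≤ C ∧
    ∀ (y r t : ℕ) (Q : Finset ℕ), 0 < y → 0 < r → r ≤ y ^ 2 → (∀ q ∈ Q, q.Prime) →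
    (∀ q ∈ Q, r.Coprime q) → Q ⊆ Ioc y (y ^ 2) → y ^ 30 ≤ t →
    ∑ q ∈ Q, |∑ n ∈ Ioc 0 t, Λ n * smoothedDeviation r q t n| ≤
    C * ((t : ℝ) ^ 2 * (1 + Real.log y) ^ 6 / (r * √y)) := by
  obtain ⟨C₀, hC₀, h₀⟩ := sum_abs_block_le
  set K : ℝ := Real.log 4 + 4 with hK
  have hK0 : 0 < K := by
    have := Real.log_nonneg (show (1 : ℝ) ≤ 4 by norm_num)
    linarith
  refine ⟨12 + 6 * K + C₀ * (3 * 15 ^ 4), by nlinarith,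
    fun y r t Q hy hr hry hQ hQr hQy ht => ?_⟩
  have hy0 : (0 : ℝ) < y := by exact_mod_cast hy
  have hy1 : (1 : ℝ) ≤ y := by exact_mod_cast hy
  have hr0 : (0 : ℝ) < r := by exact_mod_cast hr
  have hs0 : 0 < √(y : ℝ) := Real.sqrt_pos.2 hy0
  have hss : √(y : ℝ) * √y = y := Real.mul_self_sqrt hy0.le
  have hsy : √(y : ℝ) ≤ y := by
    rw [Real.sqrt_le_left hy0.le]
    nlinarith
  have hlog := Real.log_nonneg hy1
  have ht1 : 1 ≤ t := le_trans (Nat.one_le_pow _ _ hy) ht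
  have ht0 : (0 : ℝ) < t := by exact_mod_cast ht1
  set l := 1 + Real.log y with hl
  have hl1 : 1 ≤ l := by linarith
  set D := y * y ^ 9 with hD
  set U := y ^ 6 * y ^ 9 with hU
  have hD1 : 1 ≤ D := Nat.succ_le_of_lt (by positivity)
  have hU1 : 0 < U := by positivity
  have hDU : D ≤ U := Nat.mul_le_mul_right _ (Nat.le_self_pow (by norm_num) y)
  have hUt : U ≤ t := by
    refine le_trans ?_ ht
    rw [hU, ← pow_add]
    exact Nat.pow_le_pow_right hy (by norm_num)
  set f : ℕ → ℕ → ℝ := fun q m => truncatedMoebiusSum D m * ∑ k ∈ Ioc 0 (t / m),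
        Λ k * smoothedDeviation r q t (m * k) with hf
  have hryR : (r : ℝ) ≤ (y : ℝ) ^ 2 := by exact_mod_cast hry
  have htR : (y : ℝ) ^ 30 ≤ t := by exact_mod_cast ht
  set G := (t : ℝ) ^ 2 * l ^ 6 / (r * √y) with hG
  have hden : (r : ℝ) * √y ≤ (y : ℝ) ^ 3 := by
    calc (r : ℝ) * √y ≤ (y : ℝ) ^ 2 * y := by gcongr
      _ = (y : ℝ) ^ 3 := by ring
  have hG1 : (t : ℝ) ^ 2 / (y : ℝ) ^ 3 ≤ G := by
    rw [hG]
    have : (1 : ℝ) ≤ l ^ 6 := one_le_pow₀ hl1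
    calc (t : ℝ) ^ 2 / (y : ℝ) ^ 3 ≤ (t : ℝ) ^ 2 / (r * √y) := by gcongr
      _ = (t : ℝ) ^ 2 * 1 / (r * √y) := by ring
      _ ≤ _ := by gcongr
  have hcard : (#Q : ℝ) ≤ (y : ℝ) ^ 2 := by
    have h := card_le_card hQy
    rw [Nat.card_Ioc] at h
    have h2 : #Q ≤ y ^ 2 := h.trans (Nat.sub_le _ _)
    exact_mod_cast h2
  have e1 : ∀ q ∈ Q, |∑ n ∈ Ioc 0 t, Λ n * smoothedDeviation r q t n| ≤
      (y : ℝ) ^ 10 * (6 * t * Real.log t) + K * (t / U) * ((y : ℝ) ^ 10 * (6 * t)) +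
      ∑ i ∈ Ico y (y ^ 6), |∑ m ∈ Ioc (i * y ^ 9) (i * y ^ 9 + y ^ 9), f q m| := by
    intro q hq
    rw [sum_vonMangoldt_smoothedDeviation_eq r q hD1 (hDU.trans hUt)]
    have h1 := abs_sum_truncatedMoebius_mul_log_le (hQ q hq) hr (hQr q hq) ht1 D
    have h2 := abs_sum_large_truncatedMoebiusSum_le (hQ q hq) hr (hQr q hq) t D hU1 hUt
    have h3 : ∑ m ∈ Ioc D t, f q m = ∑ m ∈ Ioc D U, f q m + ∑ m ∈ Ioc U t, f q m :=
      (sum_Ioc_consecutive _ hDU hUt).symm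
    have h4 : |∑ m ∈ Ioc D U, f q m| ≤
        ∑ i ∈ Ico y (y ^ 6), |∑ m ∈ Ioc (i * y ^ 9) (i * y ^ 9 + y ^ 9), f q m| := by
      rw [hD, hU, sum_Ioc_mul_eq_sum_blocks (Nat.le_self_pow (by norm_num) y)]
      exact abs_sum_le_sum_abs _ _
    have hDR : (D : ℝ) = (y : ℝ) ^ 10 := by
      rw [hD]
      push_cast
      ring
    have h5 : Chebyshev.psi ((t / U : ℕ) : ℝ) ≤ K * (t / U) := by
      refine (Chebyshev.psi_le_const_mul_self (Nat.cast_nonneg _)).trans ?_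
      exact mul_le_mul_of_nonneg_left Nat.cast_div_le hK0.le
    have h6 : |∑ m ∈ Ioc U t, f q m| ≤ K * (t / U) * ((y : ℝ) ^ 10 * (6 * t)) := by
      refine h2.trans ?_
      rw [hDR]
      exact mul_le_mul_of_nonneg_right h5 (by positivity)
    rw [hDR] at h1
    rw [h3]
    refine (abs_sub _ _).trans ?_
    have h7 := abs_add_le (∑ m ∈ Ioc D U, f q m) (∑ m ∈ Ioc U t, f q m)
    linarith
  refine (sum_le_sum e1).trans ?_
  rw [sum_add_distrib, sum_add_distrib, sum_const, sum_const, nsmul_eq_mul, nsmul_eq_mul,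
    sum_comm]
  have t1 : (#Q : ℝ) * ((y : ℝ) ^ 10 * (6 * t * Real.log t)) ≤ 12 * G := by
    have hlt : Real.log t ≤ 2 * √(t : ℝ) := by
      have h := Real.log_le_sub_one_of_pos (Real.sqrt_pos.2 ht0)
      rw [Real.log_sqrt ht0.le] at h
      linarith
    have hst : (y : ℝ) ^ 15 ≤ √(t : ℝ) := by
      refine Real.le_sqrt_of_sq_le ?_
      calc ((y : ℝ) ^ 15) ^ 2 = (y : ℝ) ^ 30 := by ring
        _ ≤ (t : ℝ) := htR
    have hstt : √(t : ℝ) * √t = t := Real.mul_self_sqrt ht0.le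
    have hlt0 : 0 ≤ Real.log t := Real.log_nonneg (by exact_mod_cast ht1)
    calc (#Q : ℝ) * ((y : ℝ) ^ 10 * (6 * t * Real.log t)) ≤
        (y : ℝ) ^ 2 * ((y : ℝ) ^ 10 * (6 * t * (2 * √(t : ℝ)))) := by gcongr
      _ = 12 * t * √t * (y : ℝ) ^ 15 / (y : ℝ) ^ 3 := by
          field_simp
          ring
      _ ≤ 12 * t * √t * √t / (y : ℝ) ^ 3 := by gcongr
      _ = 12 * ((t : ℝ) ^ 2 / (y : ℝ) ^ 3) := by
          rw [mul_assoc, hstt]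
          ring
      _ ≤ 12 * G := by gcongr
  have t2 : (#Q : ℝ) * (K * (t / U) * ((y : ℝ) ^ 10 * (6 * t))) ≤ 6 * K * G := by
    have hUR : (U : ℝ) = (y : ℝ) ^ 15 := by
      rw [hU]
      push_cast
      ring
    calc (#Q : ℝ) * (K * (t / U) * ((y : ℝ) ^ 10 * (6 * t))) ≤
        (y : ℝ) ^ 2 * (K * (t / U) * ((y : ℝ) ^ 10 * (6 * t))) := by gcongr
      _ = 6 * K * ((t : ℝ) ^ 2 / (y : ℝ) ^ 3) := by
          rw [hUR]
          field_simp
      _ ≤ _ := by gcongr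
  have t3 : ∑ i ∈ Ico y (y ^ 6), ∑ q ∈ Q,
      |∑ m ∈ Ioc (i * y ^ 9) (i * y ^ 9 + y ^ 9), f q m| ≤ C₀ * (3 * 15 ^ 4) * G := by
    have h1 : ∀ i ∈ Ico y (y ^ 6), ∑ q ∈ Q,
        |∑ m ∈ Ioc (i * y ^ 9) (i * y ^ 9 + y ^ 9), f q m| ≤
        C₀ * ((t : ℝ) ^ 2 * l ^ 2 / (r * √y)) *
        ((∑ m ∈ Ioc (i * y ^ 9) (i * y ^ 9 + y ^ 9),
          truncatedMoebiusSum D m ^ 2 + (y : ℝ) ^ 9) / ((i * y ^ 9 : ℕ) : ℝ)) := by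
      intro i hi
      obtain ⟨hi1, hi2⟩ := mem_Ico.1 hi
      refine h₀ y r t (i * y ^ 9) Q (truncatedMoebiusSum D) hy hr hry hQ hQr hQy ?_ ?_
      · calc y ^ 10 = y * y ^ 9 := by ring
          _ ≤ i * y ^ 9 := Nat.mul_le_mul_right _ hi1
      · calc i * y ^ 9 * y ^ 4 ≤ y ^ 6 * y ^ 9 * y ^ 4 := by gcongr
          _ = y ^ 19 := by ring
          _ ≤ y ^ 30 := Nat.pow_le_pow_right hy (by norm_num)
          _ ≤ t := ht
    refine (sum_le_sum h1).trans ?_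
    rw [← mul_sum]
    have h2 := sum_blocks_truncatedMoebiusSum_le hy D
    have h3 : 2 * (1 + 15 * Real.log y) ^ 4 + (1 + 6 * Real.log y) ≤ 3 * 15 ^ 4 * l ^ 4 := by
      have h4 : (1 + 15 * Real.log y) ^ 4 ≤ (15 * l) ^ 4 :=
        pow_le_pow_left₀ (by positivity) (by rw [hl]; linarith) 4
      have h5 : (1 + 6 * Real.log y) ≤ 6 * l := by rw [hl]; linarith
      have h6 : l ≤ l ^ 4 := le_self_pow₀ hl1 (by norm_num)
      rw [mul_pow] at h4
      nlinarith
    calc C₀ * ((t : ℝ) ^ 2 * l ^ 2 / (r * √y)) * _ ≤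
        C₀ * ((t : ℝ) ^ 2 * l ^ 2 / (r * √y)) * (3 * 15 ^ 4 * l ^ 4) :=
          mul_le_mul_of_nonneg_left (h2.trans h3) (by positivity)
      _ = _ := by rw [hG]; ring
  linarith

theorem sum_indicator_sub_half_sum_pairs_le (Q : Finset ℕ) (P : ℕ → Prop)
    [DecidablePred P] :
    ∑ q ∈ Q, (if P q then (1 : ℝ) else 0) -
      (∑ r ∈ Q, ∑ q ∈ Q.erase r, if P r ∧ P q then (1 : ℝ) else 0) / 2 ≤
    if ∃ q ∈ Q, P q then 1 else 0 := by
  set F := Q.filter P with hF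
  have h1 : ∑ q ∈ Q, (if P q then (1 : ℝ) else 0) = #F := by
    rw [sum_boole]
  have h2 : ∑ r ∈ Q, ∑ q ∈ Q.erase r, (if P r ∧ P q then (1 : ℝ) else 0) =
      (#F : ℝ) * (#F - 1) := by
    have h3 : ∀ r ∈ Q, ∑ q ∈ Q.erase r, (if P r ∧ P q then (1 : ℝ) else 0) =
        if P r then (#F : ℝ) - 1 else 0 := by
      intro r hr
      split_ifs with hPr
      · have hrF : r ∈ F := mem_filter.2 ⟨hr, hPr⟩
        simp only [hPr, true_and]
        rw [sum_boole, filter_erase, ← hF, card_erase_of_mem hrF,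
          Nat.cast_sub (card_pos.2 ⟨r, hrF⟩), Nat.cast_one]
      · simp [hPr]
    rw [sum_congr rfl h3, ← sum_filter, sum_const, nsmul_eq_mul]
  rw [h1, h2]
  rcases Nat.eq_zero_or_pos (#F) with h0 | h0
  · rw [h0]
    split_ifs <;> norm_num
  · obtain ⟨q, hq⟩ := card_pos.1 h0
    rw [if_pos ⟨q, (mem_filter.1 hq).1, (mem_filter.1 hq).2⟩]
    have h3 : (0 : ℝ) ≤ ((#F : ℝ) - 1) * ((#F : ℝ) - 2) := by
      rcases Nat.lt_or_ge (#F) 2 with h | h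
      · have : #F = 1 := by omega
        rw [this]
        norm_num
      · have h4 : (2 : ℝ) ≤ #F := by exact_mod_cast h
        exact mul_nonneg (by linarith) (by linarith)
    nlinarith

theorem sum_vonMangoldt_mul_sub_ge : ∃ K : ℝ, 0 ≤ K ∧ ∀ t : ℕ,
    0.46 * (t : ℝ) ^ 2 - K * t ≤ ∑ n ∈ Ioc 0 t, Λ n * ((t - n : ℕ) : ℝ) := by
  obtain ⟨K, hK, h⟩ := psi_natCast_ge
  refine ⟨K + 0.46, by linarith, fun t => ?_⟩
  induction t with
  | zero => simp
  | succ t ih =>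
    have e : ∑ n ∈ Ioc 0 (t + 1), Λ n * ((t + 1 - n : ℕ) : ℝ) =
        ∑ n ∈ Ioc 0 t, Λ n * ((t - n : ℕ) : ℝ) + Chebyshev.psi t := by
      rw [sum_Ioc_succ_top (Nat.zero_le t), Nat.sub_self, Nat.cast_zero, mul_zero, add_zero,
        psi_natCast, ← sum_add_distrib]
      refine sum_congr rfl fun n hn => ?_
      have := (mem_Ioc.1 hn).2
      rw [Nat.succ_sub this]
      push_cast
      ring
    rw [e]
    have := h t
    push_cast
    nlinarith

theorem ite_vonMangoldt_eq {q : ℕ} (hq : q.Prime) (r t n : ℕ) :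
    (if n ≡ 1 [MOD r] ∧ n ≡ 1 [MOD q] then Λ n * ((t - n : ℕ) : ℝ) else 0) =
    Λ n * smoothedDeviation r q t n + 1 / ((q : ℝ) - 1) *
      (if n ≡ 1 [MOD r] ∧ ¬ q ∣ n then Λ n * ((t - n : ℕ) : ℝ) else 0) := by
  have h1 : n ≡ 1 [MOD q] ↔ n % q = 1 := by
    rw [Nat.ModEq, Nat.mod_eq_of_lt hq.one_lt]
  unfold smoothedDeviation oneResidueDeviation
  by_cases hr : n ≡ 1 [MOD r]
  · by_cases hd : q ∣ n
    · have : ¬ n % q = 1 := by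
        rw [Nat.mod_eq_zero_of_dvd hd]
        norm_num
      simp [hr, hd, h1, this]
    · by_cases h2 : n % q = 1
      · simp [hr, hd, h1, h2]
        ring
      · simp [hr, hd, h1, h2]
        ring
  · simp [hr]

theorem sum_vonMangoldt_not_prime_le : ∃ C : ℝ, 0 ≤ C ∧ ∀ t : ℕ,
    ∑ n ∈ Ioc 0 t with ¬ n.Prime, Λ n ≤ C * √(t : ℝ) := by
  obtain ⟨C, hC⟩ := Chebyshev.psi_sub_theta_le_mul_sqrt
  refine ⟨|C|, abs_nonneg _, fun t => ?_⟩
  have h := Chebyshev.psi_sub_theta_eq_sum_not_prime t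
  rw [Nat.floor_natCast] at h
  rw [← h]
  exact (hC t).trans (mul_le_mul_of_nonneg_right (le_abs_self C) (Real.sqrt_nonneg _))

theorem sum_vonMangoldt_dvd_le : ∃ C : ℝ, 0 ≤ C ∧ ∀ q t : ℕ, q.Prime → 1 ≤ t →
    ∑ n ∈ Ioc 0 t with q ∣ n, Λ n ≤ C * √(t : ℝ) := by
  obtain ⟨C, hC0, hC⟩ := sum_vonMangoldt_not_prime_le
  refine ⟨C + 2, by linarith, fun q t hq ht => ?_⟩
  have ht0 : (0 : ℝ) < t := by exact_mod_cast ht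
  have hlt : Real.log t ≤ 2 * √(t : ℝ) := by
    have h := Real.log_le_sub_one_of_pos (Real.sqrt_pos.2 ht0)
    rw [Real.log_sqrt ht0.le] at h
    linarith
  rw [← sum_filter_add_sum_filter_not _ Nat.Prime]
  have h1 : ∑ n ∈ (Ioc 0 t).filter (q ∣ ·) with n.Prime, Λ n ≤ Real.log t := by
    have hsub : ((Ioc 0 t).filter (q ∣ ·)).filter Nat.Prime ⊆ {n ∈ ({q} : Finset ℕ) | n ≤ t} := by
      intro n hn
      simp only [mem_filter, mem_Ioc, mem_singleton] at hn ⊢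
      exact ⟨((Nat.prime_dvd_prime_iff_eq hq hn.2).1 hn.1.2).symm, hn.1.1.2⟩
    refine (sum_le_sum_of_subset_of_nonneg hsub fun _ _ _ =>
      ArithmeticFunction.vonMangoldt_nonneg).trans ?_
    rw [sum_filter, sum_singleton]
    split_ifs with h
    · rw [ArithmeticFunction.vonMangoldt_apply_prime hq]
      exact Real.log_le_log (by exact_mod_cast hq.pos) (by exact_mod_cast h)
    · exact Real.log_nonneg (by exact_mod_cast ht)
  have h2 : ∑ n ∈ (Ioc 0 t).filter (q ∣ ·) with ¬ n.Prime, Λ n ≤ C * √(t : ℝ) := by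
    refine le_trans (sum_le_sum_of_subset_of_nonneg ?_ fun _ _ _ =>
      ArithmeticFunction.vonMangoldt_nonneg) (hC t)
    exact filter_subset_filter _ (filter_subset _ _)
  linarith

theorem sum_sub_half_sq_le_sum_exists_modEq : ∃ C : ℝ, 1 ≤ C ∧ ∀ (y t : ℕ) (Q : Finset ℕ),
    0 < y → (∀ q ∈ Q, q.Prime) → Q ⊆ Ioc y (y ^ 2) → y ^ 30 ≤ t →
    ∑ q ∈ Q, 1 / ((q : ℝ) - 1) ≤ 1 →
    (∑ q ∈ Q, 1 / ((q : ℝ) - 1) - (∑ q ∈ Q, 1 / ((q : ℝ) - 1)) ^ 2 / 2) *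
      ∑ n ∈ Ioc 0 t, Λ n * ((t - n : ℕ) : ℝ) -
      C * ((t : ℝ) ^ 2 * (1 + Real.log y) ^ 7 / √y) - C * t * √(t : ℝ) ≤
    ∑ n ∈ Ioc 0 t with ∃ q ∈ Q, n ≡ 1 [MOD q], Λ n * ((t - n : ℕ) : ℝ) := by
  obtain ⟨C₁, hC₁, h₁⟩ := sum_abs_vonMangoldt_smoothedDeviation_le
  obtain ⟨C₂, hC₂, h₂⟩ := sum_vonMangoldt_dvd_le
  refine ⟨2 * C₁ + C₂, by linarith, fun y t Q hy hQ hQy ht hs => ?_⟩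
  set s := ∑ q ∈ Q, 1 / ((q : ℝ) - 1) with hsdef
  have hy0 : (0 : ℝ) < y := by exact_mod_cast hy
  have hy1 : (1 : ℝ) ≤ y := by exact_mod_cast hy
  have hs0' : 0 < √(y : ℝ) := Real.sqrt_pos.2 hy0
  have hlog := Real.log_nonneg hy1
  set l := 1 + Real.log y with hl
  have hl1 : 1 ≤ l := by linarith
  have ht1 : 1 ≤ t := le_trans (Nat.one_le_pow _ _ hy) ht
  have ht0 : (0 : ℝ) < t := by exact_mod_cast ht1
  set w : ℕ → ℝ := fun n => Λ n * ((t - n : ℕ) : ℝ) with hw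
  have hw0 : ∀ n, 0 ≤ w n := fun n =>
    mul_nonneg ArithmeticFunction.vonMangoldt_nonneg (Nat.cast_nonneg _)
  have hwt : ∀ n, w n ≤ t * Λ n := fun n => by
    refine (mul_le_mul_of_nonneg_left ?_ ArithmeticFunction.vonMangoldt_nonneg).trans_eq
      (mul_comm _ _)
    exact_mod_cast Nat.sub_le t n
  set Ψ := ∑ n ∈ Ioc 0 t, w n with hΨ
  set A : ℕ → ℝ := fun q => ∑ n ∈ Ioc 0 t, if n ≡ 1 [MOD q] then w n else 0 with hA
  have hA0 : ∀ q, 0 ≤ A q := fun q => sum_nonneg fun n _ => by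
    split_ifs
    exacts [hw0 n, le_rfl]
  set A₂ : ℕ → ℕ → ℝ := fun r q =>
    ∑ n ∈ Ioc 0 t, if n ≡ 1 [MOD r] ∧ n ≡ 1 [MOD q] then w n else 0 with hA₂
  set E : ℕ → ℕ → ℝ := fun r q => ∑ n ∈ Ioc 0 t, Λ n * smoothedDeviation r q t n with hE
  set R : ℕ → ℕ → ℝ := fun r q => ∑ n ∈ Ioc 0 t,
    if n ≡ 1 [MOD r] ∧ ¬ q ∣ n then w n else 0 with hR
  have hAE : ∀ r, ∀ q ∈ Q, A₂ r q = E r q + 1 / ((q : ℝ) - 1) * R r q := by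
    intro r q hq
    rw [hA₂, hE, hR]
    simp only
    rw [mul_sum, ← sum_add_distrib]
    exact sum_congr rfl fun n _ => ite_vonMangoldt_eq (hQ q hq) r t n
  have hqinv : ∀ q ∈ Q, 0 ≤ 1 / ((q : ℝ) - 1) := by
    intro q hq
    have : (1 : ℝ) < q := by exact_mod_cast (hQ q hq).one_lt
    exact div_nonneg zero_le_one (by linarith)
  have hs0 : 0 ≤ s := sum_nonneg hqinv
  set G := (t : ℝ) ^ 2 * l ^ 6 / √y with hG
  have hG0 : 0 ≤ G := by positivity
  have hE1 : ∑ q ∈ Q, |E 1 q| ≤ C₁ * G := by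
    have := h₁ y 1 t Q hy one_pos (Nat.one_le_pow _ _ hy) hQ
      (fun q _ => Nat.coprime_one_left q) hQy ht
    rwa [Nat.cast_one, one_mul] at this
  have hA1 : ∀ q, A₂ 1 q = A q := by
    intro q
    simp only [hA₂, hA]
    refine sum_congr rfl fun n _ => ?_
    simp [Nat.modEq_one]
  have hAlow : s * Ψ - C₂ * t * √(t : ℝ) - C₁ * G ≤ ∑ q ∈ Q, A q := by
    have h3 : ∀ q ∈ Q, 1 / ((q : ℝ) - 1) * (Ψ - C₂ * t * √(t : ℝ)) - |E 1 q| ≤ A q := by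
      intro q hq
      rw [← hA1, hAE 1 q hq]
      have h4 : Ψ - C₂ * t * √(t : ℝ) ≤ R 1 q := by
        have h5 : Ψ = R 1 q + ∑ n ∈ Ioc 0 t with q ∣ n, w n := by
          rw [hΨ, hR, sum_filter]
          simp only
          rw [← sum_add_distrib]
          refine sum_congr rfl fun n _ => ?_
          by_cases hd : q ∣ n <;> simp [hd, Nat.modEq_one]
        have h6 : ∑ n ∈ Ioc 0 t with q ∣ n, w n ≤ t * (C₂ * √(t : ℝ)) := by
          refine (sum_le_sum fun n _ => hwt n).trans ?_
          rw [← mul_sum]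
          exact mul_le_mul_of_nonneg_left (h₂ q t (hQ q hq) ht1) ht0.le
        nlinarith
      have h7 := mul_le_mul_of_nonneg_left h4 (hqinv q hq)
      have h8 := neg_abs_le (E 1 q)
      linarith
    have h4 := sum_le_sum h3
    rw [sum_sub_distrib, ← sum_mul] at h4
    have h5 : s * (C₂ * t * √(t : ℝ)) ≤ 1 * (C₂ * t * √(t : ℝ)) :=
      mul_le_mul_of_nonneg_right hs (by positivity)
    rw [← hsdef, mul_sub] at h4
    linarith
  have hinv : ∑ r ∈ Q, (1 : ℝ) / r ≤ 2 * l := by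
    have h3 := sum_inv_le_of_subset Q (N := y ^ 2)
      (hQy.trans (Ioc_subset_Ioc_left (Nat.zero_le _)))
    push_cast [Real.log_pow] at h3
    rw [hl]
    linarith
  have hpair : ∑ r ∈ Q, ∑ q ∈ Q.erase r, A₂ r q ≤ s * ∑ r ∈ Q, A r + C₁ * G * (2 * l) := by
    have h3 : ∀ r ∈ Q, ∑ q ∈ Q.erase r, A₂ r q ≤ s * A r + C₁ * G * (1 / r) := by
      intro r hr
      have hrp := hQ r hr
      have h4 : ∑ q ∈ Q.erase r, |E r q| ≤ C₁ * G * (1 / r) := by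
        refine (h₁ y r t (Q.erase r) hy hrp.pos (mem_Ioc.1 (hQy hr)).2
          (fun q hq => hQ q (mem_of_mem_erase hq)) (fun q hq =>
            (Nat.coprime_primes hrp (hQ q (mem_of_mem_erase hq))).2 (ne_of_mem_erase hq).symm)
          ((erase_subset _ _).trans hQy) ht).trans (le_of_eq ?_)
        rw [hG, hl]
        have : (0 : ℝ) < r := by exact_mod_cast hrp.pos
        field_simp
      have h5 : ∀ q ∈ Q.erase r, A₂ r q ≤ |E r q| + 1 / ((q : ℝ) - 1) * A r := by
        intro q hq
        have hq' := mem_of_mem_erase hq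
        rw [hAE r q hq']
        refine add_le_add (le_abs_self _)
          (mul_le_mul_of_nonneg_left (sum_le_sum fun n _ => ?_) (hqinv q hq'))
        by_cases h6 : n ≡ 1 [MOD r]
        · by_cases hd : q ∣ n
          · simp [h6, hd, hw0 n]
          · simp [h6, hd]
        · simp [h6]
      refine (sum_le_sum h5).trans ?_
      rw [sum_add_distrib, ← sum_mul]
      have h6 : ∑ q ∈ Q.erase r, 1 / ((q : ℝ) - 1) ≤ s :=
        sum_le_sum_of_subset_of_nonneg (erase_subset _ _) fun q hq _ => hqinv q hq
      have h7 := mul_le_mul_of_nonneg_right h6 (hA0 r)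
      linarith
    refine (sum_le_sum h3).trans ?_
    rw [sum_add_distrib, ← mul_sum, ← mul_sum]
    have := mul_le_mul_of_nonneg_left hinv (show 0 ≤ C₁ * G by positivity)
    linarith
  have hind : ∑ q ∈ Q, A q - (∑ r ∈ Q, ∑ q ∈ Q.erase r, A₂ r q) / 2 ≤
      ∑ n ∈ Ioc 0 t with ∃ q ∈ Q, n ≡ 1 [MOD q], w n := by
    have h3 : ∀ n ∈ Ioc 0 t, w n * (∑ q ∈ Q, (if n ≡ 1 [MOD q] then (1 : ℝ) else 0) -
        (∑ r ∈ Q, ∑ q ∈ Q.erase r,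
          if n ≡ 1 [MOD r] ∧ n ≡ 1 [MOD q] then (1 : ℝ) else 0) / 2) ≤
        if ∃ q ∈ Q, n ≡ 1 [MOD q] then w n else 0 := by
      intro n _
      refine (mul_le_mul_of_nonneg_left
        (sum_indicator_sub_half_sum_pairs_le Q fun q => n ≡ 1 [MOD q]) (hw0 n)).trans
        (le_of_eq ?_)
      rw [mul_ite, mul_one, mul_zero]
    have h4 := sum_le_sum h3
    rw [← sum_filter] at h4
    refine le_trans (le_of_eq ?_) h4
    have e1 : ∑ q ∈ Q, A q = ∑ n ∈ Ioc 0 t, w n *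
        ∑ q ∈ Q, (if n ≡ 1 [MOD q] then (1 : ℝ) else 0) := by
      simp only [hA]
      rw [sum_comm]
      refine sum_congr rfl fun n _ => ?_
      rw [mul_sum]
      refine sum_congr rfl fun q _ => ?_
      rw [mul_ite, mul_one, mul_zero]
    have e2 : ∑ r ∈ Q, ∑ q ∈ Q.erase r, A₂ r q = ∑ n ∈ Ioc 0 t, w n *
        ∑ r ∈ Q, ∑ q ∈ Q.erase r,
          (if n ≡ 1 [MOD r] ∧ n ≡ 1 [MOD q] then (1 : ℝ) else 0) := by
      simp only [hA₂]
      rw [sum_congr rfl fun r _ => sum_comm, sum_comm]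
      refine sum_congr rfl fun n _ => ?_
      rw [mul_sum]
      refine sum_congr rfl fun r _ => ?_
      rw [mul_sum]
      refine sum_congr rfl fun q _ => ?_
      rw [mul_ite, mul_one, mul_zero]
    rw [e1, e2, sum_div, ← sum_sub_distrib]
    refine sum_congr rfl fun n _ => ?_
    ring
  have hGl : G ≤ G * l := le_mul_of_one_le_right hG0 hl1
  have hGe : (t : ℝ) ^ 2 * l ^ 7 / √y = G * l := by
    rw [hG]
    ring
  rw [hGe]
  have hts : 0 ≤ (t : ℝ) * √(t : ℝ) := by positivity
  have h3 : (1 - s / 2) * (s * Ψ - C₂ * t * √(t : ℝ) - C₁ * G) ≤ (1 - s / 2) * ∑ q ∈ Q, A q :=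
    mul_le_mul_of_nonneg_left hAlow (by linarith)
  have h4 : (1 - s / 2) * (C₂ * t * √(t : ℝ) + C₁ * G) ≤ 1 * (C₂ * t * √(t : ℝ) + C₁ * G) :=
    mul_le_mul_of_nonneg_right (by linarith) (by positivity)
  have h5 : C₁ * G ≤ C₁ * (G * l) := mul_le_mul_of_nonneg_left hGl (by linarith)
  have h6 : 0 ≤ C₂ * (G * l) := by positivity
  have h7 : 0 ≤ C₁ * (t * √(t : ℝ)) := by positivity
  nlinarith

theorem sum_log_prime_dvd_sub_one_ge_sub : ∃ C : ℝ, 1 ≤ C ∧ ∀ (y t : ℕ) (Q : Finset ℕ) (σ : ℝ),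
    0 < y → (∀ q ∈ Q, q.Prime) → Q ⊆ Ioc y (y ^ 2) → y ^ 30 ≤ t →
    0 ≤ σ → σ ≤ ∑ q ∈ Q, 1 / ((q : ℝ) - 1) → ∑ q ∈ Q, 1 / ((q : ℝ) - 1) ≤ 1 →
    (σ - σ ^ 2 / 2) * (0.46 * (t : ℝ) ^ 2) - C * ((t : ℝ) ^ 2 * (1 + Real.log y) ^ 7 / √y) ≤
    ∑ p ∈ Ioc 0 t with p.Prime ∧ ∃ q ∈ Q, q ∣ p - 1, Real.log p * ((t - p : ℕ) : ℝ) := by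
  obtain ⟨C, hC, h⟩ := sum_sub_half_sq_le_sum_exists_modEq
  obtain ⟨K, hK, hK'⟩ := sum_vonMangoldt_mul_sub_ge
  obtain ⟨C', hC', h'⟩ := sum_vonMangoldt_not_prime_le
  refine ⟨2 * C + K + C', by linarith, fun y t Q σ hy hQ hQy ht hσ0 hσ hs => ?_⟩
  have h1 := h y t Q hy hQ hQy ht hs
  set s := ∑ q ∈ Q, 1 / ((q : ℝ) - 1) with hsdef
  have hy1 : (1 : ℝ) ≤ y := by exact_mod_cast hy
  have hs0' : 0 < √(y : ℝ) := Real.sqrt_pos.2 (by linarith)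
  have hlog := Real.log_nonneg hy1
  have ht1 : 1 ≤ t := le_trans (Nat.one_le_pow _ _ hy) ht
  have ht0 : (1 : ℝ) ≤ t := by exact_mod_cast ht1
  have hyt : (y : ℝ) ≤ t := by
    have : y ≤ t := (Nat.le_self_pow (by norm_num) y).trans ht
    exact_mod_cast this
  set G := (t : ℝ) ^ 2 * (1 + Real.log y) ^ 7 / √y with hG
  have htG : (t : ℝ) * √t ≤ G := by
    rw [hG, le_div_iff₀ hs0']
    have e1 : √(y : ℝ) ≤ √t := Real.sqrt_le_sqrt hyt
    have e2 : √(t : ℝ) * √t = t := Real.mul_self_sqrt (by linarith)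
    have e3 : (1 : ℝ) ≤ (1 + Real.log y) ^ 7 := one_le_pow₀ (by linarith)
    calc (t : ℝ) * √t * √y ≤ t * √t * √t := by gcongr
      _ = (t : ℝ) ^ 2 * 1 := by rw [mul_assoc, e2]; ring
      _ ≤ _ := by gcongr
  have htt : (t : ℝ) ≤ t * √t := le_mul_of_one_le_right (by linarith) (Real.one_le_sqrt.2 ht0)
  set Ψ := ∑ n ∈ Ioc 0 t, Λ n * ((t - n : ℕ) : ℝ) with hΨ
  have hΨ0 : 0 ≤ Ψ := sum_nonneg fun n _ =>
    mul_nonneg ArithmeticFunction.vonMangoldt_nonneg (Nat.cast_nonneg _)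
  have h2 : (σ - σ ^ 2 / 2) * (0.46 * (t : ℝ) ^ 2) - K * t ≤ (s - s ^ 2 / 2) * Ψ := by
    have e1 : (σ - σ ^ 2 / 2) ≤ (s - s ^ 2 / 2) := by nlinarith
    have e2 : 0 ≤ (σ - σ ^ 2 / 2) := by nlinarith
    have e3 : (σ - σ ^ 2 / 2) ≤ 1 := by nlinarith
    have e4 := mul_le_mul_of_nonneg_right e1 hΨ0
    have e5 := mul_le_mul_of_nonneg_left (hK' t) e2
    have e6 : (σ - σ ^ 2 / 2) * (K * t) ≤ 1 * (K * t) :=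
      mul_le_mul_of_nonneg_right e3 (by positivity)
    linarith
  have h3 : ∑ n ∈ Ioc 0 t with ∃ q ∈ Q, n ≡ 1 [MOD q], Λ n * ((t - n : ℕ) : ℝ) ≤
      ∑ p ∈ Ioc 0 t with p.Prime ∧ ∃ q ∈ Q, q ∣ p - 1, Real.log p * ((t - p : ℕ) : ℝ) +
      t * (C' * √t) := by
    rw [← sum_filter_add_sum_filter_not (filter _ _) Nat.Prime]
    refine add_le_add (le_of_eq ?_) ?_
    · rw [filter_filter]
      refine sum_congr (filter_congr fun p hp => ?_) fun p hp => ?_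
      · rw [and_comm]
        refine and_congr_right fun _ => exists_congr fun q => and_congr_right fun _ => ?_
        rw [← Nat.modEq_iff_dvd' (mem_Ioc.1 hp).1]
        exact ⟨Nat.ModEq.symm, Nat.ModEq.symm⟩
      · rw [ArithmeticFunction.vonMangoldt_apply_prime (mem_filter.1 hp).2.1]
    · refine le_trans ?_ (mul_le_mul_of_nonneg_left (h' t) (by linarith))
      rw [mul_sum]
      refine (sum_le_sum fun n _ => ?_).trans (sum_le_sum_of_subset_of_nonneg
        (filter_subset_filter _ (filter_subset _ _)) fun n _ _ => ?_)
      · refine (mul_le_mul_of_nonneg_left ?_ ArithmeticFunction.vonMangoldt_nonneg).trans_eq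
          (mul_comm _ _)
        exact_mod_cast Nat.sub_le t n
      · exact mul_nonneg (by linarith) ArithmeticFunction.vonMangoldt_nonneg
  have e1 : K * t ≤ K * G := mul_le_mul_of_nonneg_left (htt.trans htG) hK
  have e2 : C * (t * √t) ≤ C * G := mul_le_mul_of_nonneg_left htG (by linarith)
  have e3 : C' * (t * √t) ≤ C' * G := mul_le_mul_of_nonneg_left htG hC'
  linarith

theorem eventually_mul_pow_le_sqrt (C : ℝ) :
    ∀ᶠ y : ℝ in atTop, C * (1 + Real.log y) ^ 8 ≤ √y := by
  have h1 := (Real.isLittleO_pow_log_id_atTop (n := 8)).tendsto_div_nhds_zero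
  have h2 := h1.comp Real.tendsto_sqrt_atTop
  have h3 := h2.eventually (eventually_le_nhds (show (0 : ℝ) < 1 / (4 ^ 8 * (|C| + 1)) by positivity))
  filter_upwards [h3, eventually_ge_atTop (Real.exp 1)] with y hy1 hy2
  have hy0 : 0 < y := lt_of_lt_of_le (Real.exp_pos 1) hy2
  have hlog : 1 ≤ Real.log y := by
    rw [Real.le_log_iff_exp_le hy0]
    exact hy2
  have hs : 0 < √y := Real.sqrt_pos.2 hy0
  simp only [Function.comp, id] at hy1
  rw [Real.log_sqrt hy0.le, div_le_div_iff₀ hs (by positivity), one_mul] at hy1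
  have h4 : (1 + Real.log y) ^ 8 ≤ (4 * (Real.log y / 2)) ^ 8 :=
    pow_le_pow_left₀ (by linarith) (by linarith) 8
  rw [mul_pow] at h4
  have h5 : C ≤ |C| + 1 := by linarith [le_abs_self C]
  calc C * (1 + Real.log y) ^ 8 ≤ (|C| + 1) * (4 ^ 8 * (Real.log y / 2) ^ 8) := by gcongr
    _ ≤ √y := by linarith

theorem sum_log_prime_dvd_sub_one_ge : ∃ Y : ℕ, 1 ≤ Y ∧ ∀ (y t : ℕ) (Q : Finset ℕ) (ε : ℝ),
    Y ≤ y → (∀ q ∈ Q, q.Prime) → Q ⊆ Ioc y (y ^ 2) → y ^ 30 ≤ t →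
    1 / (2 * Real.log y) ≤ ε → ε ≤ 1 / 4 →
    0.62 * ε ≤ ∑ q ∈ Q, 1 / ((q : ℝ) - 1) → ∑ q ∈ Q, 1 / ((q : ℝ) - 1) ≤ 1 →
    0.253 * ε * (t : ℝ) ^ 2 ≤
    ∑ p ∈ Ioc 0 t with p.Prime ∧ ∃ q ∈ Q, q ∣ p - 1, Real.log p * ((t - p : ℕ) : ℝ) := by
  obtain ⟨C, hC, h⟩ := sum_log_prime_dvd_sub_one_ge_sub
  obtain ⟨Y, hY⟩ := eventually_atTop.1
    (tendsto_natCast_atTop_atTop.eventually (eventually_mul_pow_le_sqrt (200 * C)))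
  refine ⟨max Y 3, by omega, fun y t Q ε hy hQ hQy ht hε hε' hs hs' => ?_⟩
  have hy3 : 3 ≤ y := (le_max_right _ _).trans hy
  have hy3' : (3 : ℝ) ≤ y := by exact_mod_cast hy3
  have hlog : 0 < Real.log y := Real.log_pos (by linarith)
  have hsy : 0 < √(y : ℝ) := Real.sqrt_pos.2 (by linarith)
  have hε0 : 0 < ε := lt_of_lt_of_le (by positivity) hε
  have h1 := h y t Q (0.62 * ε) (by omega) hQ hQy ht (by linarith) hs hs'
  have h2 := hY y ((le_max_left _ _).trans hy)
  have h3 : C * (1 + Real.log y) ^ 7 / √y ≤ 0.01 * ε := by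
    rw [div_le_iff₀ hsy]
    rw [div_le_iff₀ (by positivity)] at hε
    have h4 : 0 ≤ C * (1 + Real.log y) ^ 7 := by positivity
    have h5 : 200 * (C * (1 + Real.log y) ^ 7) * Real.log y ≤ √y := by
      refine le_trans ?_ h2
      have : C * (1 + Real.log y) ^ 8 = C * (1 + Real.log y) ^ 7 * (1 + Real.log y) := by ring
      nlinarith
    have h6 : (200 * (C * (1 + Real.log y) ^ 7)) * 1 ≤
        (200 * (C * (1 + Real.log y) ^ 7)) * (ε * (2 * Real.log y)) :=
      mul_le_mul_of_nonneg_left hε (by positivity)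
    have h7 := mul_le_mul_of_nonneg_left h5 (show 0 ≤ 2 * ε by linarith)
    linarith
  have h4 : C * ((t : ℝ) ^ 2 * (1 + Real.log y) ^ 7 / √y) ≤ 0.01 * ε * (t : ℝ) ^ 2 := by
    calc C * ((t : ℝ) ^ 2 * (1 + Real.log y) ^ 7 / √y) =
        C * (1 + Real.log y) ^ 7 / √y * (t : ℝ) ^ 2 := by ring
      _ ≤ _ := by gcongr
  refine le_trans ?_ h1
  have ht2 : 0 ≤ (t : ℝ) ^ 2 := by positivity
  have h5 : 0.263 * ε ≤ (0.62 * ε - (0.62 * ε) ^ 2 / 2) * 0.46 := by nlinarith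
  have h6 := mul_le_mul_of_nonneg_right h5 ht2
  linarith

theorem theta_natCast_succ (n : ℕ) : Chebyshev.theta ((n + 1 : ℕ) : ℝ) =
    Chebyshev.theta (n : ℝ) + if (n + 1).Prime then Real.log ((n + 1 : ℕ) : ℝ) else 0 := by
  rw [Chebyshev.theta, Chebyshev.theta, Nat.floor_natCast, Nat.floor_natCast, sum_filter,
    sum_filter, sum_Ioc_succ_top (Nat.zero_le n)]

theorem sum_log_prime_div_eq {y N : ℕ} (hyN : y ≤ N) :
    ∑ q ∈ Ioc y N with q.Prime, Real.log q / q =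
      Chebyshev.theta N / (N + 1) - Chebyshev.theta y / (y + 1) +
      ∑ n ∈ Ioc y N, Chebyshev.theta n / ((n : ℝ) * (n + 1)) := by
  induction N, hyN using Nat.le_induction with
  | base => simp
  | succ N hN ih =>
    rw [sum_filter] at ih ⊢
    rw [sum_Ioc_succ_top hN, sum_Ioc_succ_top hN, ih, theta_natCast_succ]
    have h1 : (N : ℝ) + 1 ≠ 0 := by positivity
    have h2 : (N : ℝ) + 1 + 1 ≠ 0 := by positivity
    push_cast
    split_ifs
    · field_simp
      ring
    · field_simp
      ring

theorem sum_inv_mul_succ_eq {y N : ℕ} (hyN : y ≤ N) :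
    ∑ n ∈ Ioc y N, 1 / ((n : ℝ) * (n + 1)) = 1 / ((y : ℝ) + 1) - 1 / ((N : ℝ) + 1) := by
  induction N, hyN using Nat.le_induction with
  | base => simp
  | succ N hN ih =>
    rw [sum_Ioc_succ_top hN, ih]
    push_cast
    field_simp
    ring

theorem log_sub_log_le_sum_inv_succ {y N : ℕ} (hyN : y ≤ N) :
    Real.log (N + 2) - Real.log (y + 2) ≤ ∑ n ∈ Ioc y N, 1 / ((n : ℝ) + 1) := by
  induction N, hyN using Nat.le_induction with
  | base => simp
  | succ N hN ih =>
    rw [sum_Ioc_succ_top hN]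
    have h1 : Real.log ((N + 1 : ℕ) + 2) - Real.log (N + 2) ≤ 1 / (((N + 1 : ℕ) : ℝ) + 1) := by
      rw [← Real.log_div (by positivity) (by positivity)]
      refine (Real.log_le_sub_one_of_pos (by positivity)).trans (le_of_eq ?_)
      push_cast
      field_simp
      ring
    linarith

theorem sum_log_prime_div_ge : ∃ K : ℝ, 0 ≤ K ∧ ∀ y N : ℕ, y ≤ N →
    0.919 * (Real.log (N + 2) - Real.log (y + 2)) - 0.196 - K / (y + 1) ≤
    ∑ q ∈ Ioc y N with q.Prime, Real.log q / q := by
  obtain ⟨K₁, hK₁, h₁⟩ := theta_natCast_ge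
  obtain ⟨K₂, hK₂, h₂⟩ := theta_natCast_le
  refine ⟨2 * K₁ + K₂ + 1, by linarith, fun y N hyN => ?_⟩
  rw [sum_log_prime_div_eq hyN]
  have hy1 : (0 : ℝ) < (y : ℝ) + 1 := by positivity
  have hN1 : (0 : ℝ) < (N : ℝ) + 1 := by positivity
  have hyN' : (y : ℝ) ≤ N := by exact_mod_cast hyN
  have e1 : 0.919 - (K₁ + 1) / (y + 1) ≤ Chebyshev.theta N / (N + 1) := by
    have h3 : (K₁ + 1) / (N + 1) ≤ (K₁ + 1) / ((y : ℝ) + 1) := by gcongr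
    have h4 : 0.919 - (K₁ + 1) / ((N : ℝ) + 1) ≤ Chebyshev.theta N / (N + 1) := by
      rw [le_div_iff₀ hN1, sub_mul, div_mul_cancel₀ _ hN1.ne']
      have := h₁ N
      linarith
    linarith
  have e2 : Chebyshev.theta y / (y + 1) ≤ 1.115 + K₂ / (y + 1) := by
    rw [div_le_iff₀ hy1, add_mul, div_mul_cancel₀ _ hy1.ne']
    have := h₂ y
    linarith
  have e3 : 0.919 * (Real.log (N + 2) - Real.log (y + 2)) - K₁ / (y + 1) ≤
      ∑ n ∈ Ioc y N, Chebyshev.theta n / ((n : ℝ) * (n + 1)) := by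
    have h3 : ∀ n ∈ Ioc y N, 0.919 * (1 / ((n : ℝ) + 1)) - K₁ * (1 / ((n : ℝ) * (n + 1))) ≤
        Chebyshev.theta n / ((n : ℝ) * (n + 1)) := by
      intro n hn
      have hn0 : (0 : ℝ) < n := by exact_mod_cast (Nat.zero_le y).trans_lt (mem_Ioc.1 hn).1
      have h4 : 0.919 * (1 / ((n : ℝ) + 1)) - K₁ * (1 / ((n : ℝ) * (n + 1))) =
          (0.919 * (n : ℝ) - K₁) / ((n : ℝ) * (n + 1)) := by
        field_simp
      rw [h4]
      gcongr
      exact h₁ n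
    have h4 := sum_le_sum h3
    rw [sum_sub_distrib, ← mul_sum, ← mul_sum, sum_inv_mul_succ_eq hyN] at h4
    have h5 := log_sub_log_le_sum_inv_succ hyN
    have h6 : 0 ≤ K₁ * (1 / ((N : ℝ) + 1)) := by positivity
    have h7 : K₁ * (1 / ((y : ℝ) + 1)) = K₁ / (y + 1) := by ring
    nlinarith
  have e4 : (2 * K₁ + K₂ + 1) / ((y : ℝ) + 1) =
      (K₁ + 1) / (y + 1) + K₂ / (y + 1) + K₁ / (y + 1) := by ring
  linarith

theorem sum_prime_inv_sub_one_bounds : ∃ T : ℝ, 3 ≤ T ∧ ∀ z ε : ℝ, T ≤ z →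
    1 / Real.log z ≤ ε → ε ≤ 1 / 4 →
    {q ∈ Ioc ⌊z⌋₊ ⌊z ^ (1 + ε)⌋₊ | q.Prime} ⊆ Ioc ⌊z⌋₊ (⌊z⌋₊ ^ 2) ∧
    0.62 * ε ≤ ∑ q ∈ Ioc ⌊z⌋₊ ⌊z ^ (1 + ε)⌋₊ with q.Prime, 1 / ((q : ℝ) - 1) ∧
    ∑ q ∈ Ioc ⌊z⌋₊ ⌊z ^ (1 + ε)⌋₊ with q.Prime, 1 / ((q : ℝ) - 1) ≤ 1 := by
  obtain ⟨K, hK, h₁⟩ := sum_log_prime_div_ge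
  obtain ⟨C, hC, h₂⟩ := sum_vonMangoldt_div_le
  obtain ⟨T, hT⟩ := eventually_atTop.1 ((eventually_ge_atTop (1000 * (K + 2))).and
    (Real.tendsto_log_atTop.eventually_ge_atTop (4 * C + 20)))
  refine ⟨max T 3, le_max_right _ _, fun z ε hz hε hε' => ?_⟩
  obtain ⟨hzK, hlz⟩ := hT z ((le_max_left _ _).trans hz)
  have hz0 : 0 < z := by linarith
  set L := Real.log z with hL
  have hL0 : 0 < L := by linarith
  have hε0 : 0 < ε := lt_of_lt_of_le (by positivity) hε
  have hεL : 1 ≤ ε * L := by rwa [div_le_iff₀ hL0] at hε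
  set y := ⌊z⌋₊ with hy
  set w := z ^ (1 + ε) with hw
  set N := ⌊w⌋₊ with hN
  have hyz : (y : ℝ) ≤ z := Nat.floor_le hz0.le
  have hzy : z < y + 1 := Nat.lt_floor_add_one z
  have hw0 : 0 < w := Real.rpow_pos_of_pos hz0 _
  have hNw : (N : ℝ) ≤ w := Nat.floor_le hw0.le
  have hwN : w < N + 1 := Nat.lt_floor_add_one w
  have hlw : Real.log w = (1 + ε) * L := Real.log_rpow hz0 _
  have hzw : z ≤ w := by
    have := Real.rpow_le_rpow_of_exponent_le (show 1 ≤ z by linarith)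
      (show (1 : ℝ) ≤ 1 + ε by linarith)
    rwa [Real.rpow_one] at this
  have hyN : y ≤ N := Nat.floor_le_floor hzw
  have hy1 : (1 : ℝ) < y := by linarith
  have hy0 : 0 < y := by
    have : (0 : ℝ) < y := by linarith
    exact_mod_cast this
  have hlogy : L - 1 ≤ Real.log y := by
    have h3 : Real.log (z / y) ≤ z / y - 1 := Real.log_le_sub_one_of_pos (by positivity)
    rw [Real.log_div hz0.ne' (by positivity)] at h3
    have h4 : z / y ≤ 2 := by
      rw [div_le_iff₀ (by linarith)]
      linarith
    linarith
  have hlogN : Real.log N ≤ (1 + ε) * L := by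
    rw [← hlw]
    exact Real.log_le_log (by linarith [show (y : ℝ) ≤ N by exact_mod_cast hyN]) hNw
  have hq : ∀ q ∈ {q ∈ Ioc y N | q.Prime}, z < q ∧ L ≤ Real.log q ∧
      Real.log q ≤ (1 + ε) * L ∧ (2 : ℝ) ≤ q := by
    intro q hq
    obtain ⟨hq1, hqp⟩ := mem_filter.1 hq
    obtain ⟨hq1, hq2⟩ := mem_Ioc.1 hq1
    have h3 : (y : ℝ) + 1 ≤ q := by exact_mod_cast hq1
    have h4 : (q : ℝ) ≤ N := by exact_mod_cast hq2
    refine ⟨by linarith, Real.log_le_log hz0 (by linarith), ?_, by linarith⟩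
    exact (Real.log_le_log (by linarith) h4).trans hlogN
  refine ⟨?_, ?_, ?_⟩
  · intro q hq'
    refine mem_Ioc.2 ⟨(mem_Ioc.1 (mem_filter.1 hq').1).1, ?_⟩
    obtain ⟨h3, -, h4, h5⟩ := hq q hq'
    have h6 : Real.log q ≤ Real.log ((y : ℝ) ^ 2) := by
      rw [Real.log_pow]
      push_cast
      nlinarith
    have h7 := (Real.log_le_log_iff (by linarith) (by positivity)).1 h6
    exact_mod_cast h7
  · have h3 : (∑ q ∈ Ioc y N with q.Prime, Real.log q / q) * (1 / ((1 + ε) * L)) ≤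
        ∑ q ∈ Ioc y N with q.Prime, 1 / ((q : ℝ) - 1) := by
      rw [sum_mul]
      refine sum_le_sum fun q hq' => ?_
      obtain ⟨h3, h4, h5, h6⟩ := hq q hq'
      have h7 : Real.log q * (1 / ((1 + ε) * L)) ≤ 1 := by
        rw [mul_one_div, div_le_one (by positivity)]
        exact h5
      calc Real.log q / q * (1 / ((1 + ε) * L)) = Real.log q * (1 / ((1 + ε) * L)) * (1 / q) := by
            ring
        _ ≤ 1 * (1 / q) := by gcongr
        _ ≤ 1 / ((q : ℝ) - 1) := by
            rw [one_mul]
            exact one_div_le_one_div_of_le (by linarith) (by linarith)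
    refine le_trans ?_ h3
    rw [mul_one_div, le_div_iff₀ (by positivity)]
    have h4 := h₁ y N hyN
    have h5 : (1 + ε) * L ≤ Real.log (N + 2) := by
      rw [← hlw]
      exact Real.log_le_log hw0 (by linarith)
    have h6 : Real.log (y + 2) ≤ L + 0.002 := by
      have h7 := Real.log_le_sub_one_of_pos (show 0 < ((y : ℝ) + 2) / z by positivity)
      rw [Real.log_div (by positivity) hz0.ne'] at h7
      have h8 : ((y : ℝ) + 2) / z ≤ 1.002 := by
        rw [div_le_iff₀ hz0]
        linarith
      linarith
    have h7 : K / (y + 1) ≤ 0.001 := by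
      rw [div_le_iff₀ (by linarith)]
      linarith
    have h8 : 0.919 * (ε * L) - 0.2 ≤ ∑ q ∈ Ioc y N with q.Prime, Real.log q / q := by
      refine le_trans ?_ h4
      linarith
    refine le_trans ?_ h8
    rcases le_or_gt ε 0.15 with h | h
    · have : ε * (ε * L) ≤ 0.15 * (ε * L) := mul_le_mul_of_nonneg_right h (by linarith)
      linarith
    · have h9 : ε * (ε * L) ≤ 1 / 4 * (ε * L) := mul_le_mul_of_nonneg_right hε' (by linarith)
      have h10 : 0.15 * L ≤ ε * L := mul_le_mul_of_nonneg_right h.le hL0.le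
      linarith
  · have h3 : ∑ q ∈ Ioc y N with q.Prime, 1 / ((q : ℝ) - 1) ≤
        ∑ q ∈ Ioc y N with q.Prime, (2 / L) * (Λ q / q) := by
      refine sum_le_sum fun q hq' => ?_
      obtain ⟨h3, h4, h5, h6⟩ := hq q hq'
      rw [ArithmeticFunction.vonMangoldt_apply_prime (mem_filter.1 hq').2]
      have h7 : 1 ≤ Real.log q / L := by
        rw [le_div_iff₀ hL0]
        linarith
      calc 1 / ((q : ℝ) - 1) ≤ 2 / q * 1 := by
            rw [mul_one, div_le_div_iff₀ (by linarith) (by linarith)]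
            linarith
        _ ≤ 2 / q * (Real.log q / L) := by gcongr
        _ = _ := by ring
    refine h3.trans ?_
    rw [← mul_sum, div_mul_eq_mul_div, div_le_one hL0]
    have h4 : ∑ q ∈ Ioc y N with q.Prime, Λ q / (q : ℝ) ≤ ∑ q ∈ Ioc y N, Λ q / (q : ℝ) :=
      sum_le_sum_of_subset_of_nonneg (filter_subset _ _) fun q _ _ =>
        div_nonneg ArithmeticFunction.vonMangoldt_nonneg (Nat.cast_nonneg _)
    have h5 := sum_Ioc_consecutive (fun q => Λ q / (q : ℝ)) (Nat.zero_le y) hyN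
    have h6 := h₂ N (hy0.trans_le hyN)
    have h7 := sum_vonMangoldt_div_ge y hy0
    have h8 : ε * L ≤ 1 / 4 * L := mul_le_mul_of_nonneg_right hε' hL0.le
    linarith

theorem sum_sub_mul_inv_eq {p N : ℕ} (hp : 1 ≤ p) (hpN : p ≤ N) :
    ∑ t ∈ Ioc p N, ((t - p : ℕ) : ℝ) * (2 / (((t : ℝ) - 1) * t * (t + 1))) =
      1 / p - 1 / N - ((N : ℝ) - p) / (N * (N + 1)) := by
  induction N, hpN using Nat.le_induction with
  | base => simp
  | succ N hN ih =>
    rw [sum_Ioc_succ_top hN, ih, Nat.cast_sub (by omega)]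
    have hN0 : (0 : ℝ) < N := by exact_mod_cast (by omega : 0 < N)
    have hp0 : (0 : ℝ) < p := by exact_mod_cast hp
    push_cast
    rw [add_sub_cancel_right]
    field_simp
    ring

theorem sum_sub_mul_inv_le {p N : ℕ} (hp : 1 ≤ p) (hpN : p ≤ N) :
    ∑ t ∈ Ioc p N, ((t - p : ℕ) : ℝ) * (2 / (((t : ℝ) - 1) * t * (t + 1))) ≤ 1 / p := by
  rw [sum_sub_mul_inv_eq hp hpN]
  have h1 : (0 : ℝ) ≤ (N : ℝ) - p := sub_nonneg.2 (by exact_mod_cast hpN)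
  have h2 : (0 : ℝ) ≤ 1 / (N : ℝ) := by positivity
  have h3 : (0 : ℝ) ≤ ((N : ℝ) - p) / (N * (N + 1)) := by positivity
  linarith

theorem log_log_sub_le_sum {M N : ℕ} (hM : 2 ≤ M) (hMN : M ≤ N) :
    Real.log (Real.log N) - Real.log (Real.log M) ≤
      ∑ t ∈ Ico M N, 1 / ((t : ℝ) * Real.log t) := by
  induction N, hMN using Nat.le_induction with
  | base => simp
  | succ N hN ih =>
    rw [sum_Ico_succ_top hN]
    have hN1 : (1 : ℝ) < N := by exact_mod_cast (by omega : 1 < N)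
    have hl : 0 < Real.log N := Real.log_pos hN1
    have hl' : 0 < Real.log ((N + 1 : ℕ) : ℝ) := Real.log_pos (by push_cast; linarith)
    have h1 : Real.log ((N + 1 : ℕ) : ℝ) - Real.log N ≤ 1 / N := by
      rw [← Real.log_div (by positivity) (by positivity)]
      refine (Real.log_le_sub_one_of_pos (by positivity)).trans (le_of_eq ?_)
      push_cast
      field_simp
      ring
    have h2 : Real.log (Real.log ((N + 1 : ℕ) : ℝ)) - Real.log (Real.log N) ≤
        1 / ((N : ℝ) * Real.log N) := by
      rw [← Real.log_div hl'.ne' hl.ne']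
      refine (Real.log_le_sub_one_of_pos (by positivity)).trans ?_
      rw [div_sub_one hl.ne', ← div_div]
      gcongr
    linarith

theorem log_log_sub_le_sum_inv (P : ℕ → Prop) [DecidablePred P] {c : ℝ}
    (hc : 0 ≤ c) {M N : ℕ} (hM : 2 ≤ M) (hMN : M ≤ N + 1)
    (h : ∀ t, M ≤ t → c * (t : ℝ) ^ 2 ≤
      ∑ p ∈ Ioc 0 t with P p, Real.log p * ((t - p : ℕ) : ℝ)) :
    2 * c * (Real.log (Real.log ((N + 1 : ℕ) : ℝ)) - Real.log (Real.log M)) ≤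
      ∑ p ∈ Ioc 0 N with P p, 1 / (p : ℝ) := by
  set w : ℕ → ℝ := fun t => 2 / (((t : ℝ) - 1) * t * (t + 1)) with hw
  have hw0 : ∀ t : ℕ, 1 ≤ t → 0 ≤ w t := fun t ht => by
    have : (0 : ℝ) ≤ (t : ℝ) - 1 := sub_nonneg.2 (by exact_mod_cast ht)
    simp only [hw]
    positivity
  calc 2 * c * (Real.log (Real.log ((N + 1 : ℕ) : ℝ)) - Real.log (Real.log M))
      ≤ 2 * c * ∑ t ∈ Ico M (N + 1), 1 / ((t : ℝ) * Real.log t) := by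
        gcongr
        exact log_log_sub_le_sum hM hMN
    _ ≤ ∑ t ∈ Ico M (N + 1), w t / Real.log t *
          ∑ p ∈ Ioc 0 t with P p, Real.log p * ((t - p : ℕ) : ℝ) := by
        rw [mul_sum]
        refine sum_le_sum fun t ht => ?_
        have htM := (mem_Ico.1 ht).1
        have ht1 : (1 : ℝ) < t := by exact_mod_cast (by omega : 1 < t)
        have hl : 0 < Real.log t := Real.log_pos ht1
        have h0 : 0 ≤ w t / Real.log t := div_nonneg (hw0 t (by omega)) hl.le
        refine le_trans ?_ (mul_le_mul_of_nonneg_left (h t htM) h0)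
        have e : w t / Real.log t * (c * (t : ℝ) ^ 2) - 2 * c * (1 / ((t : ℝ) * Real.log t)) =
            2 * c / (((t : ℝ) - 1) * t * (t + 1) * Real.log t) := by
          have : (t : ℝ) - 1 ≠ 0 := by linarith
          simp only [hw]
          field_simp
          ring
        have : 0 ≤ 2 * c / (((t : ℝ) - 1) * t * (t + 1) * Real.log t) := by
          have : (0 : ℝ) ≤ (t : ℝ) - 1 := by linarith
          positivity
        linarith
    _ ≤ ∑ t ∈ Ico M (N + 1), ∑ p ∈ Ioc 0 t with P p, ((t - p : ℕ) : ℝ) * w t := by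
        refine sum_le_sum fun t ht => ?_
        have htM := (mem_Ico.1 ht).1
        have ht1 : (1 : ℝ) < t := by exact_mod_cast (by omega : 1 < t)
        have hl : 0 < Real.log t := Real.log_pos ht1
        rw [mul_sum]
        refine sum_le_sum fun p hp => ?_
        obtain ⟨hp1, hp2⟩ := mem_Ioc.1 (mem_filter.1 hp).1
        have hlp : Real.log p / Real.log t ≤ 1 := by
          rw [div_le_one hl]
          exact Real.log_le_log (by exact_mod_cast hp1) (by exact_mod_cast hp2)
        have h0 := mul_nonneg (hw0 t (by omega)) (Nat.cast_nonneg (α := ℝ) (t - p))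
        calc w t / Real.log t * (Real.log p * ((t - p : ℕ) : ℝ))
            = (w t * ((t - p : ℕ) : ℝ)) * (Real.log p / Real.log t) := by ring
          _ ≤ (w t * ((t - p : ℕ) : ℝ)) * 1 := by gcongr
          _ = _ := by ring
    _ ≤ ∑ t ∈ Ioc 0 N, ∑ p ∈ Ioc 0 t with P p, ((t - p : ℕ) : ℝ) * w t := by
        refine sum_le_sum_of_subset_of_nonneg (fun t ht => ?_) fun t ht _ => ?_
        · rw [mem_Ico] at ht
          rw [mem_Ioc]
          omega
        · exact sum_nonneg fun p _ => mul_nonneg (Nat.cast_nonneg _) (hw0 t (mem_Ioc.1 ht).1)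
    _ = ∑ p ∈ Ioc 0 N with P p, ∑ t ∈ Icc p N, ((t - p : ℕ) : ℝ) * w t := by
        refine sum_comm' fun t p => ?_
        simp only [mem_filter, mem_Ioc, mem_Icc]
        constructor
        · rintro ⟨⟨h1, h2⟩, ⟨h3, h4⟩, h5⟩
          exact ⟨⟨h4, h2⟩, ⟨h3, by omega⟩, h5⟩
        · rintro ⟨⟨h1, h2⟩, ⟨h3, h4⟩, h5⟩
          exact ⟨⟨by omega, h2⟩, ⟨h3, h1⟩, h5⟩
    _ ≤ ∑ p ∈ Ioc 0 N with P p, 1 / (p : ℝ) := by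
        refine sum_le_sum fun p hp => ?_
        obtain ⟨hp1, hp2⟩ := mem_Ioc.1 (mem_filter.1 hp).1
        rw [← Ioc_insert_left hp2, sum_insert left_notMem_Ioc]
        simpa using sum_sub_mul_inv_le hp1 hp2

theorem sub_one_dvd_carmichael {p n : ℕ} (hp : p.Prime) (hn : n ≠ 0) (h : p ∣ n) :
    p - 1 ∣ carmichael n := by
  have : NeZero n := ⟨hn⟩
  have : Fact p.Prime := ⟨hp⟩
  have h1 : Monoid.exponent (ZMod p)ˣ = p - 1 := by
    rw [IsCyclic.exponent_eq_card, Nat.card_eq_fintype_card, ZMod.card_units]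
  rw [carmichael, ← h1]
  exact MonoidHom.exponent_dvd (f := ZMod.unitsMap h) (ZMod.unitsMap_surjective h)

theorem sum_rpow_neg_le {s : ℝ} (hs : 1 < s) :
    Summable (fun n : ℕ => 1 / (n : ℝ) ^ s) ∧ ∑' n : ℕ, 1 / (n : ℝ) ^ s ≤ 1 + 1 / (s - 1) := by
  have hsum : Summable (fun n : ℕ => 1 / (n : ℝ) ^ s) := Real.summable_one_div_nat_rpow.2 hs
  refine ⟨hsum, ?_⟩
  rw [hsum.tsum_eq_zero_add]
  have h := ZetaAsymptotics.zeta_limit_aux1 hs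
  have h2 : 0 ≤ ZetaAsymptotics.termTSum s := tsum_nonneg fun n =>
    ZetaAsymptotics.term_nonneg _ _
  have h3 : 0 ≤ s * ZetaAsymptotics.termTSum s := by positivity
  have h4 : ((0 : ℕ) : ℝ) ^ s = 0 := by
    rw [Nat.cast_zero, Real.zero_rpow (by linarith)]
  rw [h4]
  push_cast
  rw [div_zero]
  linarith

/-- The completely multiplicative function `n ↦ n ^ (-s)`. -/
noncomputable def oneDivRpow (s : ℝ) : ℕ →* ℝ where
  toFun n := 1 / (n : ℝ) ^ s
  map_one' := by simp
  map_mul' m n := by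
    rw [Nat.cast_mul, Real.mul_rpow (Nat.cast_nonneg _) (Nat.cast_nonneg _)]
    simp [mul_comm]

theorem one_div_rpow_lt_one {s : ℝ} (hs : 1 < s) {p : ℕ} (hp : p.Prime) :
    1 / (p : ℝ) ^ s < 1 := by
  have h1 : (1 : ℝ) < p := by exact_mod_cast hp.one_lt
  have h2 : (1 : ℝ) < (p : ℝ) ^ s := Real.one_lt_rpow h1 (by linarith)
  rw [div_lt_one (by linarith)]
  exact h2

theorem hasSum_factoredNumbers_rpow {s : ℝ} (hs : 1 < s) (A : Finset ℕ) :
    HasSum ((Nat.factoredNumbers A).indicator fun n : ℕ => 1 / (n : ℝ) ^ s)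
      (∏ p ∈ A with p.Prime, (1 - 1 / (p : ℝ) ^ s)⁻¹) := by
  have h := (EulerProduct.summable_and_hasSum_factoredNumbers_prod_filter_prime_geometric
    (f := oneDivRpow s) (fun {p} hp => by
      rw [Real.norm_of_nonneg (by simp only [oneDivRpow, MonoidHom.coe_mk, OneHom.coe_mk]; positivity)]
      exact one_div_rpow_lt_one hs hp) A).2
  rw [← hasSum_subtype_iff_indicator]
  exact h

theorem prod_prime_le {s : ℝ} (hs : 1 < s) (A : Finset ℕ) :
    ∏ p ∈ A with p.Prime, (1 - 1 / (p : ℝ) ^ s)⁻¹ ≤ 1 + 1 / (s - 1) := by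
  obtain ⟨h1, h2⟩ := sum_rpow_neg_le hs
  refine le_trans (hasSum_le (fun n => ?_) (hasSum_factoredNumbers_rpow hs A) h1.hasSum) h2
  exact Set.indicator_le_self' (fun _ _ => by positivity) n

theorem sum_rpow_le_prod {s : ℝ} (hs : 1 < s) (P : ℕ → Prop) [DecidablePred P] (N : ℕ) :
    ∑ m ∈ Ioc 0 N with ∀ p : ℕ, p.Prime → P p → ¬ p ∣ m, 1 / (m : ℝ) ^ s ≤
      (1 + 1 / (s - 1)) * Real.exp (-∑ p ∈ Ioc 0 N with p.Prime ∧ P p, 1 / (p : ℝ) ^ s) := by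
  have hlt : ∀ p ∈ (Ioc 0 N).filter Nat.Prime, 0 < 1 - 1 / (p : ℝ) ^ s := fun p hp =>
    sub_pos.2 (one_div_rpow_lt_one hs (mem_filter.1 hp).2)
  have h1 : ∑ m ∈ Ioc 0 N with ∀ p : ℕ, p.Prime → P p → ¬ p ∣ m, 1 / (m : ℝ) ^ s ≤
      ∏ p ∈ {p ∈ Ioc 0 N | ¬ P p} with p.Prime, (1 - 1 / (p : ℝ) ^ s)⁻¹ := by
    refine le_trans (le_of_eq ?_) (sum_le_hasSum
      {m ∈ Ioc 0 N | ∀ p : ℕ, p.Prime → P p → ¬ p ∣ m} (fun n _ => ?_)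
      (hasSum_factoredNumbers_rpow hs {p ∈ Ioc 0 N | ¬ P p}))
    · refine sum_congr rfl fun m hm => ?_
      rw [mem_filter, mem_Ioc] at hm
      rw [Set.indicator_of_mem]
      refine ⟨by omega, fun p hp => ?_⟩
      have hp' := Nat.prime_of_mem_primeFactorsList hp
      have hd := Nat.dvd_of_mem_primeFactorsList hp
      rw [mem_filter, mem_Ioc]
      exact ⟨⟨hp'.pos, (Nat.le_of_dvd hm.1.1 hd).trans hm.1.2⟩, fun h => hm.2 p hp' h hd⟩
    · exact Set.indicator_nonneg (fun _ _ => by positivity) n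
  have h2 : (∏ p ∈ {p ∈ Ioc 0 N | ¬ P p} with p.Prime, (1 - 1 / (p : ℝ) ^ s)⁻¹) =
      (∏ p ∈ Ioc 0 N with p.Prime, (1 - 1 / (p : ℝ) ^ s)⁻¹) *
        ∏ p ∈ Ioc 0 N with p.Prime ∧ P p, (1 - 1 / (p : ℝ) ^ s) := by
    rw [← prod_filter_mul_prod_filter_not ((Ioc 0 N).filter Nat.Prime) P
      (fun p : ℕ => (1 - 1 / (p : ℝ) ^ s)⁻¹), filter_filter, filter_filter, filter_filter]
    have hone : ∏ p ∈ Ioc 0 N with p.Prime ∧ P p,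
        ((1 - 1 / (p : ℝ) ^ s)⁻¹ * (1 - 1 / (p : ℝ) ^ s)) = 1 := by
      refine prod_eq_one fun p hp => inv_mul_cancel₀ (hlt p ?_).ne'
      simp only [mem_filter] at hp ⊢
      exact ⟨hp.1, hp.2.1⟩
    rw [mul_right_comm, ← prod_mul_distrib, hone, one_mul]
    refine prod_congr ?_ fun _ _ => rfl
    ext p
    simp only [mem_filter, mem_Ioc]
    tauto
  rw [h2] at h1
  refine h1.trans ?_
  have hs' : 0 < 1 / (s - 1) := by
    have : 0 < s - 1 := by linarith
    positivity
  refine mul_le_mul (prod_prime_le hs _) ?_ ?_ (by linarith)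
  · rw [← sum_neg_distrib, Real.exp_sum]
    refine prod_le_prod (fun p hp => ?_) fun p hp => ?_
    · exact (hlt p (by simp only [mem_filter] at hp ⊢; exact ⟨hp.1, hp.2.1⟩)).le
    · linarith [Real.add_one_le_exp (-(1 / (p : ℝ) ^ s))]
  · exact prod_nonneg fun p hp =>
      (hlt p (by simp only [mem_filter] at hp ⊢; exact ⟨hp.1, hp.2.1⟩)).le

theorem sum_inv_coprime_le : ∃ K : ℝ, 0 ≤ K ∧ ∀ (P : ℕ → Prop) [DecidablePred P] (N : ℕ), 3 ≤ N →
    ∑ m ∈ Ioc 0 N with ∀ p : ℕ, p.Prime → P p → ¬ p ∣ m, 1 / (m : ℝ) ≤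
      K * Real.log N * Real.exp (-∑ p ∈ Ioc 0 N with p.Prime ∧ P p, 1 / (p : ℝ)) := by
  obtain ⟨C, hC, h⟩ := sum_vonMangoldt_div_le
  refine ⟨2 * Real.exp (2 + C), by positivity, fun P _ N hN => ?_⟩
  have hl : 1 ≤ Real.log N := by
    rw [Real.le_log_iff_exp_le (by positivity)]
    have : (3 : ℝ) ≤ N := by exact_mod_cast hN
    linarith [Real.exp_one_lt_d9]
  set s := 1 + 1 / Real.log N with hs
  have hs1 : 1 < s := by
    have : 0 < 1 / Real.log N := by positivity
    linarith
  have key : ∀ m : ℕ, 0 < m → (m : ℝ) ^ s = m * Real.exp (Real.log m / Real.log N) := by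
    intro m hm
    have hm' : (0 : ℝ) < m := by exact_mod_cast hm
    rw [hs, Real.rpow_add hm', Real.rpow_one, Real.rpow_def_of_pos hm', mul_one_div]
  have h1 : ∑ m ∈ Ioc 0 N with ∀ p : ℕ, p.Prime → P p → ¬ p ∣ m, 1 / (m : ℝ) ≤
      Real.exp 1 * ∑ m ∈ Ioc 0 N with ∀ p : ℕ, p.Prime → P p → ¬ p ∣ m, 1 / (m : ℝ) ^ s := by
    rw [mul_sum]
    refine sum_le_sum fun m hm => ?_
    obtain ⟨hm1, hm2⟩ := mem_Ioc.1 (mem_filter.1 hm).1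
    have hm' : (0 : ℝ) < m := by exact_mod_cast hm1
    have : Real.exp (Real.log m / Real.log N) ≤ Real.exp 1 := by
      rw [Real.exp_le_exp, div_le_one (by linarith)]
      exact Real.log_le_log hm' (by exact_mod_cast hm2)
    rw [key m hm1, mul_one_div, div_le_div_iff₀ hm' (by positivity), one_mul, mul_comm]
    gcongr
  have h2 : ∑ p ∈ Ioc 0 N with p.Prime ∧ P p, 1 / (p : ℝ) - (1 + C) ≤
      ∑ p ∈ Ioc 0 N with p.Prime ∧ P p, 1 / (p : ℝ) ^ s := by
    have h3 : ∑ p ∈ Ioc 0 N with p.Prime ∧ P p, (1 / (p : ℝ) - 1 / (p : ℝ) ^ s) ≤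
        ∑ k ∈ Ioc 0 N, Λ k / (k : ℝ) / Real.log N := by
      refine le_trans (sum_le_sum fun p hp => ?_)
        (sum_le_sum_of_subset_of_nonneg (filter_subset (fun p => p.Prime ∧ P p) _)
          fun k _ _ => div_nonneg (div_nonneg ArithmeticFunction.vonMangoldt_nonneg
            (Nat.cast_nonneg _)) (by linarith))
      rw [mem_filter, mem_Ioc] at hp
      have hp' : (0 : ℝ) < p := by exact_mod_cast hp.1.1
      rw [key p hp.1.1, ArithmeticFunction.vonMangoldt_apply_prime hp.2.1, ← one_div_mul_one_div,
        one_div (Real.exp _), ← Real.exp_neg]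
      have := Real.add_one_le_exp (-(Real.log p / Real.log N))
      calc 1 / (p : ℝ) - 1 / p * Real.exp (-(Real.log p / Real.log N))
          = 1 / (p : ℝ) * (1 - Real.exp (-(Real.log p / Real.log N))) := by ring
        _ ≤ 1 / (p : ℝ) * (Real.log p / Real.log N) := by
          gcongr
          linarith
        _ = _ := by ring
    rw [sum_sub_distrib, ← sum_div] at h3
    have h4 : (∑ k ∈ Ioc 0 N, Λ k / (k : ℝ)) / Real.log N ≤ 1 + C := by
      rw [div_le_iff₀ (by linarith)]
      have := h N (by omega)
      nlinarith
    linarith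
  have h5 := sum_rpow_le_prod hs1 P N
  have h6 : 1 + 1 / (s - 1) ≤ 2 * Real.log N := by
    rw [hs, add_sub_cancel_left, one_div_one_div]
    linarith
  calc _ ≤ Real.exp 1 * ((2 * Real.log N) * Real.exp (1 + C -
        ∑ p ∈ Ioc 0 N with p.Prime ∧ P p, 1 / (p : ℝ))) := by
        refine h1.trans (mul_le_mul_of_nonneg_left (h5.trans ?_) (Real.exp_pos 1).le)
        refine mul_le_mul h6 ?_ (Real.exp_pos _).le (by positivity)
        rw [Real.exp_le_exp]
        linarith
    _ = _ := by
        rw [sub_eq_add_neg, Real.exp_add (1 + C), show 2 + C = 1 + (1 + C) by ring,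
          Real.exp_add 1 (1 + C)]
        ring

theorem card_mul_log_le (S : ℕ → Prop) [DecidablePred S] (hS : ∀ m n, S (m * n) → S m) (N : ℕ) :
    (#{n ∈ Ioc 0 N | S n} : ℝ) * Real.log N ≤
      (Real.log 4 + 5) * N * ∑ m ∈ Ioc 0 N with S m, 1 / (m : ℝ) := by
  have h1 : ∀ n ∈ (Ioc 0 N).filter S, Real.log N ≤ N * (1 / (n : ℝ)) + Real.log n := by
    intro n hn
    obtain ⟨h1, h2⟩ := mem_Ioc.1 (mem_filter.1 hn).1
    have hn' : (0 : ℝ) < n := by exact_mod_cast h1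
    have hN' : (0 : ℝ) < N := by exact_mod_cast h1.trans_le h2
    have := Real.log_le_sub_one_of_pos (div_pos hN' hn')
    rw [Real.log_div hN'.ne' hn'.ne'] at this
    rw [mul_one_div]
    linarith
  have h2 : ∑ n ∈ Ioc 0 N with S n, Real.log n ≤
      (Real.log 4 + 4) * N * ∑ m ∈ Ioc 0 N with S m, 1 / (m : ℝ) := by
    have e := sum_mul_apply_mul (ArithmeticFunction.zeta : ArithmeticFunction ℝ) Λ
      (fun n => if S n then 1 else 0) N
    rw [ArithmeticFunction.zeta_mul_vonMangoldt] at e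
    have e1 : ∑ n ∈ Ioc 0 N with S n, Real.log n =
        ∑ n ∈ Ioc 0 N, ArithmeticFunction.log n * (if S n then 1 else 0) := by
      rw [sum_filter]
      refine sum_congr rfl fun n _ => ?_
      rw [ArithmeticFunction.log_apply, mul_ite, mul_one, mul_zero]
    rw [e1, e, sum_filter, mul_sum]
    refine sum_le_sum fun n hn => ?_
    have hn0 := (mem_Ioc.1 hn).1
    have hz : (ArithmeticFunction.zeta : ArithmeticFunction ℝ) n = 1 := by
      rw [ArithmeticFunction.natCoe_apply, ArithmeticFunction.zeta_apply_ne hn0.ne', Nat.cast_one]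
    rw [hz, one_mul]
    by_cases hs : S n
    · rw [if_pos hs]
      calc ∑ m ∈ Ioc 0 (N / n), Λ m * (if S (n * m) then 1 else 0)
          ≤ ∑ m ∈ Ioc 0 (N / n), Λ m := sum_le_sum fun m _ => by
            have : 0 ≤ Λ m := ArithmeticFunction.vonMangoldt_nonneg
            split_ifs <;> linarith
        _ = Chebyshev.psi ((N / n : ℕ) : ℝ) := (psi_natCast _).symm
        _ ≤ (Real.log 4 + 4) * ((N / n : ℕ) : ℝ) :=
            Chebyshev.psi_le_const_mul_self (Nat.cast_nonneg _)
        _ ≤ (Real.log 4 + 4) * ((N : ℝ) / n) := by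
            gcongr
            exact Nat.cast_div_le
        _ = _ := by ring
    · rw [if_neg hs, mul_zero]
      refine (sum_eq_zero fun m _ => ?_).le
      rw [if_neg fun h => hs (hS n m h), mul_zero]
  calc (#{n ∈ Ioc 0 N | S n} : ℝ) * Real.log N
      = ∑ n ∈ Ioc 0 N with S n, Real.log N := by rw [sum_const, nsmul_eq_mul]
    _ ≤ ∑ n ∈ Ioc 0 N with S n, (N * (1 / (n : ℝ)) + Real.log n) := sum_le_sum h1
    _ ≤ _ := by
      rw [sum_add_distrib, ← mul_sum]
      linarith

theorem card_coprime_le : ∃ K : ℝ, 0 ≤ K ∧ ∀ (P : ℕ → Prop) [DecidablePred P] (N : ℕ), 3 ≤ N →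
    (#{n ∈ Ioc 0 N | ∀ p : ℕ, p.Prime → P p → ¬ p ∣ n} : ℝ) ≤
      K * N * Real.exp (-∑ p ∈ Ioc 0 N with p.Prime ∧ P p, 1 / (p : ℝ)) := by
  obtain ⟨K, hK, h⟩ := sum_inv_coprime_le
  refine ⟨(Real.log 4 + 5) * K, by positivity, fun P _ N hN => ?_⟩
  have hl : 0 < Real.log N := Real.log_pos (by exact_mod_cast (by omega : 1 < N))
  have h1 := card_mul_log_le (fun n => ∀ p : ℕ, p.Prime → P p → ¬ p ∣ n)
    (fun m n hmn p hp hP hd => hmn p hp hP (hd.mul_right n)) N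
  have h2 := mul_le_mul_of_nonneg_left (h P N hN)
    (by positivity : 0 ≤ (Real.log 4 + 5) * (N : ℝ))
  refine le_of_mul_le_mul_right ((h1.trans h2).trans (le_of_eq ?_)) hl
  ring

theorem exists_forall_sum_inv_ge : ∃ C : ℝ, 0 < C ∧ ∀ x g ε : ℝ, 1 < x → 0 < g →
    C ≤ g * Real.log x → 1 / (g * Real.log x) ≤ ε → ε ≤ 1 / 4 →
    ε / 2 * (Real.log (1 / g) - Real.log 30) ≤
      ∑ p ∈ Ioc 0 ⌊x⌋₊ with p.Prime ∧
        ∃ q ∈ {q ∈ Ioc ⌊x ^ g⌋₊ ⌊(x ^ g) ^ (1 + ε)⌋₊ | q.Prime}, q ∣ p - 1, 1 / (p : ℝ) := by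
  obtain ⟨Y, hY1, hY⟩ := sum_log_prime_dvd_sub_one_ge
  obtain ⟨T, hT3, hT⟩ := sum_prime_inv_sub_one_bounds
  refine ⟨T + Y, by positivity, fun x g ε hx hg hC hε hε' => ?_⟩
  have hx0 : 0 < x := by linarith
  have hlx : 0 < Real.log x := Real.log_pos hx
  set z := x ^ g with hz
  have hlz : Real.log z = g * Real.log x := Real.log_rpow hx0 g
  have hz0 : 0 < z := Real.rpow_pos_of_pos hx0 g
  have hY0 : (1 : ℝ) ≤ Y := by exact_mod_cast hY1
  have hzTY : T + Y + 1 ≤ z := by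
    rw [← Real.exp_log hz0, hlz]
    exact (Real.add_one_le_exp _).trans (Real.exp_le_exp.2 hC)
  obtain ⟨y, hy⟩ : ∃ y : ℕ, y = ⌊z⌋₊ := ⟨_, rfl⟩
  have hyz : (y : ℝ) ≤ z := hy ▸ Nat.floor_le hz0.le
  have hzy : z < y + 1 := hy ▸ Nat.lt_floor_add_one z
  have hy3 : (3 : ℝ) ≤ y := by linarith
  have hyY : Y ≤ y := by
    have : (Y : ℝ) ≤ y := by linarith
    exact_mod_cast this
  have hly : 0 < Real.log y := Real.log_pos (by linarith)
  have hlyz : Real.log y ≤ Real.log z := Real.log_le_log (by linarith) hyz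
  have hlzy : Real.log z ≤ 2 * Real.log y := by
    have : Real.log ((y : ℝ) ^ 2) = 2 * Real.log y := by
      rw [Real.log_pow]
      norm_num
    rw [← this]
    refine Real.log_le_log hz0 ?_
    nlinarith
  rw [← hlz] at hε
  obtain ⟨hQ1, hQ2, hQ3⟩ := hT z ε (by linarith) hε hε'
  have hε0 : 0 < ε := lt_of_lt_of_le (by have := hly.trans_le hlyz; positivity) hε
  have hεy : 1 / (2 * Real.log y) ≤ ε := (one_div_le_one_div_of_le (by linarith) hlzy).trans hε
  rw [← hy] at hQ1 hQ2 hQ3 ⊢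
  set Q := {q ∈ Ioc y ⌊z ^ (1 + ε)⌋₊ | q.Prime} with hQ
  have hE0 : 0 ≤ ∑ p ∈ Ioc 0 ⌊x⌋₊ with p.Prime ∧ ∃ q ∈ Q, q ∣ p - 1, 1 / (p : ℝ) :=
    sum_nonneg fun p _ => by positivity
  rcases le_or_gt (Real.log (1 / g) - Real.log 30) 0 with hD | hD
  · exact (mul_nonpos_of_nonneg_of_nonpos (by positivity) hD).trans hE0
  have hlx' : Real.log x = Real.log z * (1 / g) := by
    rw [hlz]
    field_simp
  have hxN : x ≤ ((⌊x⌋₊ + 1 : ℕ) : ℝ) := by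
    push_cast
    exact (Nat.lt_floor_add_one x).le
  have hg30 : 30 < 1 / g := (Real.log_lt_log_iff (by norm_num) (by positivity)).1 (by linarith)
  have hyN : y ^ 30 ≤ ⌊x⌋₊ + 1 := by
    have : ((y : ℝ) ^ 30) ≤ x := by
      rw [← Real.log_le_log_iff (by positivity) hx0, Real.log_pow, hlx', mul_comm]
      push_cast
      exact mul_le_mul hlyz hg30.le (by norm_num) (hly.le.trans hlyz)
    exact_mod_cast this.trans hxN
  have hM : 2 ≤ y ^ 30 := by
    have : 3 ≤ y := by exact_mod_cast hy3
    exact (by omega : 2 ≤ y).trans (Nat.le_self_pow (by norm_num) y)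
  have main := log_log_sub_le_sum_inv (fun p => p.Prime ∧ ∃ q ∈ Q, q ∣ p - 1)
    (c := 0.253 * ε) (by positivity) hM hyN fun t ht =>
      hY y t Q ε hyY (fun q hq => (mem_filter.1 hq).2) hQ1 ht hεy hε' hQ2 hQ3
  have e1 : Real.log (Real.log ((y ^ 30 : ℕ) : ℝ)) = Real.log 30 + Real.log (Real.log y) := by
    rw [Nat.cast_pow, Real.log_pow, Real.log_mul (by norm_num) hly.ne']
    norm_num
  have e2 : Real.log (1 / g) + Real.log (Real.log y) ≤
      Real.log (Real.log ((⌊x⌋₊ + 1 : ℕ) : ℝ)) := by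
    rw [← Real.log_mul (by positivity) hly.ne']
    refine Real.log_le_log (by positivity) (le_trans ?_ (Real.log_le_log hx0 hxN))
    rw [hlx', mul_comm]
    gcongr
  rw [e1] at main
  refine le_trans ?_ main
  nlinarith [mul_pos hε0 hD, mul_le_mul_of_nonneg_left e2 hε0.le]

theorem card_no_prime_dvd_carmichael_le : ∃ C K : ℝ, 0 < C ∧ 0 < K ∧ ∀ᶠ x : ℝ in atTop,
    ∀ g ε : ℝ, C / Real.log x ≤ g → g ≤ 1 / 10 →
      1 / (g * Real.log x) ≤ ε → ε ≤ 1 / 4 →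
      (((Finset.Icc 1 ⌊x⌋₊).filter
        (fun n => ¬ ∃ q : ℕ, q.Prime ∧ q ∣ carmichael n ∧
          x ^ g < (q : ℝ) ∧ (q : ℝ) ≤ x ^ (g * (1 + ε)))).card : ℝ) ≤
        K * g ^ (ε / 2) * Real.log (1 / g) * x := by
  obtain ⟨C, hC, hsum⟩ := exists_forall_sum_inv_ge
  obtain ⟨K, hK, hcard⟩ := card_coprime_le
  refine ⟨C, 30 * K + 1, hC, by positivity, ?_⟩
  filter_upwards [eventually_ge_atTop (3 : ℝ)] with x hx g ε hCg hg hε hε'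
  have hx0 : 0 < x := by linarith
  have hlx : 0 < Real.log x := Real.log_pos (by linarith)
  have hg0 : 0 < g := lt_of_lt_of_le (by positivity) hCg
  have hε0 : 0 < ε := lt_of_lt_of_le (by positivity) hε
  have hE := hsum x g ε (by linarith) hg0 ((div_le_iff₀ hlx).1 hCg) hε hε'
  set Q := {q ∈ Ioc ⌊x ^ g⌋₊ ⌊(x ^ g) ^ (1 + ε)⌋₊ | q.Prime} with hQ
  have hcard' := hcard (fun p => ∃ q ∈ Q, q ∣ p - 1) ⌊x⌋₊ (Nat.le_floor (by exact_mod_cast hx))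
  have hsub : (Finset.Icc 1 ⌊x⌋₊).filter (fun n => ¬ ∃ q : ℕ, q.Prime ∧ q ∣ carmichael n ∧
        x ^ g < (q : ℝ) ∧ (q : ℝ) ≤ x ^ (g * (1 + ε))) ⊆
      {n ∈ Ioc 0 ⌊x⌋₊ | ∀ p : ℕ, p.Prime → (∃ q ∈ Q, q ∣ p - 1) → ¬ p ∣ n} := by
    intro n hn
    rw [mem_filter, mem_Icc] at hn
    rw [mem_filter, mem_Ioc]
    refine ⟨by omega, fun p hp ⟨q, hq, hqp⟩ hpn => hn.2 ⟨q, ?_⟩⟩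
    rw [hQ, mem_filter, mem_Ioc] at hq
    refine ⟨hq.2, hqp.trans (sub_one_dvd_carmichael hp (by omega) hpn),
      Nat.lt_of_floor_lt hq.1.1, ?_⟩
    rw [Real.rpow_mul hx0.le]
    exact (Nat.cast_le.2 hq.1.2).trans (Nat.floor_le (by positivity))
  have hexp : Real.exp (-∑ p ∈ Ioc 0 ⌊x⌋₊ with p.Prime ∧ ∃ q ∈ Q, q ∣ p - 1, 1 / (p : ℝ)) ≤
      30 * g ^ (ε / 2) := by
    calc _ ≤ Real.exp (-(ε / 2 * (Real.log (1 / g) - Real.log 30))) :=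
          Real.exp_le_exp.2 (neg_le_neg hE)
      _ = Real.exp (Real.log 30 * (ε / 2)) * Real.exp (Real.log g * (ε / 2)) := by
          rw [← Real.exp_add, one_div, Real.log_inv]
          ring_nf
      _ ≤ Real.exp (Real.log 30) * Real.exp (Real.log g * (ε / 2)) := by
          gcongr
          have : 0 ≤ Real.log 30 := Real.log_nonneg (by norm_num)
          nlinarith
      _ = 30 * g ^ (ε / 2) := by
          rw [Real.exp_log (by norm_num), Real.rpow_def_of_pos hg0]
  have hlg : 1 ≤ Real.log (1 / g) := by
    rw [Real.le_log_iff_exp_le (by positivity), le_div_iff₀ hg0]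
    nlinarith [Real.exp_one_lt_d9, Real.exp_pos 1]
  have hgp : 0 < g ^ (ε / 2) := Real.rpow_pos_of_pos hg0 _
  calc _ ≤ (#{n ∈ Ioc 0 ⌊x⌋₊ | ∀ p : ℕ, p.Prime → (∃ q ∈ Q, q ∣ p - 1) → ¬ p ∣ n} : ℝ) :=
        Nat.cast_le.2 (card_le_card hsub)
    _ ≤ K * (⌊x⌋₊ : ℝ) * (30 * g ^ (ε / 2)) :=
        hcard'.trans (mul_le_mul_of_nonneg_left hexp (by positivity))
    _ ≤ K * x * (30 * g ^ (ε / 2)) := by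
        gcongr
        exact Nat.floor_le hx0.le
    _ = (30 * K) * g ^ (ε / 2) * 1 * x := by ring
    _ ≤ (30 * K + 1) * g ^ (ε / 2) * Real.log (1 / g) * x := by
        gcongr
        linarith

end

theorem stmt_13 : ∃ C K : ℝ, 0 < C ∧ 0 < K ∧ ∀ᶠ x : ℝ in atTop,
    ∀ g ε : ℝ, C / Real.log x ≤ g → g ≤ 1 / 10 →
      1 / (g * Real.log x) ≤ ε → ε ≤ 1 / 4 →
      (((Finset.Icc 1 ⌊x⌋₊).filter
        (fun n => ¬ ∃ q : ℕ, q.Prime ∧ q ∣ carmichael n ∧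
          x ^ g < (q : ℝ) ∧ (q : ℝ) ≤ x ^ (g * (1 + ε)))).card : ℝ) ≤
        K * g ^ (ε / 2) * Real.log (1 / g) * x := by
  exact card_no_prime_dvd_carmichael_le
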